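/- arXiv:2010.11556 — 7 statements merged into one kernel-verified Lean document; each statement's English description precedes it below -/
import Mathlib

section
/- Let k ≥ 1 be a natural number, let 0 < α < 1, and let E be a nonempty open interval in ℝ. Then sup{ L(α,f) : f ∈ C^k(E,ℝ) } = (1-α)/k, i.e. the supremum over all k-times continuously differentiable functions f : E → ℝ of the Hausdorff dimension of the set {y ∈ ℝ : dim_H f⁻¹(y) ≥ α} equals (1-α)/k. -/
open MeasureTheory Set

open scoped NNReal ENNReal Topology
open Filter

namespace LevelSets

/-! ### Self-similar digit sets -/

lemma ofDigits_le_one_sub_inv {B : ℕ} (x : ℕ → Fin B) (hx : (x 0 : ℕ) + 2 ≤ B) :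
    Real.ofDigits x ≤ 1 - (B : ℝ)⁻¹ := by
  have hB : (0 : ℝ) < B := by exact_mod_cast (by omega : 0 < B)
  have hx' : ((x 0 : ℕ) : ℝ) + 2 ≤ B := by exact_mod_cast hx
  rw [Real.ofDigits_eq_sum_add_ofDigits x 1]
  have h := Real.ofDigits_le_one (fun i ↦ x (i + 1))
  simp only [Finset.range_one, Finset.sum_singleton, Real.ofDigitsTerm, zero_add, pow_one]
  calc ((x 0 : ℕ) : ℝ) * (B : ℝ)⁻¹ + (B : ℝ)⁻¹ * Real.ofDigits (fun i ↦ x (i + 1))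
      ≤ (B - 2 : ℝ) * (B : ℝ)⁻¹ + (B : ℝ)⁻¹ * 1 := by
        gcongr
        linarith
    _ = 1 - (B : ℝ)⁻¹ := by field_simp; ring

/-- Digit expansions that first differ at place `n` and avoid the top digit are separated. -/
lemma inv_pow_le_abs_ofDigits_sub {B : ℕ} {x y : ℕ → Fin B} {n : ℕ}
    (hxy : ∀ i < n, x i = y i) (hn : x n ≠ y n)
    (hx : ∀ i, (x i : ℕ) + 2 ≤ B) (hy : ∀ i, (y i : ℕ) + 2 ≤ B) :
    ((B : ℝ) ^ (n + 2))⁻¹ ≤ |Real.ofDigits x - Real.ofDigits y| := by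
  wlog hlt : (y n : ℕ) < x n generalizing x y
  · rw [abs_sub_comm]
    refine this (fun i hi ↦ (hxy i hi).symm) hn.symm hy hx ?_
    have : (x n : ℕ) ≠ y n := fun h ↦ hn (Fin.ext h)
    omega
  have hB : (0 : ℝ) < B := by
    have := hx 0
    exact_mod_cast (by omega : 0 < B)
  have hlt' : ((y n : ℕ) : ℝ) + 1 ≤ (x n : ℕ) := by exact_mod_cast hlt
  have h1 : ∑ i ∈ Finset.range n, Real.ofDigitsTerm x i =
      ∑ i ∈ Finset.range n, Real.ofDigitsTerm y i :=
    Finset.sum_congr rfl fun i hi ↦ by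
      simp [Real.ofDigitsTerm, hxy i (Finset.mem_range.mp hi)]
  refine le_trans ?_ (le_abs_self _)
  rw [Real.ofDigits_eq_sum_add_ofDigits x (n + 1), Real.ofDigits_eq_sum_add_ofDigits y (n + 1),
    Finset.sum_range_succ, Finset.sum_range_succ, h1]
  have h2 := Real.ofDigits_nonneg (fun i ↦ x (i + (n + 1)))
  have h3 := ofDigits_le_one_sub_inv (fun i ↦ y (i + (n + 1))) (hy _)
  have h4 : ((B : ℝ) ^ (n + 2))⁻¹ = ((B : ℝ) ^ (n + 1))⁻¹ * (B : ℝ)⁻¹ := by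
    rw [← mul_inv, ← pow_succ]
  have h5 : (0 : ℝ) ≤ ((B : ℝ) ^ (n + 1))⁻¹ := by positivity
  simp only [Real.ofDigitsTerm]
  rw [h4]
  nlinarith [mul_nonneg h5 (by linarith : (0 : ℝ) ≤ ((x n : ℕ) : ℝ) - (y n : ℕ) - 1
    + Real.ofDigits (fun i ↦ x (i + (n + 1)))
    + (1 - (B : ℝ)⁻¹ - Real.ofDigits (fun i ↦ y (i + (n + 1)))))]

/-- A set of numbers in base `B` with `Q ≥ B ^ s` admissible digits at each place has Hausdorff
dimension at least `s`. -/
lemma le_dimH_range_ofDigits {B Q : ℕ} {s : ℝ≥0} (hs : 0 < s) (hQ : 2 ≤ Q)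
    (hBQ : (B : ℝ) ^ (s : ℝ) ≤ Q) (e : ℕ → Fin Q → Fin B)
    (he : ∀ n, Function.Injective (e n)) (heB : ∀ n q, (e n q : ℕ) + 2 ≤ B) :
    (s : ℝ≥0∞) ≤ dimH (range fun u : ℕ → Fin Q ↦ Real.ofDigits fun n ↦ e n (u n)) := by
  set F : (ℕ → Fin Q) → ℝ := fun u ↦ Real.ofDigits fun n ↦ e n (u n) with hF
  have : Nonempty (Fin Q) := ⟨⟨0, by omega⟩⟩
  have hB : 0 < B := Fin.pos (e 0 ⟨0, by omega⟩)
  have hB' : (0 : ℝ) < B := by exact_mod_cast hB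
  have key : ∀ u v : ℕ → Fin Q, u ≠ v → ∃ n, (∀ i < n, u i = v i) ∧
      ((B : ℝ) ^ (n + 2))⁻¹ ≤ |F u - F v| := by
    intro u v huv
    have hex : ∃ n, u n ≠ v n := Function.ne_iff.mp huv
    refine ⟨Nat.find hex, fun i hi ↦ not_not.mp (Nat.find_min hex hi), ?_⟩
    refine inv_pow_le_abs_ofDigits_sub (fun i hi ↦ ?_) (fun h ↦ Nat.find_spec hex (he _ h))
      (fun i ↦ heB _ _) (fun i ↦ heB _ _)
    rw [not_not.mp (Nat.find_min hex hi)]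
  have hinj : Function.Injective F := by
    intro u v huv
    by_contra hne
    obtain ⟨n, -, h⟩ := key u v hne
    rw [huv, sub_self, abs_zero] at h
    have : (0 : ℝ) < ((B : ℝ) ^ (n + 2))⁻¹ := by positivity
    linarith
  have hold : HolderOnWith (((B : ℝ≥0) ^ 2) ^ (s : ℝ)) s
      (fun x ↦ Real.ofDigits (Function.invFun F x)) (range F) := by
    rintro _ ⟨u, rfl⟩ _ ⟨v, rfl⟩
    simp only [Function.leftInverse_invFun hinj u, Function.leftInverse_invFun hinj v]
    rcases eq_or_ne u v with rfl | huv
    · simp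
    obtain ⟨n, hn, h⟩ := key u v huv
    have h1 := Real.abs_ofDigits_sub_ofDigits_le hn
    rw [edist_dist, edist_dist, ENNReal.ofReal_rpow_of_nonneg dist_nonneg s.coe_nonneg,
      ← ENNReal.ofReal_coe_nnreal, ← ENNReal.ofReal_mul (NNReal.coe_nonneg _)]
    refine ENNReal.ofReal_le_ofReal ?_
    rw [Real.dist_eq, Real.dist_eq]
    push_cast
    calc |Real.ofDigits u - Real.ofDigits v| ≤ ((Q : ℝ) ^ n)⁻¹ := h1
      _ ≤ (((B : ℝ) ^ (s : ℝ)) ^ n)⁻¹ := by gcongr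
      _ = ((B : ℝ) ^ 2) ^ (s : ℝ) * (((B : ℝ) ^ (n + 2))⁻¹) ^ (s : ℝ) := by
        rw [← Real.mul_rpow (by positivity) (by positivity), ← Real.rpow_natCast,
          ← Real.rpow_mul hB'.le, mul_comm (s : ℝ), Real.rpow_mul hB'.le, Real.rpow_natCast,
          ← Real.inv_rpow (by positivity)]
        congr 1
        field_simp
        ring
      _ ≤ _ := by gcongr
  have himg := hold.dimH_image_le hs
  have hsub : Icc (0 : ℝ) 1 ⊆ (fun x ↦ Real.ofDigits (Function.invFun F x)) '' range F := by
    intro x hx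
    obtain ⟨u, -, rfl⟩ := Real.ofDigits_SurjOn (b := Q) (by omega) hx
    exact ⟨F u, mem_range_self u, by simp only [Function.leftInverse_invFun hinj u]⟩
  have hone : dimH (Icc (0 : ℝ) 1) = 1 := by
    rw [Real.dimH_of_nonempty_interior (by simp)]
    simp
  have h1 : 1 ≤ dimH (range F) / (s : ℝ≥0∞) := hone ▸ (dimH_mono hsub).trans himg
  rw [ENNReal.le_div_iff_mul_le (by simp [hs.ne']) (by simp), one_mul] at h1
  exact h1

/-! ### A smooth function with prescribed level sets -/

/-- A smooth periodic function that takes the value `p` on the `p`-th block of `[0, 1/2]`. -/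
lemma exists_periodic_step {N P W : ℕ} (hN : 2 * P * W ≤ N) (hN0 : 0 < N) (hW : 1 ≤ W) :
    ∃ g : ℝ → ℝ, ContDiff ℝ (⊤ : ℕ∞) g ∧ Function.Periodic g 1 ∧
      ∀ p < P, ∀ x : ℝ, ((p * W + 1 : ℕ) : ℝ) / N ≤ x → x ≤ (((p + 1) * W : ℕ) : ℝ) / N →
        g x = p := by
  have hN' : (0 : ℝ) < N := by exact_mod_cast hN0
  set c : ℕ → ℝ := fun m ↦ Real.cos (2 * Real.pi * (m / N)) with hc
  have hcos : ∀ {x y : ℝ}, 0 ≤ x → x ≤ y → y ≤ 1 / 2 →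
      Real.cos (2 * Real.pi * y) ≤ Real.cos (2 * Real.pi * x) := by
    intro x y hx hxy hy
    have := Real.pi_pos
    exact Real.cos_le_cos_of_nonneg_of_le_pi (by positivity) (by nlinarith) (by gcongr)
  have hhalf : ∀ m ≤ P * W, (m : ℝ) / N ≤ 1 / 2 := by
    intro m hm
    rw [div_le_div_iff₀ hN' (by norm_num)]
    exact_mod_cast (by nlinarith : m * 2 ≤ 1 * N)
  have hgap : ∀ p < P, 0 < c (p * W) - c (p * W + 1) := by
    intro p hp
    have hpi := Real.pi_pos
    have h1 := hhalf (p * W + 1) (by nlinarith)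
    rw [sub_pos]
    refine Real.cos_lt_cos_of_nonneg_of_le_pi (by positivity) (by nlinarith) ?_
    gcongr
    simp
  refine ⟨fun x ↦ ∑ p ∈ Finset.range P,
    Real.smoothTransition ((c (p * W) - Real.cos (2 * Real.pi * x)) /
      (c (p * W) - c (p * W + 1))) - 1, ?_, ?_, ?_⟩
  · refine ContDiff.sub (ContDiff.sum fun p _ ↦ ?_) contDiff_const
    refine Real.smoothTransition.contDiff.comp ?_
    refine ContDiff.div_const (contDiff_const.sub ?_) _
    exact Real.contDiff_cos.comp (contDiff_const.mul contDiff_id)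
  · intro x
    simp only [mul_add, mul_one, Real.cos_add_two_pi]
  · intro p hp x hx1 hx2
    have hx0 : 0 ≤ x := le_trans (by positivity) hx1
    have hxh : x ≤ 1 / 2 := hx2.trans (hhalf _ (by gcongr; omega))
    have hterm : ∀ p' ∈ Finset.range P,
        Real.smoothTransition ((c (p' * W) - Real.cos (2 * Real.pi * x)) /
          (c (p' * W) - c (p' * W + 1))) = if p' ∈ Finset.range (p + 1) then 1 else 0 := by
      intro p' hp'
      rw [Finset.mem_range] at hp'
      split_ifs with h
      · rw [Finset.mem_range] at h
        apply Real.smoothTransition.one_of_one_le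
        rw [one_le_div (hgap p' hp')]
        have : Real.cos (2 * Real.pi * x) ≤ c (p' * W + 1) := by
          refine hcos (by positivity) (le_trans ?_ hx1) hxh
          gcongr
          omega
        linarith
      · rw [Finset.mem_range] at h
        apply Real.smoothTransition.zero_of_nonpos
        refine div_nonpos_of_nonpos_of_nonneg ?_ (hgap p' hp').le
        have : c (p' * W) ≤ Real.cos (2 * Real.pi * x) := by
          refine hcos hx0 (hx2.trans ?_) (hhalf _ (by gcongr))
          gcongr
          omega
        linarith
    have hsub : Finset.range (p + 1) ⊆ Finset.range P := by
      rw [Finset.range_subset_range]; omega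
    simp only
    rw [Finset.sum_congr rfl hterm, Finset.sum_ite_mem, Finset.inter_eq_right.mpr hsub]
    simp

lemma iteratedDeriv_periodic {g : ℝ → ℝ} {c : ℝ} (hg : Function.Periodic g c) (j : ℕ) :
    Function.Periodic (iteratedDeriv j g) c := by
  intro x
  have h : (fun z ↦ g (z + c)) = g := funext hg
  conv_rhs => rw [← h]
  rw [iteratedDeriv_comp_add_const]

/-- The lacunary series `∑ B⁻⁽ⁿ⁺¹⁾ g (Nⁿ x)` is `C^k` when `B > N ^ k`. -/
lemma contDiff_lacunary {g : ℝ → ℝ} (hg : ContDiff ℝ (⊤ : ℕ∞) g) (hper : Function.Periodic g 1)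
    {N B k : ℕ} (hN : 1 ≤ N) (hB : N ^ k < B) :
    ContDiff ℝ k fun x ↦ ∑' n : ℕ, ((B : ℝ) ^ (n + 1))⁻¹ * g ((N : ℝ) ^ n * x) := by
  have hbdd : ∀ j : ℕ, ∃ C, ∀ x, ‖iteratedDeriv j g x‖ ≤ C := by
    intro j
    have hcont : Continuous (iteratedDeriv j g) := hg.continuous_iteratedDeriv j (mod_cast le_top)
    obtain ⟨C, hC⟩ := ((iteratedDeriv_periodic hper j).isBounded_of_continuous one_ne_zero
      hcont).exists_norm_le
    exact ⟨C, fun x ↦ hC _ (mem_range_self x)⟩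
  choose C hC using hbdd
  have hB0 : (0 : ℝ) < B := by exact_mod_cast (by omega : 0 < B)
  have hN' : (1 : ℝ) ≤ N := by exact_mod_cast hN
  have hj : ∀ j : ℕ, ContDiff ℝ j g := fun j ↦ hg.of_le (mod_cast le_top)
  refine contDiff_tsum (N := (k : ℕ∞)) (v := fun j n ↦ ((B : ℝ) ^ (n + 1))⁻¹ *
    (((N : ℝ) ^ n) ^ k * C j)) (fun n ↦ ?_) (fun j _ ↦ ?_) (fun j n x hjk ↦ ?_)
  · exact contDiff_const.mul ((hj k).comp (contDiff_const.mul contDiff_id))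
  · have hr : (N : ℝ) ^ k / B < 1 := by
      rw [div_lt_one hB0]; exact_mod_cast hB
    have := (summable_geometric_of_lt_one (by positivity) hr).mul_left ((B : ℝ)⁻¹ * C j)
    refine this.congr fun n ↦ ?_
    rw [div_pow, pow_succ, ← pow_mul, ← pow_mul, mul_comm n k]
    field_simp
  · rw [norm_iteratedFDeriv_eq_norm_iteratedDeriv, iteratedDeriv_const_mul_field,
      iteratedDeriv_comp_const_mul (hj j)]
    rw [norm_mul, norm_mul, Real.norm_of_nonneg (by positivity : (0 : ℝ) ≤ ((B : ℝ) ^ (n + 1))⁻¹),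
      Real.norm_of_nonneg (by positivity : (0 : ℝ) ≤ ((N : ℝ) ^ n) ^ j)]
    have hjk' : j ≤ k := by exact_mod_cast hjk
    gcongr
    · exact one_le_pow₀ hN'
    · exact hC _ _

/-- The integer part of a digit expansion shifted by `n` places. -/
lemma exists_pow_mul_ofDigits {N : ℕ} (hN : 0 < N) (d : ℕ → Fin N) (n : ℕ) :
    ∃ m : ℕ, (N : ℝ) ^ n * Real.ofDigits d = Real.ofDigits (fun i ↦ d (i + n)) + m := by
  refine ⟨∑ i ∈ Finset.range n, (d i : ℕ) * N ^ (n - (i + 1)), ?_⟩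
  have hN' : (N : ℝ) ≠ 0 := by exact_mod_cast hN.ne'
  rw [Real.ofDigits_eq_sum_add_ofDigits d n, mul_add, mul_inv_cancel_left₀ (pow_ne_zero _ hN'),
    add_comm, Finset.mul_sum]
  push_cast
  congr 1
  refine Finset.sum_congr rfl fun i hi ↦ ?_
  rw [Finset.mem_range] at hi
  rw [Real.ofDigitsTerm, pow_sub₀ _ hN' (by omega : i + 1 ≤ n)]
  ring

/-- On points with digits from the `p n`-th block, the lacunary series has digits `p n`. -/
lemma lacunary_ofDigits {N P W B : ℕ} {g : ℝ → ℝ} (hN : 0 < N) (hper : Function.Periodic g 1)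
    (hg : ∀ p < P, ∀ x : ℝ, ((p * W + 1 : ℕ) : ℝ) / N ≤ x → x ≤ (((p + 1) * W : ℕ) : ℝ) / N →
        g x = p)
    (d : ℕ → Fin N) (p : ℕ → Fin B) (hp : ∀ n, (p n : ℕ) < P)
    (h1 : ∀ n, (p n : ℕ) * W + 1 ≤ d n) (h2 : ∀ n, (d n : ℕ) + 1 ≤ ((p n : ℕ) + 1) * W) :
    ∑' n : ℕ, ((B : ℝ) ^ (n + 1))⁻¹ * g ((N : ℝ) ^ n * Real.ofDigits d) = Real.ofDigits p := by
  refine tsum_congr fun n ↦ ?_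
  have hN' : (0 : ℝ) < N := by exact_mod_cast hN
  obtain ⟨m, hm⟩ := exists_pow_mul_ofDigits hN d n
  have hgm := hper.nat_mul m (Real.ofDigits fun i ↦ d (i + n))
  rw [mul_one] at hgm
  rw [hm, hgm, Real.ofDigitsTerm, mul_comm, hg (p n) (hp n)]
  all_goals
    rw [Real.ofDigits_eq_sum_add_ofDigits (fun i ↦ d (i + n)) 1]
    have h3 := Real.ofDigits_nonneg (fun i ↦ d (i + 1 + n))
    have h4 := Real.ofDigits_le_one (fun i ↦ d (i + 1 + n))
    simp only [Finset.range_one, Finset.sum_singleton, Real.ofDigitsTerm, zero_add, pow_one]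
    have h1' : (((p n : ℕ) * W + 1 : ℕ) : ℝ) ≤ (d n : ℕ) := by exact_mod_cast h1 n
    have h2' : ((d n : ℕ) : ℝ) + 1 ≤ ((((p n : ℕ) + 1) * W : ℕ) : ℝ) := by exact_mod_cast h2 n
    rw [← div_eq_mul_inv, inv_mul_eq_div, ← add_div]
    gcongr
    linarith

lemma exists_contDiff_le_dimH {k N P Q : ℕ} {α s : ℝ≥0} (hα : 0 < α) (hs : 0 < s) (hQ : 2 ≤ Q)
    (hP : 2 ≤ P) (hN : 2 * P * (Q + 1) ≤ N) (hNQ : (N : ℝ) ^ (α : ℝ) ≤ Q)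
    (hNP : (2 * (N : ℝ) ^ k) ^ (s : ℝ) ≤ P) (hkP : P + 1 ≤ 2 * N ^ k) {a b : ℝ} (hab : a < b) :
    ∃ f : ℝ → ℝ, ContDiff ℝ k f ∧
      (s : ℝ≥0∞) ≤ dimH {y : ℝ | (α : ℝ≥0∞) ≤ dimH (Ioo a b ∩ f ⁻¹' {y})} := by
  have hN0 : 0 < N := by nlinarith
  have hN' : (0 : ℝ) < N := by exact_mod_cast hN0
  have hba : 0 < b - a := sub_pos.mpr hab
  obtain ⟨g, hg, hper, hstep⟩ := exists_periodic_step hN hN0 (by omega : 1 ≤ Q + 1)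
  set B := 2 * N ^ k with hBdef
  have hB : N ^ k < B := by
    have : 0 < N ^ k := by positivity
    omega
  set F : ℝ → ℝ := fun x ↦ ∑' n : ℕ, ((B : ℝ) ^ (n + 1))⁻¹ * g ((N : ℝ) ^ n * x)
  have hdig : ∀ (p : Fin P) (q : Fin Q), (p : ℕ) * (Q + 1) + 1 + q + 2 ≤ N := by
    intro p q
    have h1 : ((p : ℕ) + 1) * (Q + 1) ≤ P * (Q + 1) := by gcongr; omega
    have h2 := q.2
    nlinarith
  have hφ : LipschitzWith (Real.toNNReal (b - a)⁻¹) fun t : ℝ ↦ (t - a) / (b - a) := by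
    refine LipschitzWith.of_dist_le_mul fun x y ↦ ?_
    rw [Real.dist_eq, Real.dist_eq, ← sub_div, sub_sub_sub_cancel_right, abs_div,
      abs_of_pos hba, Real.coe_toNNReal _ (by positivity), inv_mul_eq_div]
  refine ⟨fun t ↦ F ((t - a) / (b - a)), ?_, ?_⟩
  · exact (contDiff_lacunary hg hper hN0 hB).comp
      ((contDiff_id.sub contDiff_const).div_const _)
  have hY := le_dimH_range_ofDigits (B := B) hs hP (by rw [hBdef]; exact_mod_cast hNP)
    (fun _ p ↦ ⟨p, by omega⟩)
    (fun _ p p' h ↦ Fin.ext (by simpa using h)) (fun _ p ↦ by simp only; omega)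
  refine hY.trans (dimH_mono ?_)
  rintro _ ⟨p, rfl⟩
  have hK := le_dimH_range_ofDigits (B := N) hα hQ hNQ
    (fun n q ↦ ⟨(p n : ℕ) * (Q + 1) + 1 + q, by have := hdig (p n) q; omega⟩)
    (fun n q q' h ↦ Fin.ext (by simpa using h)) (fun n q ↦ hdig (p n) q)
  refine hK.trans ((dimH_mono ?_).trans (hφ.dimH_image_le _))
  rintro _ ⟨q, rfl⟩
  set d : ℕ → Fin N := fun n ↦ ⟨(p n : ℕ) * (Q + 1) + 1 + q n, by
    have := hdig (p n) (q n); omega⟩ with hd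
  have hd0 : 0 < Real.ofDigits d := by
    rw [Real.ofDigits_eq_sum_add_ofDigits d 1]
    have h1 := Real.ofDigits_nonneg (fun i ↦ d (i + 1))
    have h2 : (0 : ℝ) < (d 0 : ℕ) := by
      exact_mod_cast (by simp only [hd]; omega : 0 < (d 0 : ℕ))
    simp only [Finset.range_one, Finset.sum_singleton, Real.ofDigitsTerm]
    positivity
  have hd1 : Real.ofDigits d < 1 := by
    have h1 := ofDigits_le_one_sub_inv d (hdig (p 0) (q 0))
    have h2 : (0 : ℝ) < (N : ℝ)⁻¹ := by positivity
    linarith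
  refine ⟨a + (b - a) * Real.ofDigits d, ⟨⟨?_, ?_⟩, ?_⟩, ?_⟩
  · nlinarith
  · nlinarith
  · simp only [mem_preimage, mem_singleton_iff, add_sub_cancel_left]
    rw [mul_div_cancel_left₀ _ hba.ne']
    refine lacunary_ofDigits hN0 hper hstep d _ (fun n ↦ (p n).2) (fun n ↦ ?_) (fun n ↦ ?_)
    · simp only [hd]; omega
    · have := (q n).2
      simp only [hd]; nlinarith
  · simp only [add_sub_cancel_left]
    exact mul_div_cancel_left₀ _ hba.ne'

lemma exists_parameters {k : ℕ} (hk : 1 ≤ k) {α s : ℝ} (hα0 : 0 < α) (hs : 0 < s)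
    (hsα : k * s < 1 - α) :
    ∃ N P Q : ℕ, 2 ≤ Q ∧ 2 ≤ P ∧ 2 * P * (Q + 1) ≤ N ∧ (N : ℝ) ^ α ≤ Q ∧
      (2 * (N : ℝ) ^ k) ^ s ≤ P ∧ P + 1 ≤ 2 * N ^ k := by
  have hs1 : s < 1 := by
    have : (1 : ℝ) ≤ k := by exact_mod_cast hk
    nlinarith
  obtain ⟨N, hN1, hN2⟩ := (((tendsto_rpow_atTop (by linarith : 0 < 1 - α - k * s)).comp
    tendsto_natCast_atTop_atTop).eventually_ge_atTop 40 |>.and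
      (((tendsto_rpow_atTop hα0).comp
        tendsto_natCast_atTop_atTop).eventually_gt_atTop 1)).exists
  simp only [Function.comp_apply] at hN1 hN2
  have hN0 : 0 < N := by
    rcases Nat.eq_zero_or_pos N with rfl | h
    · rw [Nat.cast_zero, Real.zero_rpow hα0.ne'] at hN2
      linarith
    · exact h
  have hN' : (1 : ℝ) ≤ N := by exact_mod_cast hN0
  set A : ℝ := (N : ℝ) ^ α with hA
  set T : ℝ := (N : ℝ) ^ (k * s) with hT
  have hT1 : 1 ≤ T := Real.one_le_rpow hN' (by positivity)
  have hATN : 40 * (A * T) ≤ N := by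
    calc 40 * (A * T) ≤ (N : ℝ) ^ (1 - α - k * s) * (A * T) := by gcongr
      _ = N := by
        rw [hA, hT, ← Real.rpow_add (by linarith), ← Real.rpow_add (by linarith)]
        ring_nf
        exact Real.rpow_one _
  set X : ℝ := (2 * (N : ℝ) ^ k) ^ s with hX
  have hXT : X ≤ 2 * T := by
    rw [hX, Real.mul_rpow (by norm_num) (by positivity), ← Real.rpow_natCast,
      ← Real.rpow_mul (by linarith)]
    gcongr
    calc (2 : ℝ) ^ s ≤ 2 ^ (1 : ℝ) := Real.rpow_le_rpow_of_exponent_le (by norm_num) hs1.le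
      _ = 2 := Real.rpow_one _
  have hX1 : 1 < X := by
    refine Real.one_lt_rpow ?_ hs
    have : 1 ≤ (N : ℝ) ^ k := one_le_pow₀ hN'
    linarith
  have hQ := Nat.ceil_lt_add_one (by linarith : 0 ≤ A)
  have hP := Nat.ceil_lt_add_one (by linarith : 0 ≤ X)
  have hQ2 : (2 : ℕ) ≤ ⌈A⌉₊ := Nat.lt_ceil.mpr (by simpa using hN2)
  have hmain : 2 * ⌈X⌉₊ * (⌈A⌉₊ + 1) ≤ N := by
    have h : (2 * ⌈X⌉₊ * (⌈A⌉₊ + 1) : ℝ) ≤ N := by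
      calc (2 * ⌈X⌉₊ * (⌈A⌉₊ + 1) : ℝ) ≤ 2 * (3 * T) * (3 * A) := by
            gcongr <;> linarith
        _ ≤ 40 * (A * T) := by nlinarith [mul_pos (by linarith : 0 < A) (by linarith : 0 < T)]
        _ ≤ N := hATN
    exact_mod_cast h
  refine ⟨N, ⌈X⌉₊, ⌈A⌉₊, hQ2, Nat.lt_ceil.mpr (by simpa using hX1), hmain, Nat.le_ceil _,
    Nat.le_ceil _, ?_⟩
  have h1 : N ^ 1 ≤ N ^ k := Nat.pow_le_pow_right hN0 hk
  nlinarith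

/-! ### The dimension of the set of large level sets -/

lemma dimH_le_of_frequently_cover {S : Set ℝ} {s C : ℝ≥0} {ε : ℕ → ℝ≥0}
    (hε : Tendsto ε atTop (𝓝 0))
    (h : ∃ᶠ n in atTop, ∃ (ι : Type) (_ : Fintype ι) (t : ι → Set ℝ),
      (∀ i, Metric.ediam (t i) ≤ ε n) ∧ S ⊆ ⋃ i, t i ∧ Fintype.card ι * ε n ^ (s : ℝ) ≤ C) :
    dimH S ≤ s := by
  obtain ⟨φ, hφ, h⟩ := extraction_of_frequently_atTop h
  choose ι hι t ht hS hC using h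
  refine dimH_le_of_hausdorffMeasure_ne_top (ne_top_of_le_ne_top (ENNReal.coe_ne_top (r := C)) ?_)
  refine (Measure.hausdorffMeasure_le_liminf_sum (l := atTop) s S (fun n ↦ (ε (φ n) : ℝ≥0∞)) ?_ t
    (Eventually.of_forall ht) (Eventually.of_forall hS)).trans ?_
  · exact ENNReal.tendsto_coe.mpr (hε.comp hφ.tendsto_atTop)
  refine liminf_le_of_frequently_le' (Frequently.of_forall fun n ↦ ?_)
  calc ∑ i, Metric.ediam (t n i) ^ (s : ℝ) ≤ ∑ _i : ι n, (ε (φ n) : ℝ≥0∞) ^ (s : ℝ) := by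
        gcongr with i
        exact ht n i
    _ = ((Fintype.card (ι n) * ε (φ n) ^ (s : ℝ) : ℝ≥0) : ℝ≥0∞) := by
        rw [Finset.sum_const, Finset.card_univ, nsmul_eq_mul]
        push_cast
        rw [ENNReal.coe_rpow_of_nonneg _ s.coe_nonneg]
    _ ≤ C := by exact_mod_cast hC n

/-- Near a point that is a right accumulation point of its level set, `f` is flat to order `k`. -/
lemma exists_abs_sub_le_of_accumulation {a b c d : ℝ} (hac : a < c) (hdb : d < b) (k : ℕ) :
    ∀ f : ℝ → ℝ, ContDiffOn ℝ k f (Ioo a b) → ∃ M : ℝ, ∀ x ∈ Icc c d,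
      (∀ y > x, ∃ z ∈ Ioo x y, f z = f x) → ∀ t ∈ Icc c d, |f t - f x| ≤ M * |t - x| ^ k := by
  have hsub : Icc c d ⊆ Ioo a b := Icc_subset_Ioo hac hdb
  induction k with
  | zero =>
    intro f hf
    obtain ⟨C, hC⟩ := isCompact_Icc.exists_bound_of_continuousOn (hf.continuousOn.mono hsub)
    refine ⟨C + C, fun x hx _ t ht ↦ ?_⟩
    rw [pow_zero, mul_one]
    exact (abs_sub _ _).trans (add_le_add (hC t ht) (hC x hx))
  | succ k ih =>
    intro f hf
    push_cast at hf
    rw [contDiffOn_succ_iff_deriv_of_isOpen isOpen_Ioo] at hf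
    obtain ⟨hfd, -, hf'⟩ := hf
    obtain ⟨M, hM⟩ := ih (deriv f) hf'
    refine ⟨M, fun x hx hacc t ht ↦ ?_⟩
    have hzero : ∀ y > x, ∃ z ∈ Ioo x y, deriv f z = 0 := by
      intro y hy
      obtain ⟨z, hz, hfz⟩ := hacc (min y b) (lt_min hy (hsub hx).2)
      have hzb : z < b := hz.2.trans_le (min_le_right _ _)
      obtain ⟨w, hw, hw0⟩ := exists_deriv_eq_zero hz.1
        (hfd.continuousOn.mono (Icc_subset_Ioo (hsub hx).1 hzb)) hfz.symm
      exact ⟨w, ⟨hw.1, hw.2.trans (hz.2.trans_le (min_le_left _ _))⟩, hw0⟩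
    have hx0 : deriv f x = 0 := by
      by_contra hne
      have hcont : ContinuousAt (deriv f) x :=
        hf'.continuousOn.continuousAt (isOpen_Ioo.mem_nhds (hsub hx))
      obtain ⟨y, hy, hy'⟩ := mem_nhdsGE_iff_exists_Ico_subset.mp
        (mem_nhdsWithin_of_mem_nhds (hcont.eventually_ne hne) : _ ∈ 𝓝[≥] x)
      obtain ⟨z, hz, hz0⟩ := hzero y hy
      exact hy' ⟨hz.1.le, hz.2⟩ hz0
    have hM' := hM x hx (fun y hy ↦ by simpa only [hx0] using hzero y hy)
    have huI : uIcc x t ⊆ Icc c d := uIcc_subset_Icc hx ht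
    have hMVT := (convex_uIcc x t).norm_image_sub_le_of_norm_deriv_le (f := f)
      (C := M * |t - x| ^ k)
      (fun u hu ↦ (hfd u (hsub (huI hu))).differentiableAt (isOpen_Ioo.mem_nhds (hsub (huI hu))))
      (fun u hu ↦ ?_) left_mem_uIcc right_mem_uIcc
    · rw [pow_succ, ← mul_assoc]
      exact hMVT
    · have h1 := hM' u (huI hu)
      rw [hx0, sub_zero] at h1
      have h2 : |u - x| ≤ |t - x| := abs_sub_left_of_mem_uIcc hu
      rw [Real.norm_eq_abs]
      rcases eq_or_ne u x with rfl | hux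
      · rw [hx0, abs_zero]
        have h3 := (abs_nonneg _).trans (hM' t ht)
        exact h3
      refine h1.trans ?_
      have hMnn : 0 ≤ M := by
        have h3 := (abs_nonneg _).trans h1
        exact nonneg_of_mul_nonneg_left h3 (by have := sub_ne_zero.mpr hux; positivity)
      gcongr

open Classical in
/-- If each point of `A` lies in at least `m` of `n` sets of diameter at most `ε`, then `A` is
covered by at most `3 n / m` intervals of length `ε`. -/
lemma exists_cover_of_multiplicity {A : Set ℝ} {n m : ℕ} {ε : ℝ} (hε : 0 < ε) (hm : 0 < m)
    (V : Fin n → Set ℝ) (hV : ∀ i, ∀ y ∈ V i, ∀ y' ∈ V i, |y - y'| ≤ ε)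
    (hA : ∀ y ∈ A, m ≤ (Finset.univ.filter fun i ↦ y ∈ V i).card) :
    ∃ J : Finset ℤ, A ⊆ ⋃ j : J, {y | ⌊y / ε⌋ = j} ∧ J.card * m ≤ n * 3 := by
  have hfloor : ∀ i, ∃ j₀ : ℤ, ∀ y ∈ V i, ⌊y / ε⌋ ∈ Finset.Icc (j₀ - 1) (j₀ + 1) := by
    intro i
    rcases (V i).eq_empty_or_nonempty with h | ⟨y₀, hy₀⟩
    · exact ⟨0, by simp [h]⟩
    refine ⟨⌊y₀ / ε⌋, fun y hy ↦ ?_⟩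
    have h := abs_le.mp (hV i y hy y₀ hy₀)
    have h1 : y / ε ≤ y₀ / ε + 1 := by
      rw [← div_self hε.ne', ← add_div]
      gcongr
      linarith
    have h2 : y₀ / ε ≤ y / ε + 1 := by
      rw [← div_self hε.ne', ← add_div]
      gcongr
      linarith
    have h3 := Int.floor_le_floor h1
    have h4 := Int.floor_le_floor h2
    rw [Int.floor_add_one] at h3 h4
    rw [Finset.mem_Icc]
    omega
  choose j₀ hj₀ using hfloor
  set J := (Finset.univ.biUnion fun i ↦ Finset.Icc (j₀ i - 1) (j₀ i + 1)).filter
    fun j ↦ ∃ y ∈ A, ⌊y / ε⌋ = j with hJ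
  refine ⟨J, fun y hy ↦ ?_, ?_⟩
  · obtain ⟨i, hi⟩ := Finset.card_pos.mp (hm.trans_le (hA y hy))
    rw [Finset.mem_filter] at hi
    refine mem_iUnion.mpr ⟨⟨⌊y / ε⌋, ?_⟩, rfl⟩
    rw [hJ, Finset.mem_filter, Finset.mem_biUnion]
    exact ⟨⟨i, Finset.mem_univ _, hj₀ i y hi.2⟩, y, hy, rfl⟩
  · have hcount := Finset.card_mul_le_card_mul (s := J) (t := (Finset.univ : Finset (Fin n)))
      (fun j i ↦ ∃ y ∈ V i, ⌊y / ε⌋ = j) (m := m) (n := 3) (fun j hj ↦ ?_) (fun i _ ↦ ?_)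
    · simpa using hcount
    · obtain ⟨y, hy, hyj⟩ := (Finset.mem_filter.mp hj).2
      refine (hA y hy).trans (Finset.card_le_card fun i hi ↦ ?_)
      rw [Finset.mem_bipartiteAbove]
      exact ⟨Finset.mem_univ _, y, (Finset.mem_filter.mp hi).2, hyj⟩
    · have h3 : (Finset.Icc (j₀ i - 1) (j₀ i + 1)).card = 3 := by
        rw [Int.card_Icc]
        omega
      rw [← h3]
      refine Finset.card_le_card fun j hj ↦ ?_
      rw [Finset.mem_bipartiteBelow] at hj
      obtain ⟨-, y, hy, rfl⟩ := hj
      exact hj₀ i y hy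

lemma ediam_floor_div_eq_le {ε : ℝ≥0} (hε : 0 < ε) (j : ℤ) :
    Metric.ediam {y : ℝ | ⌊y / ε⌋ = j} ≤ ε := by
  have hε' : (0 : ℝ) < ε := hε
  have hsub : {y : ℝ | ⌊y / ε⌋ = j} ⊆ Icc (j * ε : ℝ) ((j + 1) * ε) := by
    intro y hy
    obtain ⟨h1, h2⟩ := Int.floor_eq_iff.mp hy
    exact ⟨(le_div_iff₀ hε').mp h1, ((div_lt_iff₀ hε').mp h2).le⟩
  refine (Metric.ediam_mono hsub).trans ?_
  rw [Real.ediam_Icc, ← sub_mul, add_sub_cancel_left, one_mul, ENNReal.ofReal_coe_nnreal]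

lemma exists_fin_mem_Icc {c x : ℝ} {L : ℝ≥0} (hL : 0 < L) (n : ℕ) (h1 : c ≤ x) (h2 : x < c + L) :
    ∃ i : Fin (n + 1), x ∈ Icc (c + i * (L / (n + 1))) (c + (i + 1) * (L / (n + 1))) := by
  have hL' : (0 : ℝ) < L := hL
  have hδ : (0 : ℝ) < L / (n + 1) := by positivity
  have hnn : 0 ≤ (x - c) / (L / (n + 1)) := div_nonneg (by linarith) hδ.le
  refine ⟨⟨⌊(x - c) / (L / (n + 1))⌋₊, ?_⟩, ?_, ?_⟩
  · rw [Nat.floor_lt hnn, div_lt_iff₀ hδ]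
    push_cast
    rw [mul_div_cancel₀ _ (by positivity)]
    linarith
  · have := (le_div_iff₀ hδ).mp (Nat.floor_le hnn)
    simp only
    linarith
  · have := (div_lt_iff₀ hδ).mp (Nat.lt_floor_add_one ((x - c) / (L / (n + 1))))
    simp only
    linarith

open Classical in
/-- If `f` is Hölder of exponent `k` on a bounded set `Z`, then the set of values whose level sets
in `Z` have dimension more than `β` has dimension at most `(1 - β) / k`. -/
lemma dimH_setOf_lt_dimH_le {Z : Set ℝ} {c d : ℝ} (hZ : Z ⊆ Icc c d) {f : ℝ → ℝ} {M : ℝ} {k : ℕ}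
    (hk : 1 ≤ k) (hf : ∀ x ∈ Z, ∀ t ∈ Z, |f t - f x| ≤ M * |t - x| ^ k) {β s : ℝ≥0}
    (hβs : β + k * s = 1) :
    dimH {y : ℝ | (β : ℝ≥0∞) < dimH (Z ∩ f ⁻¹' {y})} ≤ s := by
  set M' : ℝ≥0 := Real.toNNReal M + 1
  have hM' : 0 < M' := by positivity
  have hMM' : M ≤ M' := by
    have := Real.le_coe_toNNReal M
    simp only [M', NNReal.coe_add, NNReal.coe_one]
    linarith
  set L : ℝ≥0 := Real.toNNReal (d - c) + 1
  have hL : 0 < L := by positivity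
  have hLd : d < c + L := by
    have := Real.le_coe_toNNReal (d - c)
    simp only [L, NNReal.coe_add, NNReal.coe_one]
    linarith
  set δ : ℕ → ℝ≥0 := fun n ↦ L / (n + 1) with hδ
  have hδ0 : ∀ n, 0 < δ n := fun n ↦ by positivity
  have hδlim : Tendsto δ atTop (𝓝 0) := by
    rw [← NNReal.tendsto_coe]
    simpa [hδ, div_eq_mul_inv] using
      (tendsto_one_div_add_atTop_nhds_zero_nat (𝕜 := ℝ)).const_mul (L : ℝ)
  set U : (n : ℕ) → Fin (n + 1) → Set ℝ :=
    fun n i ↦ Icc (c + i * (L / (n + 1))) (c + (i + 1) * (L / (n + 1)))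
  have hcover : ∀ n, ∀ x ∈ Z, ∃ i, x ∈ U n i := fun n x hx ↦
    exists_fin_mem_Icc hL n (hZ hx).1 ((hZ hx).2.trans_lt hLd)
  set V : (n : ℕ) → Fin (n + 1) → Set ℝ := fun n i ↦ f '' (Z ∩ U n i)
  set N : ℕ → ℝ → ℕ := fun n y ↦ (Finset.univ.filter fun i ↦ y ∈ V n i).card
  set A : ℕ → Set ℝ := fun m ↦ {y | ∀ n ≥ m, ((n : ℝ≥0) + 1) ^ (β : ℝ) < N n y}
  have hsub : {y : ℝ | (β : ℝ≥0∞) < dimH (Z ∩ f ⁻¹' {y})} ⊆ ⋃ m, A m := by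
    intro y hy
    by_contra hyA
    simp only [A, mem_iUnion, mem_ofPred_eq, not_exists, not_forall, not_lt] at hyA
    refine not_lt.mpr ?_ (show (β : ℝ≥0∞) < dimH (Z ∩ f ⁻¹' {y}) from hy)
    refine dimH_le_of_frequently_cover (C := L ^ (β : ℝ)) hδlim (frequently_atTop.mpr fun m ↦ ?_)
    obtain ⟨n, hn, hN⟩ := hyA m
    refine ⟨n, hn, {i // y ∈ V n i}, inferInstance, fun i ↦ U n i, fun i ↦ ?_, ?_, ?_⟩
    · simp only [U]
      rw [Real.ediam_Icc, ← ENNReal.ofReal_coe_nnreal]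
      refine ENNReal.ofReal_le_ofReal (le_of_eq ?_)
      simp only [hδ]
      push_cast
      ring
    · rintro x ⟨hxZ, hxy⟩
      obtain ⟨i, hi⟩ := hcover n x hxZ
      exact mem_iUnion.mpr ⟨⟨i, x, ⟨hxZ, hi⟩, hxy⟩, hi⟩
    · rw [Fintype.card_subtype]
      calc (N n y : ℝ≥0) * δ n ^ (β : ℝ) ≤ ((n : ℝ≥0) + 1) ^ (β : ℝ) * δ n ^ (β : ℝ) := by gcongr
        _ = L ^ (β : ℝ) := by
          rw [← NNReal.mul_rpow, hδ, mul_div_cancel₀ _ (by positivity)]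
  refine (dimH_mono hsub).trans ?_
  rw [dimH_iUnion]
  refine iSup_le fun m ↦ ?_
  have hεlim : Tendsto (fun n ↦ M' * δ n ^ k) atTop (𝓝 0) := by
    simpa [zero_pow (by omega : k ≠ 0)] using (hδlim.pow k).const_mul M'
  refine dimH_le_of_frequently_cover (C := 3 * (M' * L ^ k) ^ (s : ℝ)) hεlim
    (Eventually.frequently ((eventually_ge_atTop m).mono fun n hn ↦ ?_))
  have hε : 0 < M' * δ n ^ k := mul_pos hM' (pow_pos (hδ0 n) k)
  have hpow : (0 : ℝ≥0) < ((n : ℝ≥0) + 1) ^ (β : ℝ) := NNReal.rpow_pos (by positivity)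
  have hV : ∀ i, ∀ y ∈ V n i, ∀ y' ∈ V n i, |y - y'| ≤ (M' * δ n ^ k : ℝ≥0) := by
    rintro i _ ⟨t, ⟨htZ, ht⟩, rfl⟩ _ ⟨x, ⟨hxZ, hx⟩, rfl⟩
    have htx : |t - x| ≤ δ n := by
      have h1 := ht.1
      have h2 := ht.2
      have h3 := hx.1
      have h4 := hx.2
      rw [add_mul, one_mul] at h2 h4
      simp only [hδ]
      push_cast
      rw [abs_le]
      constructor <;> linarith
    refine (hf x hxZ t htZ).trans ?_
    push_cast
    gcongr
  have hA : ∀ y ∈ A m, ⌈((n : ℝ≥0) + 1) ^ (β : ℝ)⌉₊ ≤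
      (Finset.univ.filter fun i ↦ y ∈ V n i).card :=
    fun y hy ↦ Nat.ceil_le.mpr (hy n hn).le
  obtain ⟨J, hJA, hJ⟩ := exists_cover_of_multiplicity (A := A m) (ε := (M' * δ n ^ k : ℝ≥0))
    (m := ⌈((n : ℝ≥0) + 1) ^ (β : ℝ)⌉₊) hε (Nat.ceil_pos.mpr hpow) (V n) hV hA
  refine ⟨J, inferInstance, _, fun j ↦ ediam_floor_div_eq_le hε j, hJA, ?_⟩
  rw [Fintype.card_coe]
  have hJ' : (J.card : ℝ≥0) * ((n : ℝ≥0) + 1) ^ (β : ℝ) ≤ ((n : ℝ≥0) + 1) * 3 := by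
    calc (J.card : ℝ≥0) * ((n : ℝ≥0) + 1) ^ (β : ℝ)
        ≤ J.card * (⌈((n : ℝ≥0) + 1) ^ (β : ℝ)⌉₊ : ℝ≥0) := by
          gcongr
          exact Nat.le_ceil _
      _ ≤ ((n : ℝ≥0) + 1) * 3 := by exact_mod_cast hJ
  have hsplit : ((n : ℝ≥0) + 1) ^ (β : ℝ) * (((n : ℝ≥0) + 1) ^ k) ^ (s : ℝ) = (n : ℝ≥0) + 1 := by
    rw [← NNReal.rpow_natCast, ← NNReal.rpow_mul, ← NNReal.rpow_add (by positivity)]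
    have : (β : ℝ) + k * s = 1 := by exact_mod_cast hβs
    rw [this, NNReal.rpow_one]
  have hkey : (J.card : ℝ≥0) ≤ 3 * (((n : ℝ≥0) + 1) ^ k) ^ (s : ℝ) := by
    refine le_of_mul_le_mul_right (hJ'.trans (le_of_eq ?_)) hpow
    rw [mul_assoc, mul_comm ((((n : ℝ≥0) + 1) ^ k) ^ (s : ℝ)), hsplit, mul_comm]
  calc (J.card : ℝ≥0) * (M' * δ n ^ k) ^ (s : ℝ)
      ≤ 3 * (((n : ℝ≥0) + 1) ^ k) ^ (s : ℝ) * (M' * δ n ^ k) ^ (s : ℝ) := by gcongr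
    _ = 3 * (M' * L ^ k) ^ (s : ℝ) := by
      rw [mul_assoc, ← NNReal.mul_rpow]
      congr 2
      rw [mul_left_comm, ← mul_pow, hδ, mul_div_cancel₀ _ (by positivity)]

lemma countable_isolated_right (S : Set ℝ) :
    {x ∈ S | ¬ ∀ y > x, ∃ z ∈ Ioo x y, z ∈ S}.Countable := by
  refine (countable_setOfPred_isolated_right_within (s := S)).mono ?_
  rintro x ⟨hxS, hx⟩
  push Not at hx
  obtain ⟨y, hy, hxy⟩ := hx
  refine ⟨hxS, ?_⟩
  rw [← Filter.empty_mem_iff_bot, mem_nhdsWithin]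
  exact ⟨Iio y, isOpen_Iio, hy, fun z hz ↦ hxy z ⟨hz.2.2, hz.1⟩ hz.2.1⟩

lemma dimH_large_level_sets_le {k : ℕ} (hk : 1 ≤ k) {α : ℝ} (hα0 : 0 < α) (hα1 : α < 1) {a b : ℝ}
    {f : ℝ → ℝ} (hf : ContDiffOn ℝ k f (Ioo a b)) :
    dimH {y : ℝ | ENNReal.ofReal α ≤ dimH (Ioo a b ∩ f ⁻¹' {y})} ≤
      ENNReal.ofReal ((1 - α) / k) := by
  have hk' : (0 : ℝ) < k := by exact_mod_cast hk
  have hlim : Tendsto (fun β : ℝ ↦ ENNReal.ofReal ((1 - β) / k)) (𝓝[<] α)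
      (𝓝 (ENNReal.ofReal ((1 - α) / k))) := by
    refine (ENNReal.continuous_ofReal.comp ?_).continuousAt.tendsto.mono_left nhdsWithin_le_nhds
    fun_prop
  refine ge_of_tendsto hlim ?_
  filter_upwards [Ioo_mem_nhdsLT hα0] with β hβ
  set Z : ℕ → Set ℝ := fun j ↦ {x ∈ Icc (a + 1 / (j + 1)) (b - 1 / (j + 1)) |
    ∀ y > x, ∃ z ∈ Ioo x y, f z = f x}
  have hsub : {y : ℝ | ENNReal.ofReal α ≤ dimH (Ioo a b ∩ f ⁻¹' {y})} ⊆
      ⋃ j, {y | (Real.toNNReal β : ℝ≥0∞) < dimH (Z j ∩ f ⁻¹' {y})} := by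
    intro y hy
    have hlt : ENNReal.ofReal β < dimH (Ioo a b ∩ f ⁻¹' {y}) :=
      ((ENNReal.ofReal_lt_ofReal_iff hα0).mpr hβ.2).trans_le hy
    set S := Ioo a b ∩ f ⁻¹' {y}
    have hS : S ⊆ {x ∈ S | ¬ ∀ y > x, ∃ z ∈ Ioo x y, z ∈ S} ∪ ⋃ j, (Z j ∩ f ⁻¹' {y}) := by
      intro x hx
      by_cases hacc : ∀ y > x, ∃ z ∈ Ioo x y, z ∈ S
      · right
        obtain ⟨j, hj⟩ := exists_nat_one_div_lt
          (lt_min (sub_pos.mpr hx.1.1) (sub_pos.mpr hx.1.2))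
        have h1 := hj.trans_le (min_le_left _ _)
        have h2 := hj.trans_le (min_le_right _ _)
        refine mem_iUnion.mpr ⟨j, ⟨⟨by linarith, by linarith⟩, fun w hw ↦ ?_⟩, hx.2⟩
        obtain ⟨z, hz, hzS⟩ := hacc w hw
        exact ⟨z, hz, hzS.2.trans hx.2.symm⟩
      · exact Or.inl ⟨hx, hacc⟩
    have h := hlt.trans_le (dimH_mono hS)
    rw [dimH_union, dimH_countable (countable_isolated_right S), max_eq_right zero_le,
      dimH_iUnion, lt_iSup_iff] at h
    exact mem_iUnion.mpr h
  refine (dimH_mono hsub).trans ?_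
  rw [dimH_iUnion]
  refine iSup_le fun j ↦ ?_
  have hj : (0 : ℝ) < 1 / (j + 1) := by positivity
  obtain ⟨M, hM⟩ := exists_abs_sub_le_of_accumulation (lt_add_of_pos_right a hj)
    (sub_lt_self b hj) k f hf
  refine dimH_setOf_lt_dimH_le (fun x hx ↦ hx.1) hk
    (fun x hx t ht ↦ hM x hx.1 hx.2 t ht.1) ?_
  rw [← NNReal.coe_inj]
  push_cast
  have h1 : 0 ≤ (1 - β) / k := div_nonneg (by linarith [hβ.2]) hk'.le
  rw [Real.coe_toNNReal _ hβ.1.le, Real.coe_toNNReal _ h1, mul_div_cancel₀ _ hk'.ne']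
  ring

end LevelSets

/-- **Main theorem.** For `k ≥ 1`, `0 < α < 1`, and a nonempty open interval
`E = Ioo a b`, the supremum over all `C^k` functions `f : E → ℝ` of the Hausdorff
dimension of `I_α(f) = {y : dim_H f⁻¹(y) ≥ α}` equals `(1 - α)/k`. -/
theorem sup_dimH_large_level_sets_eq (k : ℕ) (hk : 1 ≤ k) (α : ℝ) (hα0 : 0 < α)
    (hα1 : α < 1) (a b : ℝ) (hab : a < b) :
    (⨆ (f : ℝ → ℝ) (_ : ContDiffOn ℝ k f (Set.Ioo a b)),
        dimH {y : ℝ | ENNReal.ofReal α ≤ dimH (Set.Ioo a b ∩ f ⁻¹' {y})}) =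
      ENNReal.ofReal ((1 - α) / k) := by
  have hk' : (0 : ℝ) < k := by exact_mod_cast hk
  refine le_antisymm (iSup₂_le fun f hf ↦ LevelSets.dimH_large_level_sets_le hk hα0 hα1 hf) ?_
  refine le_of_forall_lt fun r hr ↦ ?_
  obtain ⟨s, hrs, hs⟩ := ENNReal.lt_iff_exists_nnreal_btwn.mp hr
  have hs0 : 0 < s := by exact_mod_cast hrs.pos
  have hs' : (s : ℝ) < (1 - α) / k := by
    rw [← ENNReal.ofReal_coe_nnreal] at hs
    exact (ENNReal.ofReal_lt_ofReal_iff_of_nonneg s.coe_nonneg).mp hs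
  obtain ⟨N, P, Q, hQ, hP, hN, hNQ, hNP, hkP⟩ :=
    LevelSets.exists_parameters hk hα0 (s := s) (by exact_mod_cast hs0)
      (by rwa [lt_div_iff₀ hk', mul_comm] at hs')
  obtain ⟨f, hf, hfs⟩ := LevelSets.exists_contDiff_le_dimH (α := Real.toNNReal α)
    (Real.toNNReal_pos.mpr hα0) hs0 hQ hP hN (by rwa [Real.coe_toNNReal _ hα0.le]) hNP hkP hab
  exact hrs.trans_le (hfs.trans (le_iSup₂_of_le f hf.contDiffOn le_rfl))
end

section
/- Let k ≥ 1 be a natural number, let 0 < α < 1, and let E be a nonempty open interval in ℝ. Then for every f ∈ C^k(E,ℝ) one has L(α,f) ≤ (1-α)/k; that is, the Hausdorff dimension of {y ∈ ℝ : dim_H f⁻¹(y) ≥ α} is at most (1-α)/k. -/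
open MeasureTheory Set

open Filter Topology

/-- The index of the cell containing `x` in the partition of `ℝ` into half-open intervals of
length `r`. -/
noncomputable def gridIndex (r x : ℝ) : ℤ := ⌊x / r⌋

theorem abs_sub_le_of_gridIndex_eq {r x y : ℝ} (hr : 0 < r) (h : gridIndex r x = gridIndex r y) :
    |x - y| ≤ r := by
  have h1 := Int.abs_sub_lt_one_of_floor_eq_floor h
  rw [← sub_div, abs_div, abs_of_pos hr, div_lt_one hr] at h1
  exact h1.le

theorem abs_gridIndex_sub_le_one {r x y : ℝ} (hr : 0 < r) (h : |x - y| ≤ r) :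
    |gridIndex r x - gridIndex r y| ≤ 1 := by
  have h1 : |x / r - y / r| ≤ 1 := by
    rwa [← sub_div, abs_div, abs_of_pos hr, div_le_one hr]
  rw [abs_le] at h1 ⊢
  have h2 : ⌊x / r⌋ ≤ ⌊y / r⌋ + 1 := by
    rw [← Int.floor_add_one]; exact Int.floor_le_floor (by linarith)
  have h3 : ⌊y / r⌋ ≤ ⌊x / r⌋ + 1 := by
    rw [← Int.floor_add_one]; exact Int.floor_le_floor (by linarith)
  unfold gridIndex
  constructor <;> linarith

theorem gridIndex_image_subset_Icc {r c d : ℝ} (hr : 0 < r) {B : Set ℝ} (hB : B ⊆ Icc c d) :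
    gridIndex r '' B ⊆ Finset.Icc ⌊c / r⌋ ⌊d / r⌋ := by
  rintro _ ⟨x, hx, rfl⟩
  rw [Finset.coe_Icc]
  exact ⟨Int.floor_le_floor (by gcongr; exact (hB hx).1),
    Int.floor_le_floor (by gcongr; exact (hB hx).2)⟩

theorem finite_gridIndex_image {r c d : ℝ} (hr : 0 < r) {B : Set ℝ} (hB : B ⊆ Icc c d) :
    (gridIndex r '' B).Finite :=
  (Finset.finite_toSet _).subset (gridIndex_image_subset_Icc hr hB)

theorem ncard_gridIndex_image_le {r c d : ℝ} (hr : 0 < r) (hcd : c ≤ d) {B : Set ℝ}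
    (hB : B ⊆ Icc c d) : ((gridIndex r '' B).ncard : ℝ) ≤ (d - c) / r + 2 := by
  have h1 := Set.ncard_le_ncard (gridIndex_image_subset_Icc hr hB) (Finset.finite_toSet _)
  rw [Set.ncard_coe_finset, Int.card_Icc] at h1
  have h2 : ⌊c / r⌋ ≤ ⌊d / r⌋ := Int.floor_le_floor (by gcongr)
  have h3 : ((gridIndex r '' B).ncard : ℤ) ≤ ⌊d / r⌋ + 1 - ⌊c / r⌋ := by omega
  have h4 : ((gridIndex r '' B).ncard : ℝ) ≤ ⌊d / r⌋ + 1 - ⌊c / r⌋ := by exact_mod_cast h3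
  have h5 := Int.floor_le (d / r)
  have h6 := Int.lt_floor_add_one (c / r)
  rw [sub_div]
  linarith

/-- A set has zero Hausdorff measure if it is covered by few grid cells along some sequence of
scales tending to zero. -/
theorem hausdorffMeasure_eq_zero_of_tendsto_ncard_gridIndex {t : ℝ} (ht : 0 ≤ t) {A : Set ℝ}
    {r : ℕ → ℝ} (hr : ∀ n, 0 < r n) (hr0 : Tendsto r atTop (𝓝 0))
    (hfin : ∀ n, (gridIndex (r n) '' A).Finite)
    (h : Tendsto (fun n => ((gridIndex (r n) '' A).ncard : ℝ) * r n ^ t) atTop (𝓝 0)) :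
    μH[t] A = 0 := by
  have hdiam : ∀ n (i : ℤ), Metric.ediam (gridIndex (r n) ⁻¹' {i}) ≤ ENNReal.ofReal (r n) := by
    intro n i
    refine Metric.ediam_le fun x hx y hy => ?_
    rw [edist_dist, Real.dist_eq]
    refine ENNReal.ofReal_le_ofReal (abs_sub_le_of_gridIndex_eq (hr n) ?_)
    rw [mem_preimage, mem_singleton_iff] at hx hy
    rw [hx, hy]
  have h1 := Measure.hausdorffMeasure_le_liminf_sum
    (ι := fun n => (hfin n).toFinset) t A (l := atTop) (fun n => ENNReal.ofReal (r n))
    (by simpa using ENNReal.tendsto_ofReal hr0) (fun n i => gridIndex (r n) ⁻¹' {(i : ℤ)})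
    (Eventually.of_forall fun n i => hdiam n i)
    (Eventually.of_forall fun n x hx => mem_iUnion.2
      ⟨⟨gridIndex (r n) x, (hfin n).mem_toFinset.2 ⟨x, hx, rfl⟩⟩, rfl⟩)
  have h2 : Tendsto (fun n => ENNReal.ofReal (((gridIndex (r n) '' A).ncard : ℝ) * r n ^ t))
      atTop (𝓝 0) := by simpa using ENNReal.tendsto_ofReal h
  rw [← nonpos_iff_eq_zero, ← h2.liminf_eq]
  refine h1.trans (liminf_le_liminf (Eventually.of_forall fun n => ?_))
  calc ∑ i : (hfin n).toFinset, Metric.ediam (gridIndex (r n) ⁻¹' {(i : ℤ)}) ^ t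
      ≤ ∑ _i : (hfin n).toFinset, ENNReal.ofReal (r n) ^ t :=
        Finset.sum_le_sum fun i _ => ENNReal.rpow_le_rpow (hdiam n i) ht
    _ = ENNReal.ofReal (((gridIndex (r n) '' A).ncard : ℝ) * r n ^ t) := by
        rw [ENNReal.ofReal_mul (by positivity), ENNReal.ofReal_natCast,
          ENNReal.ofReal_rpow_of_pos (hr n), Finset.sum_const, nsmul_eq_mul, Finset.card_univ,
          Fintype.card_coe, Set.ncard_eq_toFinset_card _ (hfin n)]

/-- A bounded set of nonzero `t`-dimensional Hausdorff measure needs at least a constant times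
`n ^ t` grid cells at all small scales `1 / n`. -/
theorem exists_le_ncard_gridIndex_of_hausdorffMeasure_ne_zero {t c d : ℝ} (ht : 0 ≤ t)
    {A : Set ℝ} (hA : A ⊆ Icc c d) (h : μH[t] A ≠ 0) :
    ∃ m : ℕ, ∀ n ≥ m, 1 / ((m : ℝ) + 1) ≤
      ((gridIndex (1 / ((n : ℝ) + 1)) '' A).ncard : ℝ) * (1 / ((n : ℝ) + 1)) ^ t := by
  contrapose! h
  choose n hn hlt using h
  have hpos : ∀ m, 0 < 1 / ((n m : ℝ) + 1) := fun m => by positivity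
  refine hausdorffMeasure_eq_zero_of_tendsto_ncard_gridIndex ht hpos ?_
    (fun m => finite_gridIndex_image (hpos m) hA) ?_
  · exact tendsto_one_div_add_atTop_nhds_zero_nat.comp (tendsto_atTop_mono hn tendsto_id)
  · exact squeeze_zero (fun m => by have := hpos m; positivity) (fun m => (hlt m).le)
      tendsto_one_div_add_atTop_nhds_zero_nat

/-- Double counting of pairs of cells: if `f` maps each cell of `B` into boundedly many cells and
each fibre over `Z` meets at least `D` cells, then `Z` meets few cells. -/
theorem finite_and_ncard_mul_le_of_fibers {X Y : Type*} {u : X → ℤ} {v : Y → ℤ} {f : X → Y}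
    {B : Set X} {Z : Set Y} {D : ℝ} (hD : 0 < D) (hB : (u '' B).Finite)
    (huv : ∀ x ∈ B, ∀ x' ∈ B, u x = u x' → |v (f x) - v (f x')| ≤ 1)
    (hZ : ∀ y ∈ Z, D ≤ ((u '' (B ∩ f ⁻¹' {y})).ncard : ℝ)) :
    (v '' Z).Finite ∧ ((v '' Z).ncard : ℝ) * D ≤ (u '' B).ncard * 3 := by
  classical
  have hrep : ∀ b : ℤ, ∃ w : ℤ, ∀ x ∈ B, u x = b → |v (f x) - w| ≤ 1 := by
    intro b
    by_cases hb : ∃ x' ∈ B, u x' = b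
    · obtain ⟨x', hx', rfl⟩ := hb
      exact ⟨v (f x'), fun x hx hxu => huv x hx x' hx' hxu⟩
    · exact ⟨0, fun x hx hxu => (hb ⟨x, hx, hxu⟩).elim⟩
  choose w hw using hrep
  have hsub : ∀ y ∈ Z, u '' (B ∩ f ⁻¹' {y}) ⊆
      (hB.toFinset.filter fun b => |v y - w b| ≤ 1 : Finset ℤ) := by
    rintro y - _ ⟨x, ⟨hx, rfl⟩, rfl⟩
    simp only [Finset.coe_filter, mem_ofPred_eq, hB.mem_toFinset]
    exact ⟨⟨x, hx, rfl⟩, hw _ x hx rfl⟩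
  have hcard : ∀ y ∈ Z, D ≤ ((hB.toFinset.filter fun b => |v y - w b| ≤ 1).card : ℝ) := by
    intro y hy
    refine (hZ y hy).trans ?_
    rw [← Set.ncard_coe_finset]
    exact_mod_cast Set.ncard_le_ncard (hsub y hy) (Finset.finite_toSet _)
  have hfin : (v '' Z).Finite := by
    refine (Finset.finite_toSet
      (hB.toFinset.biUnion fun b => Finset.Icc (w b - 1) (w b + 1))).subset ?_
    rintro _ ⟨y, hy, rfl⟩
    have h1 : 0 < (hB.toFinset.filter fun b => |v y - w b| ≤ 1).card := by
      exact_mod_cast hD.trans_le (hcard y hy)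
    obtain ⟨b, hb⟩ := Finset.card_pos.1 h1
    rw [Finset.mem_filter, abs_le] at hb
    rw [Finset.mem_coe, Finset.mem_biUnion]
    exact ⟨b, hb.1, Finset.mem_Icc.2 ⟨by linarith [hb.2.1], by linarith [hb.2.2]⟩⟩
  refine ⟨hfin, ?_⟩
  rw [Set.ncard_eq_toFinset_card _ hfin, Set.ncard_eq_toFinset_card _ hB]
  rw [← nsmul_eq_mul, ← nsmul_eq_mul]
  refine Finset.card_nsmul_le_card_nsmul (fun i b : ℤ => |i - w b| ≤ 1) (fun i hi => ?_)
    fun b _ => ?_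
  · obtain ⟨y, hy, rfl⟩ := hfin.mem_toFinset.1 hi
    exact hcard y hy
  · have h1 : Finset.bipartiteBelow (fun i b : ℤ => |i - w b| ≤ 1) hfin.toFinset b ⊆
        Finset.Icc (w b - 1) (w b + 1) := by
      intro i hi
      rw [Finset.mem_bipartiteBelow, abs_le] at hi
      exact Finset.mem_Icc.2 ⟨by linarith [hi.2.1], by linarith [hi.2.2]⟩
    have h2 := Finset.card_le_card h1
    rw [Int.card_Icc] at h2
    have h3 : (Finset.bipartiteBelow (fun i b : ℤ => |i - w b| ≤ 1) hfin.toFinset b).card ≤ 3 := by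
      omega
    exact_mod_cast h3

/-- **Eilenberg-type inequality.** If `f` satisfies a Hölder condition of exponent `k` on a bounded
set `B ⊆ ℝ` and `1 < t + k * s`, then almost every fibre of `f` on `B` with respect to the
`s`-dimensional Hausdorff measure has zero `t`-dimensional Hausdorff measure. -/
theorem hausdorffMeasure_setOf_fiber_ne_zero {k : ℕ} (hk : k ≠ 0) {s t c d C : ℝ} (hs : 0 ≤ s)
    (ht : 0 ≤ t) (hst : 1 < t + k * s) (hC : 0 < C) (hcd : c ≤ d) {B : Set ℝ} (hB : B ⊆ Icc c d)
    {f : ℝ → ℝ} (hf : ∀ x ∈ B, ∀ y ∈ B, |f x - f y| ≤ C * |x - y| ^ k) :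
    μH[s] {y : ℝ | μH[t] (B ∩ f ⁻¹' {y}) ≠ 0} = 0 := by
  set Z : ℕ → Set ℝ := fun m => {y | ∀ n ≥ m, 1 / ((m : ℝ) + 1) ≤
    ((gridIndex (1 / ((n : ℝ) + 1)) '' (B ∩ f ⁻¹' {y})).ncard : ℝ) * (1 / ((n : ℝ) + 1)) ^ t}
    with hZ
  have hcover : {y : ℝ | μH[t] (B ∩ f ⁻¹' {y}) ≠ 0} ⊆ ⋃ m, Z m := fun y hy =>
    mem_iUnion.2 (exists_le_ncard_gridIndex_of_hausdorffMeasure_ne_zero ht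
      (inter_subset_left.trans hB) hy)
  refine measure_mono_null hcover (measure_iUnion_null fun m => ?_)
  set q : ℕ → ℝ := fun j => 1 / (((j + m : ℕ) : ℝ) + 1) with hq
  have hq0 : ∀ j, 0 < q j := fun j => by positivity
  have hq1 : ∀ j, q j ≤ 1 := fun j => by
    rw [hq]
    exact div_le_one_of_le₀ (by linarith [Nat.cast_nonneg (α := ℝ) (j + m)]) (by positivity)
  have hqlim : Tendsto q atTop (𝓝 0) :=
    tendsto_one_div_add_atTop_nhds_zero_nat.comp (tendsto_add_atTop_nat m)
  have hr0 : ∀ j, 0 < C * q j ^ k := fun j => mul_pos hC (pow_pos (hq0 j) k)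
  have hm : (0 : ℝ) < 1 / ((m : ℝ) + 1) := by positivity
  have key : ∀ j, (gridIndex (C * q j ^ k) '' Z m).Finite ∧
      ((gridIndex (C * q j ^ k) '' Z m).ncard : ℝ) * (1 / ((m : ℝ) + 1) / q j ^ t) ≤
        (gridIndex (q j) '' B).ncard * 3 := by
    intro j
    have hqt : 0 < q j ^ t := Real.rpow_pos_of_pos (hq0 j) t
    refine finite_and_ncard_mul_le_of_fibers (f := f) (by positivity)
      (finite_gridIndex_image (hq0 j) hB) (fun x hx x' hx' hxx' => ?_) fun y hy => ?_
    · refine abs_gridIndex_sub_le_one (hr0 j) ((hf x hx x' hx').trans ?_)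
      gcongr
      exact abs_sub_le_of_gridIndex_eq (hq0 j) hxx'
    · rw [div_le_iff₀ hqt]
      exact hy (j + m) (Nat.le_add_left m j)
  refine hausdorffMeasure_eq_zero_of_tendsto_ncard_gridIndex hs hr0 ?_ (fun j => (key j).1) ?_
  · simpa [hk] using (hqlim.pow k).const_mul C
  have hlim : Tendsto (fun j => 3 * ((m : ℝ) + 1) * (d - c + 2) * C ^ s * q j ^ (t + k * s - 1))
      atTop (𝓝 0) := by
    have h1 := hqlim.rpow_const (p := t + k * s - 1) (Or.inr (by linarith))
    rw [Real.zero_rpow (by linarith)] at h1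
    simpa using h1.const_mul (3 * ((m : ℝ) + 1) * (d - c + 2) * C ^ s)
  refine squeeze_zero (fun j => by have := hr0 j; positivity) (fun j => ?_) hlim
  have hqj := hq0 j
  have hqt : 0 < q j ^ t := Real.rpow_pos_of_pos hqj t
  have hcells : ((gridIndex (q j) '' B).ncard : ℝ) ≤ (d - c + 2) / q j := by
    refine (ncard_gridIndex_image_le hqj hcd hB).trans ?_
    rw [add_div]
    gcongr
    rw [le_div_iff₀ hqj]
    linarith [hq1 j]
  have hcount : ((gridIndex (C * q j ^ k) '' Z m).ncard : ℝ) ≤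
      3 * ((m : ℝ) + 1) * (d - c + 2) * (q j ^ t / q j) := by
    have h1 := (key j).2
    rw [div_div, mul_one_div, div_le_iff₀ (by positivity)] at h1
    refine h1.trans ?_
    calc ((gridIndex (q j) '' B).ncard : ℝ) * 3 * (((m : ℝ) + 1) * q j ^ t)
        ≤ (d - c + 2) / q j * 3 * (((m : ℝ) + 1) * q j ^ t) := by gcongr
      _ = _ := by ring
  have hpow : (C * q j ^ k) ^ s = C ^ s * q j ^ ((k : ℝ) * s) := by
    rw [Real.mul_rpow hC.le (by positivity), ← Real.rpow_natCast, ← Real.rpow_mul hqj.le]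
  have hexp : q j ^ t / q j * q j ^ ((k : ℝ) * s) = q j ^ (t + k * s - 1) := by
    rw [Real.rpow_sub hqj, Real.rpow_add hqj, Real.rpow_one]
    ring
  rw [hpow, ← hexp]
  calc _ ≤ 3 * ((m : ℝ) + 1) * (d - c + 2) * (q j ^ t / q j) * (C ^ s * q j ^ ((k : ℝ) * s)) := by
        gcongr
    _ = _ := by ring

/-- The points of a level set at which the derivative does not vanish form a countable set. -/
theorem countable_setOf_eq_of_deriv_ne_zero (g : ℝ → ℝ) (y : ℝ) :
    {x | g x = y ∧ deriv g x ≠ 0}.Countable := by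
  have : DiscreteTopology {x | g x = y ∧ deriv g x ≠ 0} := by
    rw [discreteTopology_subtype_iff]
    rintro x ⟨-, hx⟩
    have h := (differentiableAt_of_deriv_ne_zero hx).hasDerivAt.eventually_ne hx (c := y)
    rw [← disjoint_iff, disjoint_principal_right]
    filter_upwards [h] with z hz hz'
    exact hz hz'.1
  exact Set.countable_coe_iff.1 (TopologicalSpace.separableSpace_iff_countable.1 inferInstance)

/-- At all but countably many points of a level set of `f`, the derivatives of `f` of orders
`1, …, k - 1` vanish. -/
theorem countable_level_set_diff_flat (f : ℝ → ℝ) (y : ℝ) (k : ℕ) :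
    {x | f x = y ∧ ∃ j ∈ Ico 1 k, iteratedDeriv j f x ≠ 0}.Countable := by
  refine ((countable_setOf_eq_of_deriv_ne_zero f y).union (countable_iUnion fun j : ℕ =>
    countable_setOf_eq_of_deriv_ne_zero (iteratedDeriv j f) 0)).mono ?_
  rintro x ⟨hxy, j, hj, hne⟩
  by_contra hx
  simp only [mem_union, mem_iUnion, mem_ofPred_eq, not_or, not_exists, not_and, not_not] at hx
  have h : ∀ i, iteratedDeriv (i + 1) f x = 0 := by
    intro i
    induction i with
    | zero => simpa using hx.1 hxy
    | succ i ih => rw [iteratedDeriv_succ]; exact hx.2 (i + 1) ih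
  exact hne (by simpa [Nat.sub_add_cancel hj.1] using h (j - 1))

/-- A `C^k` function satisfies a Hölder condition of exponent `k` on the set of points of a compact
interval where its derivatives of orders `1, …, k - 1` vanish. -/
theorem exists_abs_sub_le_pow_of_iteratedDeriv_eq_zero {k : ℕ} (hk : 1 ≤ k) {a b c d : ℝ}
    {f : ℝ → ℝ} (hf : ContDiffOn ℝ k f (Ioo a b)) (hcd : Icc c d ⊆ Ioo a b) :
    ∃ C > 0, ∀ x ∈ Icc c d, ∀ y ∈ Icc c d, (∀ j ∈ Ico 1 k, iteratedDeriv j f x = 0) →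
      (∀ j ∈ Ico 1 k, iteratedDeriv j f y = 0) → |f x - f y| ≤ C * |x - y| ^ k := by
  have hcont : ContinuousOn (iteratedDeriv k f) (Icc c d) :=
    ((hf.continuousOn_iteratedDerivWithin le_rfl isOpen_Ioo.uniqueDiffOn).congr
      fun x hx => (iteratedDerivWithin_of_isOpen isOpen_Ioo hx).symm).mono hcd
  obtain ⟨M, hM⟩ := isCompact_Icc.exists_bound_of_continuousOn hcont
  obtain ⟨n, rfl⟩ : ∃ n, k = n + 1 := ⟨k - 1, by omega⟩
  have main : ∀ x ∈ Icc c d, ∀ y ∈ Icc c d, x < y →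
      (∀ j ∈ Ico 1 (n + 1), iteratedDeriv j f x = 0) →
        |f y - f x| ≤ max M 1 * |y - x| ^ (n + 1) := by
    intro x hx y hy hxy hflat
    have hsub : Icc x y ⊆ Icc c d := Icc_subset_Icc hx.1 hy.2
    have hderiv : ∀ j ≤ n + 1, ∀ z ∈ Icc x y,
        iteratedDerivWithin j f (Icc x y) z = iteratedDeriv j f z := fun j hj z hz =>
      iteratedDerivWithin_eq_iteratedDeriv (uniqueDiffOn_Icc hxy)
        ((hf.contDiffAt (isOpen_Ioo.mem_nhds (hcd (hsub hz)))).of_le (by exact_mod_cast hj)) hz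
    have htaylor := taylor_mean_remainder_bound (C := max M 1) (n := n) hxy.le
      (by exact_mod_cast hf.mono (hsub.trans hcd)) (right_mem_Icc.2 hxy.le)
      fun z hz => by
        rw [hderiv _ le_rfl z hz]
        exact (hM z (hsub hz)).trans (le_max_left _ _)
    have heval : taylorWithinEval f n (Icc x y) x y = f x := by
      rw [taylor_within_apply, Finset.sum_range_succ', Finset.sum_eq_zero]
      · simp
      · intro j hj
        rw [Finset.mem_range] at hj
        rw [hderiv _ (by omega) x (left_mem_Icc.2 hxy.le), hflat _ ⟨by omega, by omega⟩, smul_zero]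
    rw [heval, Real.norm_eq_abs] at htaylor
    rw [abs_of_pos (sub_pos.2 hxy)]
    refine htaylor.trans (div_le_self ?_ (by exact_mod_cast Nat.factorial_pos n))
    have := sub_pos.2 hxy
    positivity
  refine ⟨max M 1, by positivity, fun x hx y hy hfx hfy => ?_⟩
  rcases lt_trichotomy x y with h | rfl | h
  · rw [abs_sub_comm (f x), abs_sub_comm x]
    exact main x hx y hy h hfx
  · simp
  · exact main y hy x hx h hfy

/-- If `1 < t + k * s`, then the level sets of a `C^k` function on a compact interval have zero
`t`-dimensional Hausdorff measure except for a set of values of zero `s`-dimensional Hausdorff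
measure. -/
theorem hausdorffMeasure_setOf_level_set_ne_zero {k : ℕ} (hk : 1 ≤ k) {a b c d s t : ℝ}
    (hs : 0 ≤ s) (ht : 0 < t) (hst : 1 < t + k * s) {f : ℝ → ℝ}
    (hf : ContDiffOn ℝ k f (Ioo a b)) (hcd : Icc c d ⊆ Ioo a b) :
    μH[s] {y : ℝ | μH[t] (Icc c d ∩ f ⁻¹' {y}) ≠ 0} = 0 := by
  rcases lt_or_ge d c with hdc | hcd'
  · simp [Icc_eq_empty_of_lt hdc]
  obtain ⟨C, hC, hCf⟩ := exists_abs_sub_le_pow_of_iteratedDeriv_eq_zero hk hf hcd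
  set B : Set ℝ := {x ∈ Icc c d | ∀ j ∈ Ico 1 k, iteratedDeriv j f x = 0} with hB
  refine measure_mono_null (fun y hy => ?_)
    (hausdorffMeasure_setOf_fiber_ne_zero (by omega) hs ht.le hst hC hcd' (B := B)
      (fun x hx => hx.1) (f := f) fun x hx y hy => hCf x hx.1 y hy.1 hx.2 hy.2)
  contrapose! hy
  rw [mem_ofPred_eq, not_not] at hy ⊢
  have := Measure.nullSingletonClass_hausdorff ℝ ht
  refine measure_mono_null (fun x hx => ?_)
    (measure_union_null hy ((countable_level_set_diff_flat f y k).measure_zero μH[t]))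
  by_cases hflat : ∀ j ∈ Ico 1 k, iteratedDeriv j f x = 0
  · exact Or.inl ⟨⟨hx.1, hflat⟩, hx.2⟩
  · push Not at hflat
    exact Or.inr ⟨hx.2, hflat⟩

/-- **Upper bound.** For `k ≥ 1`, `0 < α < 1`, a nonempty open interval `E = Ioo a b`,
and any `C^k` function `f : E → ℝ`, the Hausdorff dimension of
`I_α(f) = {y : dim_H f⁻¹(y) ≥ α}` is at most `(1 - α)/k`. -/
theorem dimH_large_level_sets_le (k : ℕ) (hk : 1 ≤ k) (α : ℝ) (hα0 : 0 < α)
    (hα1 : α < 1) (a b : ℝ) (hab : a < b) (f : ℝ → ℝ)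
    (hf : ContDiffOn ℝ k f (Set.Ioo a b)) :
    dimH {y : ℝ | ENNReal.ofReal α ≤ dimH (Set.Ioo a b ∩ f ⁻¹' {y})} ≤
      ENNReal.ofReal ((1 - α) / k) := by
  refine dimH_le fun s hs => ?_
  by_contra! hlt
  have hk0 : (0 : ℝ) < k := by exact_mod_cast hk
  have hsα : (1 - α) / k < s := by
    rw [← ENNReal.ofReal_coe_nnreal] at hlt
    exact (ENNReal.ofReal_lt_ofReal_iff_of_nonneg
      (div_nonneg (by linarith) hk0.le)).1 hlt
  rw [div_lt_iff₀ hk0] at hsα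
  obtain ⟨t, ht1, ht2⟩ := exists_between (max_lt hα0 (by linarith : 1 - k * (s : ℝ) < α))
  obtain ⟨ht0, hst⟩ := max_lt_iff.1 ht1
  have hIoo : Ioo a b = ⋃ n : ℕ, Icc (a + 1 / ((n : ℝ) + 1)) (b - 1 / ((n : ℝ) + 1)) := by
    refine Subset.antisymm (fun x hx => ?_) (iUnion_subset fun n x hx => ?_)
    · obtain ⟨n, hn⟩ := exists_nat_one_div_lt (lt_min (sub_pos.2 hx.1) (sub_pos.2 hx.2))
      rw [lt_min_iff] at hn
      exact mem_iUnion.2 ⟨n, by linarith [hn.1], by linarith [hn.2]⟩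
    · have : (0 : ℝ) < 1 / ((n : ℝ) + 1) := by positivity
      exact ⟨by linarith [hx.1], by linarith [hx.2]⟩
  have hnull : μH[s] (⋃ n : ℕ, {y : ℝ | μH[t] (Icc (a + 1 / ((n : ℝ) + 1))
      (b - 1 / ((n : ℝ) + 1)) ∩ f ⁻¹' {y}) ≠ 0}) = 0 :=
    measure_iUnion_null fun n => hausdorffMeasure_setOf_level_set_ne_zero hk s.coe_nonneg ht0
      (by linarith) hf (hIoo ▸ subset_iUnion (fun n : ℕ => Icc (a + 1 / ((n : ℝ) + 1))
        (b - 1 / ((n : ℝ) + 1))) n)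
  refine ENNReal.zero_ne_top ((measure_mono_null (fun y hy => ?_) hnull).symm.trans hs)
  lift t to NNReal using ht0.le
  have hdim : (t : ENNReal) < dimH (Ioo a b ∩ f ⁻¹' {y}) := by
    refine lt_of_lt_of_le ?_ hy
    rw [← ENNReal.ofReal_coe_nnreal]
    exact (ENNReal.ofReal_lt_ofReal_iff hα0).2 ht2
  by_contra hmem
  simp only [mem_iUnion, mem_ofPred_eq, not_exists, not_not] at hmem
  have h0 : μH[t] (Ioo a b ∩ f ⁻¹' {y}) = 0 := by
    rw [hIoo, iUnion_inter]
    exact measure_iUnion_null hmem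
  exact ENNReal.zero_ne_top (h0.symm.trans (hausdorffMeasure_of_lt_dimH hdim))
end

section
/- Let k ≥ 1 be a natural number, let 0 < α < 1, and let E be a nonempty open interval in ℝ. Then for every η > 0 there exists f ∈ C^k(E,ℝ) such that L(α,f) > (1-α)/k − η; consequently sup{ L(α,f) : f ∈ C^k(E,ℝ) } ≥ (1-α)/k. -/
open MeasureTheory Set

theorem half_pow_le_abs_tsum_mul_pow {u : ℕ → ℝ} {r A : ℝ} {m : ℕ} (hr : 0 < r) (hA : 0 ≤ A)
    (hAr : 2 * (A + 1) * r ≤ 1) (hlt : ∀ n < m, u n = 0) (hm : 1 ≤ |u m|) (hu : ∀ n, |u n| ≤ A) :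
    r ^ m / 2 ≤ |∑' n, u n * r ^ n| := by
  have hr1 : r < 1 := by nlinarith
  have hgeo := hasSum_geometric_of_lt_one hr.le hr1
  have hsum : Summable fun n => u n * r ^ n := by
    refine Summable.of_norm_bounded (hgeo.summable.mul_left A) fun n => ?_
    rw [Real.norm_eq_abs, abs_mul, abs_of_pos (pow_pos hr n)]
    exact mul_le_mul_of_nonneg_right (hu n) (pow_pos hr n).le
  have htail : |∑' n, u (n + (m + 1)) * r ^ (n + (m + 1))| ≤ A * r ^ (m + 1) * (1 - r)⁻¹ := by
    rw [← Real.norm_eq_abs]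
    refine tsum_of_norm_bounded (hgeo.mul_left (A * r ^ (m + 1))) fun n => ?_
    rw [Real.norm_eq_abs, abs_mul, abs_of_pos (pow_pos hr _)]
    calc |u (n + (m + 1))| * r ^ (n + (m + 1)) ≤ A * r ^ (n + (m + 1)) :=
          mul_le_mul_of_nonneg_right (hu _) (pow_pos hr _).le
      _ = A * r ^ (m + 1) * r ^ n := by ring
  have hhead : ∑ n ∈ Finset.range (m + 1), u n * r ^ n = u m * r ^ m := by
    rw [Finset.sum_range_succ, Finset.sum_eq_zero, zero_add]
    intro n hn
    rw [hlt n (Finset.mem_range.mp hn), zero_mul]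
  have hAle : A * r ^ (m + 1) * (1 - r)⁻¹ ≤ r ^ m / 2 := by
    rw [← div_eq_mul_inv, div_le_iff₀ (by linarith), pow_succ]
    nlinarith [pow_pos hr m]
  rw [← hsum.sum_add_tsum_nat_add (m + 1), hhead]
  have h1 : r ^ m ≤ |u m * r ^ m| := by
    rw [abs_mul, abs_of_pos (pow_pos hr m)]
    exact le_mul_of_one_le_left (pow_pos hr m).le hm
  have h2 := abs_sub_abs_le_abs_add (u m * r ^ m) (∑' n, u (n + (m + 1)) * r ^ (n + (m + 1)))
  linarith

theorem summable_fin_mul_pow {N : ℕ} (x : ℕ → Fin N) {r : ℝ} (hr : 0 ≤ r) (hr1 : r < 1) :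
    Summable fun n => (x n : ℝ) * r ^ n := by
  refine Summable.of_nonneg_of_le (fun n => by positivity) (fun n => ?_)
    ((summable_geometric_of_lt_one hr hr1).mul_left (N : ℝ))
  exact mul_le_mul_of_nonneg_right (by exact_mod_cast (x n).isLt.le) (by positivity)

theorem le_dimH_range_of_abs_sub_le_rpow {X : Type*} {φ ψ : X → ℝ} {C s : ℝ} (hC : 0 ≤ C)
    (hs : 0 < s) (h : ∀ x y, |ψ x - ψ y| ≤ C * |φ x - φ y| ^ s)
    (hψ : Icc 0 1 ⊆ range ψ) : ENNReal.ofReal s ≤ dimH (range φ) := by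
  classical
  lift C to NNReal using hC
  lift s to NNReal using hs.le
  have : Nonempty X := by
    obtain ⟨x, -⟩ := hψ (⟨le_rfl, zero_le_one⟩ : (0 : ℝ) ∈ Icc 0 1)
    exact ⟨x⟩
  have hinv : ∀ x, φ (Function.invFun φ (φ x)) = φ x := fun x =>
    Function.invFun_eq ⟨x, rfl⟩
  have hg : ∀ x, ψ (Function.invFun φ (φ x)) = ψ x := fun x => by
    have := h (Function.invFun φ (φ x)) x
    rw [hinv, sub_self, abs_zero, Real.zero_rpow hs.ne', mul_zero] at this
    exact sub_eq_zero.mp (abs_nonpos_iff.mp this)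
  have hholder : HolderOnWith C s (ψ ∘ Function.invFun φ) (range φ) := by
    rintro _ ⟨x, rfl⟩ _ ⟨y, rfl⟩
    simp only [Function.comp, hg, edist_dist, Real.dist_eq]
    rw [ENNReal.ofReal_rpow_of_nonneg (abs_nonneg _) hs.le, ← ENNReal.ofReal_coe_nnreal,
      ← ENNReal.ofReal_mul C.coe_nonneg]
    exact ENNReal.ofReal_le_ofReal (h x y)
  have himage : Icc (0 : ℝ) 1 ⊆ (ψ ∘ Function.invFun φ) '' range φ := by
    intro t ht
    obtain ⟨x, rfl⟩ := hψ ht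
    exact ⟨φ x, ⟨x, rfl⟩, hg x⟩
  have hIcc : dimH (Icc (0 : ℝ) 1) = 1 := by
    rw [Real.dimH_of_nonempty_interior (by rw [interior_Icc]; exact nonempty_Ioo.mpr one_pos)]
    simp
  have hle := (dimH_mono himage).trans (hholder.dimH_image_le (by exact_mod_cast hs))
  have hs' : (s : ENNReal) ≠ 0 := by exact_mod_cast hs.ne'
  rw [hIcc, ENNReal.le_div_iff_mul_le (Or.inl hs') (Or.inl ENNReal.coe_ne_top), one_mul] at hle
  rwa [ENNReal.ofReal_coe_nnreal]

theorem le_dimH_range_digit_series {N : ℕ} (hN : 2 ≤ N) {r s p c : ℝ} (hr : 0 < r)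
    (hNr : 2 * N * r ≤ 1) (hs : 0 < s) (hNs : 1 ≤ N * r ^ s) (hc : c ≠ 0) :
    ENNReal.ofReal s ≤ dimH (range fun x : ℕ → Fin N => p + c * ∑' n, (x n : ℝ) * r ^ n) := by
  have hN' : (2 : ℝ) ≤ N := by exact_mod_cast hN
  have hr1 : r < 1 := by nlinarith
  refine le_dimH_range_of_abs_sub_le_rpow (ψ := Real.ofDigits) (C := (2 / |c|) ^ s)
    (by positivity) hs (fun x y => ?_) fun t ht => ?_
  · by_cases hxy : x = y
    · subst hxy
      simp only [sub_self, abs_zero]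
      positivity
    have hex : ∃ n, x n ≠ y n := Function.ne_iff.mp hxy
    classical
    let m := Nat.find hex
    have hm : x m ≠ y m := Nat.find_spec hex
    have hlt : ∀ n < m, x n = y n := fun n hn => not_not.mp (Nat.find_min hex hn)
    have hlow : r ^ m / 2 ≤ |∑' n, ((x n : ℝ) - y n) * r ^ n| := by
      refine half_pow_le_abs_tsum_mul_pow (A := N - 1) hr (by linarith) (by linarith)
        (fun n hn => by rw [hlt n hn, sub_self]) ?_ fun n => ?_
      · have h : ((x m : ℕ) : ℤ) - (y m : ℕ) ≠ 0 := by
          have := Fin.val_ne_of_ne hm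
          omega
        exact_mod_cast Int.one_le_abs h
      · have hx : ((x n : ℕ) : ℝ) + 1 ≤ N := by exact_mod_cast (x n).isLt
        have hy : ((y n : ℕ) : ℝ) + 1 ≤ N := by exact_mod_cast (y n).isLt
        have hx0 : (0 : ℝ) ≤ (x n : ℕ) := Nat.cast_nonneg _
        have hy0 : (0 : ℝ) ≤ (y n : ℕ) := Nat.cast_nonneg _
        rw [abs_le]
        constructor <;> linarith
    have hdiff : (p + c * ∑' n, (x n : ℝ) * r ^ n) - (p + c * ∑' n, (y n : ℝ) * r ^ n) =
        c * ∑' n, ((x n : ℝ) - y n) * r ^ n := by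
      simp_rw [sub_mul]
      rw [(summable_fin_mul_pow x hr.le hr1).tsum_sub (summable_fin_mul_pow y hr.le hr1)]
      ring
    rw [hdiff, ← Real.mul_rpow (by positivity) (abs_nonneg _), abs_mul]
    have hc' : 0 < |c| := abs_pos.mpr hc
    calc |Real.ofDigits x - Real.ofDigits y| ≤ ((N : ℝ) ^ m)⁻¹ :=
          Real.abs_ofDigits_sub_ofDigits_le hlt
      _ ≤ (r ^ s) ^ m := by
          rw [inv_le_iff_one_le_mul₀' (by positivity), ← mul_pow]
          exact one_le_pow₀ hNs
      _ = (r ^ m) ^ s := by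
          rw [← Real.rpow_natCast, ← Real.rpow_natCast, ← Real.rpow_mul hr.le,
            ← Real.rpow_mul hr.le, mul_comm]
      _ ≤ _ := by
          refine Real.rpow_le_rpow (by positivity) ?_ hs.le
          rw [← mul_assoc, div_mul_cancel₀ _ hc'.ne']
          linarith
  · obtain ⟨x, -, hx⟩ := Real.ofDigits_SurjOn (b := N) (by omega) ht
    exact ⟨x, hx⟩

theorem exists_contDiff_periodic_step {M N b : ℕ} (hb : 2 * M * (N + 1) ≤ b) :
    ∃ G : ℝ → ℝ, ContDiff ℝ (⊤ : ℕ∞) G ∧ Function.Periodic G 1 ∧ ∀ i < M, ∀ t : ℝ,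
      (i * (N + 1) : ℝ) / b ≤ t → t ≤ (i * (N + 1) + N : ℝ) / b → G t = i := by
  let w : ℝ → ℝ := fun t => Real.cos (2 * Real.pi * t)
  have hw : StrictAntiOn w (Icc 0 (1 / 2)) := by
    intro s hs t ht hst
    have hpi := Real.pi_pos
    exact Real.strictAntiOn_cos ⟨by nlinarith [hs.1], by nlinarith [hs.2]⟩
      ⟨by nlinarith [ht.1], by nlinarith [ht.2]⟩ (by nlinarith)
  let p : ℕ → ℝ := fun l => (l * (N + 1) + N : ℝ) / b
  let q : ℕ → ℝ := fun l => ((l + 1) * (N + 1) : ℝ) / b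
  refine ⟨fun t => ∑ l ∈ Finset.range (M - 1),
    Real.smoothTransition ((w (p l) - w t) / (w (p l) - w (q l))), ?_, ?_, ?_⟩
  · refine ContDiff.sum fun l _ => Real.smoothTransition.contDiff.comp ?_
    refine (contDiff_const.sub ?_).div_const _
    exact Real.contDiff_cos.comp (contDiff_const.mul contDiff_id)
  · intro t
    have : w (t + 1) = w t := by
      simp only [w, mul_add, mul_one, Real.cos_add_two_pi]
    simp only [this]
  · intro i hi t hit hti
    have hb0 : 0 < b := by
      have hM : 0 < M := by omega
      have : 0 < 2 * M * (N + 1) := by positivity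
      omega
    have hbR : (0 : ℝ) < b := by exact_mod_cast hb0
    have hbM : (2 * M * (N + 1) : ℝ) ≤ b := by exact_mod_cast hb
    have hmem : ∀ z : ℝ, 0 ≤ z → z ≤ M * (N + 1) → z / b ∈ Icc (0 : ℝ) (1 / 2) := fun z hz hz' =>
      ⟨by positivity, by rw [div_le_iff₀ hbR]; linarith⟩
    have hiM : (i + 1 : ℝ) ≤ M := by exact_mod_cast hi
    have hN0 : (0 : ℝ) ≤ N := Nat.cast_nonneg N
    have ht : t ∈ Icc (0 : ℝ) (1 / 2) :=
      ⟨le_trans (by positivity) hit, hti.trans (hmem _ (by positivity) (by nlinarith)).2⟩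
    have hval : ∀ l ∈ Finset.range (M - 1),
        Real.smoothTransition ((w (p l) - w t) / (w (p l) - w (q l))) = if l < i then 1 else 0 := by
      intro l hl
      have hlM : (l + 1 : ℝ) ≤ M := by
        have := Finset.mem_range.mp hl
        have : l + 1 ≤ M := by omega
        exact_mod_cast this
      have hp : p l ∈ Icc (0 : ℝ) (1 / 2) := hmem _ (by positivity) (by nlinarith)
      have hq : q l ∈ Icc (0 : ℝ) (1 / 2) := hmem _ (by positivity) (by nlinarith)
      have hpq : 0 < w (p l) - w (q l) := by
        refine sub_pos.mpr (hw hp hq ?_)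
        exact div_lt_div_of_pos_right (by linarith) hbR
      split_ifs with h
      · refine Real.smoothTransition.one_of_one_le ((one_le_div hpq).mpr ?_)
        have hli : (l + 1 : ℝ) ≤ i := by exact_mod_cast h
        have : q l ≤ t := le_trans (div_le_div_of_nonneg_right (by nlinarith) hbR.le) hit
        linarith [hw.antitoneOn hq ht this]
      · refine Real.smoothTransition.zero_of_nonpos (div_nonpos_of_nonpos_of_nonneg ?_ hpq.le)
        have hli : (i : ℝ) ≤ l := by exact_mod_cast not_lt.mp h
        have : t ≤ p l := hti.trans (div_le_div_of_nonneg_right (by nlinarith) hbR.le)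
        linarith [hw.antitoneOn ht hp this]
    refine (Finset.sum_congr rfl hval).trans ?_
    rw [Finset.sum_boole]
    congr 1
    have : Finset.filter (fun l => l < i) (Finset.range (M - 1)) = Finset.range i := by
      ext l
      simp only [Finset.mem_filter, Finset.mem_range]
      omega
    rw [this, Finset.card_range]

theorem Function.Periodic.iteratedDeriv {G : ℝ → ℝ} {c : ℝ} (hG : Function.Periodic G c) (n : ℕ) :
    Function.Periodic (iteratedDeriv n G) c := by
  intro x
  have h : (fun z => G (z + c)) = G := funext hG
  have := congrFun (iteratedDeriv_comp_add_const (n := n) (f := G) (s := c)) x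
  rw [h] at this
  exact this.symm

theorem contDiff_tsum_pow_mul_comp_pow_mul {G : ℝ → ℝ} (hG : ContDiff ℝ (⊤ : ℕ∞) G)
    (hper : Function.Periodic G 1) {k : ℕ} {r b : ℝ} (hr : 0 ≤ r) (hb : 1 ≤ b)
    (hrb : r * b ^ k < 1) : ContDiff ℝ k fun x => ∑' n : ℕ, r ^ n * G (b ^ n * x) := by
  have hbdd : ∀ j : ℕ, ∃ C, ∀ x, |iteratedDeriv j G x| ≤ C := fun j => by
    obtain ⟨C, hC⟩ := ((hper.iteratedDeriv j).isBounded_of_continuous one_ne_zero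
      (hG.continuous_iteratedDeriv j (by exact_mod_cast le_top))).exists_norm_le
    exact ⟨C, fun x => hC _ ⟨x, rfl⟩⟩
  choose C hC using hbdd
  refine contDiff_tsum (N := (k : ℕ∞)) (v := fun j n => (r * b ^ j) ^ n * C j) (fun n => ?_)
    (fun j hj => ?_) fun j n x hj => ?_
  · exact contDiff_const.mul ((hG.of_le (by exact_mod_cast le_top)).comp
      (contDiff_const.mul contDiff_id))
  · have hj' : j ≤ k := by exact_mod_cast hj
    refine (summable_geometric_of_lt_one (by positivity) (lt_of_le_of_lt ?_ hrb)).mul_right _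
    exact mul_le_mul_of_nonneg_left (pow_le_pow_right₀ hb hj') hr
  · rw [norm_iteratedFDeriv_eq_norm_iteratedDeriv, iteratedDeriv_const_mul_field,
      iteratedDeriv_comp_const_mul (hG.of_le (by exact_mod_cast le_top)), Real.norm_eq_abs,
      abs_mul, abs_mul, abs_of_nonneg (by positivity), abs_of_nonneg (by positivity), ← mul_assoc]
    calc r ^ n * (b ^ n) ^ j * |iteratedDeriv j G (b ^ n * x)|
        ≤ r ^ n * (b ^ n) ^ j * C j := mul_le_mul_of_nonneg_left (hC j _) (by positivity)
      _ = (r * b ^ j) ^ n * C j := by rw [mul_pow, ← pow_mul, ← pow_mul, mul_comm n j]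

theorem exists_pow_mul_ofDigits_eq {b : ℕ} (hb : 0 < b) (d : ℕ → Fin b) (m : ℕ) :
    ∃ z : ℕ, (b : ℝ) ^ m * Real.ofDigits d = z + Real.ofDigits fun n => d (n + m) := by
  have hb' : (b : ℝ) ≠ 0 := by positivity
  induction m with
  | zero => exact ⟨0, by simp⟩
  | succ m ih =>
    obtain ⟨z, hz⟩ := ih
    refine ⟨b * z + d m, ?_⟩
    rw [pow_succ', mul_assoc, hz, Real.ofDigits_eq_sum_add_ofDigits (fun n => d (n + m)) 1]
    simp only [Finset.sum_range_one, Real.ofDigitsTerm, zero_add, pow_one]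
    push_cast
    field_simp
    simp only [add_assoc, add_comm 1]

theorem comp_pow_mul_ofDigits {b : ℕ} (hb : 0 < b) {G : ℝ → ℝ} (hper : Function.Periodic G 1)
    (d : ℕ → Fin b) (m : ℕ) : ∃ t : ℝ, (d m : ℝ) / b ≤ t ∧ t ≤ (d m + 1 : ℝ) / b ∧
      G (b ^ m * Real.ofDigits d) = G t := by
  have hb' : (0 : ℝ) < b := by positivity
  obtain ⟨z, hz⟩ := exists_pow_mul_ofDigits_eq hb d m
  refine ⟨Real.ofDigits fun n => d (n + m), ?_, ?_, ?_⟩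
  · rw [Real.ofDigits_eq_sum_add_ofDigits _ 1]
    simp only [Finset.sum_range_one, Real.ofDigitsTerm, zero_add, pow_one, div_eq_mul_inv]
    exact le_add_of_nonneg_right (mul_nonneg (by positivity) (Real.ofDigits_nonneg _))
  · rw [Real.ofDigits_eq_sum_add_ofDigits _ 1]
    simp only [Finset.sum_range_one, Real.ofDigitsTerm, zero_add, pow_one, div_eq_mul_inv, add_mul,
      one_mul]
    gcongr
    exact mul_le_of_le_one_right (by positivity) (Real.ofDigits_le_one _)
  · rw [hz, add_comm]
    simpa using hper.nat_mul z (Real.ofDigits fun n => d (n + m))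

theorem exists_contDiff_le_dimH_level_sets {k M N b : ℕ} {α s : ℝ} (hα : 0 < α) (hs : 0 < s)
    (hM : 2 ≤ M) (hN : 2 ≤ N) (hb : 2 * M * (N + 1) ≤ b) (hk : 1 ≤ k) (hNα : (b : ℝ) ^ α ≤ N)
    (hMs : (2 * (b : ℝ) ^ k) ^ s ≤ M) {l u : ℝ} (hlu : l < u) :
    ∃ f : ℝ → ℝ, ContDiff ℝ k f ∧
      ENNReal.ofReal s ≤ dimH {y : ℝ | ENNReal.ofReal α ≤ dimH (Ioo l u ∩ f ⁻¹' {y})} := by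
  have hb0 : 0 < b := lt_of_lt_of_le (by positivity) hb
  have hbR : (0 : ℝ) < b := by exact_mod_cast hb0
  have hb1 : (1 : ℝ) ≤ b := by exact_mod_cast hb0
  have hMb : 2 * M ≤ b := by nlinarith
  have hNb : 2 * N ≤ b := by nlinarith
  have hb2 : (b : ℝ)⁻¹ < 1 := inv_lt_one_of_one_lt₀ (by
    have : 1 < b := by omega
    exact_mod_cast this)
  obtain ⟨G, hG, hper, hstep⟩ := exists_contDiff_periodic_step hb
  set r : ℝ := (2 * (b : ℝ) ^ k)⁻¹ with hr
  have hr0 : 0 < r := by positivity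
  have hbk : (b : ℝ) ≤ b ^ k := le_self_pow₀ hb1 (by omega)
  let F : ℝ → ℝ := fun x => ∑' n : ℕ, r ^ n * G ((b : ℝ) ^ n * x)
  have hF : ContDiff ℝ k F := by
    refine contDiff_tsum_pow_mul_comp_pow_mul hG hper hr0.le hb1 ?_
    rw [hr, mul_inv, mul_assoc, inv_mul_cancel₀ (by positivity)]
    norm_num
  let p : ℝ := l + (u - l) / 4
  let c : ℝ := (u - l) / 2
  have hc : 0 < c := by simp only [c]; linarith
  refine ⟨fun x => F ((x - p) / c), hF.comp ((contDiff_id.sub contDiff_const).div_const c), ?_⟩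
  have hMr : 2 * M * r ≤ 1 := by
    rw [hr, ← div_eq_mul_inv, div_le_one (by positivity)]
    have : (2 * M : ℝ) ≤ b := by exact_mod_cast hMb
    linarith
  have hMs' : 1 ≤ M * r ^ s := by
    rw [hr, Real.inv_rpow (by positivity), ← div_eq_mul_inv, one_le_div (by positivity)]
    exact hMs
  refine (le_dimH_range_digit_series (p := 0) (c := 1) hM hr0 hMr hs hMs' one_ne_zero).trans
    (dimH_mono ?_)
  rintro _ ⟨i, rfl⟩
  simp only [zero_add, one_mul, mem_ofPred_eq]
  have hdlt : ∀ (j : ℕ → Fin N) n, (i n : ℕ) * (N + 1) + j n < b := fun j n => by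
    have h1 := (i n).isLt
    have h2 := (j n).isLt
    nlinarith
  let d : (ℕ → Fin N) → ℕ → Fin b := fun j n => ⟨_, hdlt j n⟩
  have hNb' : 2 * N * (b : ℝ)⁻¹ ≤ 1 := by
    rw [← div_eq_mul_inv, div_le_one hbR]
    exact_mod_cast hNb
  have hNα' : 1 ≤ N * ((b : ℝ)⁻¹) ^ α := by
    rw [Real.inv_rpow hbR.le, ← div_eq_mul_inv, one_le_div (by positivity)]
    exact hNα
  refine (le_dimH_range_digit_series
    (p := p + c * ((N + 1) * (b : ℝ)⁻¹ * ∑' n, (i n : ℝ) * (b : ℝ)⁻¹ ^ n)) (c := c * (b : ℝ)⁻¹)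
    hN (inv_pos.mpr hbR) hNb' hα hNα' (by positivity)).trans (dimH_mono ?_)
  rintro _ ⟨j, rfl⟩
  have hdig : (p + c * ((N + 1) * (b : ℝ)⁻¹ * ∑' n, (i n : ℝ) * (b : ℝ)⁻¹ ^ n)) +
      c * (b : ℝ)⁻¹ * ∑' n, (j n : ℝ) * (b : ℝ)⁻¹ ^ n = p + c * Real.ofDigits (d j) := by
    have hsi := (summable_fin_mul_pow i (inv_pos.mpr hbR).le hb2).mul_left ((N + 1) * (b : ℝ)⁻¹)
    have hsj := (summable_fin_mul_pow j (inv_pos.mpr hbR).le hb2).mul_left ((b : ℝ)⁻¹)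
    rw [mul_assoc c, add_assoc, ← mul_add, ← tsum_mul_left, ← tsum_mul_left, ← hsi.tsum_add hsj,
      Real.ofDigits]
    congr 3
    ext n
    simp only [Real.ofDigitsTerm, d, pow_succ, mul_inv, inv_pow]
    push_cast
    ring
  simp only [hdig, mem_inter_iff, mem_Ioo, mem_preimage, mem_singleton_iff]
  have h0 := Real.ofDigits_nonneg (d j)
  have h1 := Real.ofDigits_le_one (d j)
  refine ⟨⟨?_, ?_⟩, ?_⟩
  · have := mul_nonneg hc.le h0
    simp only [p]
    linarith
  · have := mul_le_of_le_one_right hc.le h1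
    simp only [p, c] at this ⊢
    linarith
  · rw [add_sub_cancel_left, mul_div_cancel_left₀ _ hc.ne']
    refine tsum_congr fun n => ?_
    obtain ⟨t, ht1, ht2, ht⟩ := comp_pow_mul_ofDigits hb0 hper (d j) n
    rw [ht, mul_comm]
    congr 1
    simp only [d] at ht1 ht2
    push_cast at ht1 ht2
    have hj : ((j n : ℕ) : ℝ) + 1 ≤ N := by exact_mod_cast (j n).isLt
    exact hstep _ (i n).isLt t
      ((div_le_div_of_nonneg_right (le_add_of_nonneg_right (Nat.cast_nonneg _)) hbR.le).trans ht1)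
      (ht2.trans (div_le_div_of_nonneg_right (by linarith) hbR.le))

theorem exists_block_sizes {k : ℕ} {α s : ℝ} (hα : 0 < α) (hs : 0 < s) (hs1 : s ≤ 1)
    (hks : k * s < 1 - α) : ∃ M N b : ℕ, 2 ≤ M ∧ 2 ≤ N ∧ 2 * M * (N + 1) ≤ b ∧
      (b : ℝ) ^ α ≤ N ∧ (2 * (b : ℝ) ^ k) ^ s ≤ M := by
  have hlim := (tendsto_rpow_atTop (y := 1 - α - k * s) (by linarith)).comp
    (tendsto_natCast_atTop_atTop (R := ℝ))
  obtain ⟨b, hb, hb2⟩ := ((hlim.eventually_ge_atTop 24).and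
    (Filter.eventually_ge_atTop 2)).exists
  simp only [Function.comp_apply] at hb
  have hb2' : (2 : ℝ) ≤ b := by exact_mod_cast hb2
  have hbR : (0 : ℝ) < b := by linarith
  have hA : 1 < (b : ℝ) ^ α := Real.one_lt_rpow (by linarith) hα
  have hks0 : 1 ≤ (b : ℝ) ^ (k * s) := Real.one_le_rpow (by linarith) (by positivity)
  have hD : 24 * (b : ℝ) ^ (k * s) ≤ (b : ℝ) ^ (1 - α) := by
    have : (b : ℝ) ^ (1 - α) = (b : ℝ) ^ (1 - α - k * s) * (b : ℝ) ^ (k * s) := by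
      rw [← Real.rpow_add hbR]
      ring_nf
    rw [this]
    exact mul_le_mul_of_nonneg_right hb (by positivity)
  have hAD : (b : ℝ) ^ α * (b : ℝ) ^ (1 - α) = b := by
    rw [← Real.rpow_add hbR, add_sub_cancel, Real.rpow_one]
  set N := ⌈(b : ℝ) ^ α⌉₊ with hN
  have hN1 : (b : ℝ) ^ α ≤ N := Nat.le_ceil _
  have hN2 : (N : ℝ) < (b : ℝ) ^ α + 1 := Nat.ceil_lt_add_one (by positivity)
  have hfloor : (b : ℝ) ^ (1 - α) / 12 ≤ (b / (2 * (N + 1)) : ℕ) := by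
    have h1 : (b : ℝ) ^ (1 - α) / 6 ≤ b / (2 * (N + 1) : ℕ) := by
      push_cast
      rw [le_div_iff₀ (by positivity)]
      nlinarith
    have h2 := Nat.lt_floor_add_one ((b : ℝ) / (2 * (N + 1) : ℕ))
    rw [Nat.floor_div_eq_div] at h2
    linarith
  refine ⟨b / (2 * (N + 1)), N, b, ?_, ?_, ?_, hN1, ?_⟩
  · have : (2 : ℝ) ≤ (b / (2 * (N + 1)) : ℕ) := by linarith
    exact_mod_cast this
  · have : (1 : ℝ) < N := by linarith
    exact_mod_cast this
  · calc 2 * (b / (2 * (N + 1))) * (N + 1) = b / (2 * (N + 1)) * (2 * (N + 1)) := by ring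
      _ ≤ b := Nat.div_mul_le_self _ _
  · rw [Real.mul_rpow (by norm_num) (by positivity), ← Real.rpow_natCast, ← Real.rpow_mul hbR.le]
    have h2 : (2 : ℝ) ^ s ≤ 2 := by
      simpa using Real.rpow_le_rpow_of_exponent_le (one_le_two (α := ℝ)) hs1
    nlinarith

theorem exists_contDiff_lt_dimH_level_sets {k : ℕ} (hk : 1 ≤ k) {α : ℝ} (hα0 : 0 < α)
    (hα1 : α < 1) {l u : ℝ} (hlu : l < u) {η : ℝ} (hη : 0 < η) :
    ∃ f : ℝ → ℝ, ContDiff ℝ k f ∧ ENNReal.ofReal ((1 - α) / k - η) <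
      dimH {y : ℝ | ENNReal.ofReal α ≤ dimH (Ioo l u ∩ f ⁻¹' {y})} := by
  have hk' : (1 : ℝ) ≤ k := by exact_mod_cast hk
  have hpos : 0 < (1 - α) / k := div_pos (by linarith) (by linarith)
  obtain ⟨s, hs, hs2⟩ := exists_between
    (max_lt hpos (sub_lt_self _ hη) : max 0 ((1 - α) / k - η) < (1 - α) / k)
  obtain ⟨hs0, hs1⟩ := max_lt_iff.mp hs
  rw [lt_div_iff₀ (by linarith)] at hs2
  obtain ⟨M, N, b, hM, hN, hb, hNα, hMs⟩ :=
    exists_block_sizes (k := k) hα0 hs0 (by nlinarith) (by linarith)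
  obtain ⟨f, hf, hdim⟩ := exists_contDiff_le_dimH_level_sets hα0 hs0 hM hN hb hk hNα hMs hlu
  exact ⟨f, hf, ((ENNReal.ofReal_lt_ofReal_iff hs0).mpr hs1).trans_le hdim⟩

/-- **Lower bound.** For `k ≥ 1`, `0 < α < 1`, and a nonempty open interval
`E = Ioo a b`: for every `η > 0` there is a `C^k` function `f : E → ℝ` with
`L(α, f) > (1-α)/k - η`; consequently the supremum of `L(α, f)` over all
`C^k` functions is at least `(1-α)/k`. -/
theorem sup_dimH_large_level_sets_ge (k : ℕ) (hk : 1 ≤ k) (α : ℝ) (hα0 : 0 < α)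
    (hα1 : α < 1) (a b : ℝ) (hab : a < b) :
    (∀ η : ℝ, 0 < η → ∃ f : ℝ → ℝ, ContDiffOn ℝ k f (Set.Ioo a b) ∧
        ENNReal.ofReal ((1 - α) / k - η) <
          dimH {y : ℝ | ENNReal.ofReal α ≤ dimH (Set.Ioo a b ∩ f ⁻¹' {y})}) ∧
      ENNReal.ofReal ((1 - α) / k) ≤
        ⨆ (f : ℝ → ℝ) (_ : ContDiffOn ℝ k f (Set.Ioo a b)),
          dimH {y : ℝ | ENNReal.ofReal α ≤ dimH (Set.Ioo a b ∩ f ⁻¹' {y})} := by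
  have hmain : ∀ η : ℝ, 0 < η → ∃ f : ℝ → ℝ, ContDiffOn ℝ k f (Set.Ioo a b) ∧
      ENNReal.ofReal ((1 - α) / k - η) <
        dimH {y : ℝ | ENNReal.ofReal α ≤ dimH (Set.Ioo a b ∩ f ⁻¹' {y})} := fun η hη => by
    obtain ⟨f, hf, hdim⟩ := exists_contDiff_lt_dimH_level_sets hk hα0 hα1 hab hη
    exact ⟨f, hf.contDiffOn, hdim⟩
  refine ⟨hmain, ENNReal.le_of_forall_pos_le_add fun ε hε _ => ?_⟩
  obtain ⟨f, hf, hdim⟩ := hmain ε hε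
  calc ENNReal.ofReal ((1 - α) / k) = ENNReal.ofReal ((1 - α) / k - ε + ε) := by
        rw [sub_add_cancel]
    _ ≤ ENNReal.ofReal ((1 - α) / k - ε) + ε := by
        simpa using ENNReal.ofReal_add_le (p := (1 - α) / k - ε) (q := (ε : ℝ))
    _ ≤ _ := by
        gcongr
        exact hdim.le.trans (le_iSup₂_of_le f hf le_rfl)
end

section
/- Let k ≥ 1 be a natural number, let r ≥ 2 and s ≥ 2 be natural numbers, and let 0 < ε < 1/(rs−1). Then there exists a function f ∈ C^k((-2,2),ℝ) such that, writing α₀ := (log_s r)/(1 + log_s(r/(1−ε))), one has L(α₀, f) ≥ 1/((k+ε)·(1 + log_s(r/(1−ε)))); i.e. the set of y ∈ ℝ whose level set f⁻¹(y) has Hausdorff dimension at least α₀ itself has Hausdorff dimension at least 1/((k+ε)·(1 + log_s(r/(1−ε)))). -/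
open MeasureTheory Set

/-- The real number `∑ᵢ Dᵢ ρ ^ (i + 1)` with digits `D` in base `ρ⁻¹`. -/
noncomputable def expansion (ρ : ℝ) (D : ℕ → ℕ) : ℝ := ∑' i, (D i : ℝ) * ρ ^ (i + 1)

section expansion

variable {ρ : ℝ} {M : ℕ} {D D' : ℕ → ℕ}

lemma summable_expansion (h0 : 0 < ρ) (h1 : ρ < 1) (hD : ∀ i, D i ≤ M) :
    Summable fun i ↦ (D i : ℝ) * ρ ^ (i + 1) := by
  refine Summable.of_nonneg_of_le (fun i ↦ by positivity)
    (fun i ↦ mul_le_mul_of_nonneg_right (Nat.cast_le.2 (hD i)) (by positivity)) ?_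
  simp_rw [pow_succ']
  exact ((summable_geometric_of_lt_one h0.le h1).mul_left _).mul_left _

lemma expansion_nonneg (h0 : 0 < ρ) : 0 ≤ expansion ρ D :=
  tsum_nonneg fun _ ↦ by positivity

lemma expansion_le (h0 : 0 < ρ) (h1 : ρ < 1) (hD : ∀ i, D i ≤ M) :
    expansion ρ D ≤ ρ * M / (1 - ρ) := by
  have hs : HasSum (fun i : ℕ ↦ (M : ℝ) * ρ ^ (i + 1)) (ρ * M / (1 - ρ)) := by
    have := (hasSum_geometric_of_lt_one h0.le h1).mul_left (M * ρ)
    convert! this using 1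
    · ext i; ring
    · ring
  exact hasSum_le (fun i ↦ mul_le_mul_of_nonneg_right (Nat.cast_le.2 (hD i)) (by positivity))
    (summable_expansion h0 h1 hD).hasSum hs

lemma expansion_eq_sum_add (h0 : 0 < ρ) (h1 : ρ < 1) (hD : ∀ i, D i ≤ M) (n : ℕ) :
    expansion ρ D = ∑ i ∈ Finset.range n, (D i : ℝ) * ρ ^ (i + 1) +
      ρ ^ n * expansion ρ fun i ↦ D (i + n) := by
  rw [expansion, expansion, ← (summable_expansion h0 h1 hD).sum_add_tsum_nat_add n, ← tsum_mul_left]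
  congr 2
  ext i
  ring

lemma expansion_eq_mul (h0 : 0 < ρ) (h1 : ρ < 1) (hD : ∀ i, D i ≤ M) :
    expansion ρ D = ρ * (D 0 + expansion ρ fun i ↦ D (i + 1)) := by
  rw [expansion_eq_sum_add h0 h1 hD 1]
  simp
  ring

lemma le_abs_expansion_sub (h0 : 0 < ρ) (h1 : ρ < 1) (hD : ∀ i, D i ≤ M) (hD' : ∀ i, D' i ≤ M)
    {n : ℕ} (hlt : ∀ i < n, D i = D' i) (hn : D n ≠ D' n) :
    ρ * (1 - ρ * M / (1 - ρ)) * ρ ^ n ≤ |expansion ρ D - expansion ρ D'| := by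
  have hsum : ∑ i ∈ Finset.range n, (D i : ℝ) * ρ ^ (i + 1) =
      ∑ i ∈ Finset.range n, (D' i : ℝ) * ρ ^ (i + 1) :=
    Finset.sum_congr rfl fun i hi ↦ by rw [hlt i (Finset.mem_range.1 hi)]
  rw [expansion_eq_sum_add h0 h1 hD n, expansion_eq_sum_add h0 h1 hD' n, hsum, add_sub_add_left_eq_sub,
    ← mul_sub, abs_mul, abs_of_pos (by positivity : 0 < ρ ^ n),
    expansion_eq_mul (D := fun i ↦ D (i + n)) h0 h1 (fun i ↦ hD _),
    expansion_eq_mul (D := fun i ↦ D' (i + n)) h0 h1 (fun i ↦ hD' _), ← mul_sub, abs_mul,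
    abs_of_pos h0, mul_comm (ρ ^ n)]
  refine mul_le_mul_of_nonneg_right (mul_le_mul_of_nonneg_left ?_ h0.le) (by positivity)
  have hu0 := expansion_nonneg (D := fun i ↦ D (i + 1 + n)) h0
  have hu1 := expansion_le (D := fun i ↦ D (i + 1 + n)) h0 h1 (fun i ↦ hD _)
  have hv0 := expansion_nonneg (D := fun i ↦ D' (i + 1 + n)) h0
  have hv1 := expansion_le (D := fun i ↦ D' (i + 1 + n)) h0 h1 (fun i ↦ hD' _)
  simp only [zero_add]
  rcases hn.lt_or_gt with h | h
  · have : (D n : ℝ) + 1 ≤ D' n := by exact_mod_cast h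
    rw [abs_sub_comm]
    exact le_trans (by linarith) (le_abs_self _)
  · have : (D' n : ℝ) + 1 ≤ D n := by exact_mod_cast h
    exact le_trans (by linarith) (le_abs_self _)

end expansion

/-- A coding map that separates points whose codes first differ at index `n` by at least `c * ρ ^ n`
has a range of Hausdorff dimension at least the similarity dimension. -/
lemma le_dimH_range_of_separated {q : ℕ} (hq : 1 < q) {ρ c : ℝ} (h0 : 0 < ρ) (h1 : ρ < 1)
    (hc : 0 < c) (π : (ℕ → Fin q) → ℝ)
    (hπ : ∀ a b n, (∀ i < n, a i = b i) → a n ≠ b n → c * ρ ^ n ≤ |π a - π b|) :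
    ENNReal.ofReal (Real.log q / Real.log ρ⁻¹) ≤ dimH (range π) := by
  have hq' : (1 : ℝ) < q := by exact_mod_cast hq
  have hlogρ : 0 < Real.log ρ⁻¹ := Real.log_pos ((one_lt_inv₀ h0).2 h1)
  set α := Real.log q / Real.log ρ⁻¹ with hα
  have hα0 : 0 < α := div_pos (Real.log_pos hq') hlogρ
  have hρα : ρ ^ α = (q : ℝ)⁻¹ := by
    rw [Real.rpow_def_of_pos h0, hα, Real.log_inv, div_neg, mul_neg, mul_div_cancel₀, Real.exp_neg,
      Real.exp_log (by linarith)]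
    rw [Real.log_inv] at hlogρ
    linarith
  have hdist (a b : ℕ → Fin q) :
      |Real.ofDigits a - Real.ofDigits b| ≤ (c⁻¹) ^ α * |π a - π b| ^ α := by
    by_cases hab : a = b
    · subst hab; simp [Real.zero_rpow hα0.ne']
    have hle := hπ a b (PiNat.firstDiff a b) (fun i ↦ PiNat.apply_eq_of_lt_firstDiff)
      (PiNat.apply_firstDiff_ne hab)
    refine (Real.abs_ofDigits_sub_ofDigits_le (n := PiNat.firstDiff a b)
      fun i ↦ PiNat.apply_eq_of_lt_firstDiff).trans ?_
    rw [← Real.mul_rpow (by positivity) (abs_nonneg _), ← inv_pow, ← hρα, ← Real.rpow_natCast,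
      ← Real.rpow_mul h0.le, mul_comm α, Real.rpow_mul h0.le, Real.rpow_natCast]
    refine Real.rpow_le_rpow (by positivity) ?_ hα0.le
    rw [inv_mul_eq_div, le_div_iff₀ hc]
    linarith
  have : NeZero q := ⟨by omega⟩
  set Φ : ℝ → ℝ := fun x ↦ Real.ofDigits (Function.invFun π x) with hΦ
  have hπinv {x : ℝ} (hx : x ∈ range π) : π (Function.invFun π x) = x := Function.invFun_eq hx
  have hinj : Function.Injective π := by
    intro a b hab
    by_contra hne
    have hle := hπ a b (PiNat.firstDiff a b) (fun i ↦ PiNat.apply_eq_of_lt_firstDiff)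
      (PiNat.apply_firstDiff_ne hne)
    rw [hab, sub_self, abs_zero] at hle
    exact absurd hle (not_le.2 (by positivity))
  have hholder : HolderOnWith (Real.toNNReal (c⁻¹ ^ α)) (Real.toNNReal α) Φ (range π) := by
    intro x hx y hy
    have := hdist (Function.invFun π x) (Function.invFun π y)
    rw [hπinv hx, hπinv hy] at this
    rw [edist_dist, edist_dist, Real.coe_toNNReal _ hα0.le, ENNReal.ofReal_rpow_of_nonneg dist_nonneg
      hα0.le, ← ENNReal.ofReal, ← ENNReal.ofReal_mul (by positivity)]
    exact ENNReal.ofReal_le_ofReal this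
  have himage := hholder.dimH_image_le (Real.toNNReal_pos.2 hα0)
  have hIco : Ico (0 : ℝ) 1 ⊆ Φ '' range π := by
    intro x hx
    refine ⟨π (Real.digits x q), mem_range_self _, ?_⟩
    simp only [hΦ, Function.leftInverse_invFun hinj _, Real.ofDigits_digits hq hx]
  have hone : (1 : ENNReal) ≤ dimH (Φ '' range π) := by
    refine le_trans (le_of_eq ?_) (dimH_mono hIco)
    rw [Real.dimH_of_nonempty_interior]
    · simp
    · simp
  have := hone.trans himage
  rw [ENNReal.le_div_iff_mul_le, one_mul] at this
  · exact this
  · left; simpa using hα0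
  · left; simp

/-- The sum of `N` weighted copies of `g`, each contracted by `ρ` towards one of the `N` branches. -/
noncomputable def branchSum (ρ : ℝ) (N : ℕ) (w : ℕ → ℝ) (g : ℝ → ℝ) (x : ℝ) : ℝ :=
  ∑ d ∈ Finset.range N, w d * g (ρ⁻¹ * x - d)

section branchSum

variable {ρ : ℝ} {N : ℕ} {w : ℕ → ℝ} {g : ℝ → ℝ} {c R : ℝ}

lemma contDiff_branchSum {n : WithTop ℕ∞} (hg : ContDiff ℝ n g) :
    ContDiff ℝ n (branchSum ρ N w g) := by
  unfold branchSum
  fun_prop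

lemma iteratedDeriv_branchSum (j : ℕ) (hg : ContDiff ℝ j g) (x : ℝ) :
    iteratedDeriv j (branchSum ρ N w g) x =
      ∑ d ∈ Finset.range N, w d * (ρ⁻¹ ^ j * iteratedDeriv j g (ρ⁻¹ * x - d)) := by
  unfold branchSum
  rw [iteratedDeriv_fun_sum fun i _ ↦ by fun_prop]
  refine Finset.sum_congr rfl fun d _ ↦ ?_
  rw [iteratedDeriv_const_mul_field,
    iteratedDeriv_comp_const_mul (f := fun z ↦ g (z - d)) (by fun_prop), iteratedDeriv_comp_sub_const]

lemma iteratedDeriv_eq_zero_of_dist (j : ℕ) (hsupp : ∀ x, R < |x - c| → g x = 0) {x : ℝ}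
    (hx : R < |x - c|) : iteratedDeriv j g x = 0 := by
  have hev : g =ᶠ[nhds x] fun _ ↦ 0 := by
    filter_upwards [(isOpen_lt continuous_const
      (by fun_prop : Continuous fun y : ℝ ↦ |y - c|)).mem_nhds hx] with y hy
    exact hsupp y hy
  rw [hev.iteratedDeriv_eq]
  simp

lemma abs_iteratedDeriv_branchSum_le {j : ℕ} {B W : ℝ} (h0 : 0 < ρ) (hR : R < 1 / 2)
    (hg : ContDiff ℝ j g) (hsupp : ∀ x, R < |x - c| → g x = 0)
    (hB : ∀ x, |iteratedDeriv j g x| ≤ B) (hw : ∀ d, |w d| ≤ W) (x : ℝ) :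
    |iteratedDeriv j (branchSum ρ N w g) x| ≤ W * (ρ⁻¹ ^ j * B) := by
  have hW : 0 ≤ W := (abs_nonneg _).trans (hw 0)
  have hB0 : 0 ≤ B := (abs_nonneg _).trans (hB 0)
  rw [iteratedDeriv_branchSum j hg]
  by_cases h : ∃ d ∈ Finset.range N, |ρ⁻¹ * x - d - c| ≤ R
  · obtain ⟨d, hd, hdR⟩ := h
    rw [Finset.sum_eq_single_of_mem d hd]
    · rw [abs_mul, abs_mul, abs_of_pos (by positivity : 0 < ρ⁻¹ ^ j)]
      have := hw d
      have := hB (ρ⁻¹ * x - d)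
      gcongr
    · intro e _ hed
      rw [iteratedDeriv_eq_zero_of_dist j hsupp, mul_zero, mul_zero]
      rw [abs_le] at hdR
      rw [lt_abs]
      rcases hed.lt_or_gt with h | h
      · have : (e : ℝ) + 1 ≤ d := by exact_mod_cast h
        left; linarith
      · have : (d : ℝ) + 1 ≤ e := by exact_mod_cast h
        right; linarith
  · push Not at h
    rw [Finset.sum_eq_zero, abs_zero]
    · positivity
    · intro d hd
      rw [iteratedDeriv_eq_zero_of_dist j hsupp (h d hd), mul_zero, mul_zero]

variable {M : ℕ} {L : ℝ}

lemma branchSum_eq_zero (h0 : 0 < ρ) (h1 : ρ < 1) (hL : ρ * (M + L) = L) (hLR : L / 2 ≤ R)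
    (hsupp : ∀ x, R < |x - L / 2| → g x = 0) {x : ℝ} (hx : R < |x - L / 2|) :
    branchSum ρ (M + 1) w g x = 0 := by
  refine Finset.sum_eq_zero fun d hd ↦ ?_
  rw [hsupp, mul_zero]
  by_contra! h
  have hdM : (d : ℝ) ≤ M := by exact_mod_cast Nat.lt_succ_iff.1 (Finset.mem_range.1 hd)
  have hd0 : (0 : ℝ) ≤ d := d.cast_nonneg
  have hxe : x = ρ * (ρ⁻¹ * x) := by field_simp
  set u := ρ⁻¹ * x
  refine hx.not_ge ?_
  rw [abs_le] at h ⊢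
  have hRL : ρ * (M / 2 + R) ≤ R := by nlinarith
  rw [hxe]
  constructor
  · nlinarith
  · nlinarith

lemma branchSum_apply (h0 : 0 < ρ) (hL1 : L < 1) (hR : R < 1 / 2)
    (hsupp : ∀ x, R < |x - L / 2| → g x = 0) {d : ℕ} (hd : d < N) {u : ℝ} (hu0 : 0 ≤ u)
    (huL : u ≤ L) : branchSum ρ N w g (ρ * (d + u)) = w d * g u := by
  unfold branchSum
  rw [inv_mul_cancel_left₀ h0.ne', Finset.sum_eq_single_of_mem d (Finset.mem_range.2 hd)]
  · rw [add_sub_cancel_left]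
  · intro e _ hed
    rw [hsupp, mul_zero]
    rw [lt_abs]
    rcases hed.lt_or_gt with h | h
    · have : (e : ℝ) + 1 ≤ d := by exact_mod_cast h
      left; linarith
    · have : (d : ℝ) + 1 ≤ e := by exact_mod_cast h
      right; linarith

end branchSum

/-- Smooth functions that read off the digits of expansions and whose derivatives grow
geometrically with the position of the digit. -/
lemma exists_smooth_digit_functions {ρ : ℝ} {M : ℕ} (h0 : 0 < ρ) (hM : 0 < M)
    (hρM : ρ * (M + 1) < 1) {w : ℕ → ℝ} {W : ℝ} (hw : ∀ d, |w d| ≤ W) :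
    ∃ (g : ℕ → ℝ → ℝ) (C : ℕ → ℝ), (∀ n, ContDiff ℝ (⊤ : ℕ∞) (g n)) ∧
      (∀ n j x, |iteratedDeriv j (g n) x| ≤ C j * (ρ⁻¹ ^ j) ^ n) ∧
      ∀ n (D : ℕ → ℕ), (∀ i, D i ≤ M) → g n (expansion ρ D) = w (D n) := by
  have hM' : (1 : ℝ) ≤ M := by exact_mod_cast hM
  have h1 : ρ < 1 := by nlinarith
  set L := ρ * M / (1 - ρ) with hLdef
  have hLeq : ρ * (M + L) = L := by
    have : 1 - ρ ≠ 0 := by linarith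
    rw [hLdef]; field_simp; ring
  have hL0 : 0 < L := div_pos (by positivity) (by linarith)
  have hL1 : L < 1 := by rw [hLdef, div_lt_one (by linarith)]; linarith
  set R := (L + 1) / 4 with hRdef
  have hR : R < 1 / 2 := by linarith
  have hLR : L / 2 < R := by linarith
  let θ : ContDiffBump (L / 2) := ⟨L / 2, R, by linarith, hLR⟩
  have hθs : ∀ x, R < |x - L / 2| → θ x = 0 := fun x hx ↦ θ.zero_of_le_dist (by
    rw [Real.dist_eq]; exact hx.le)
  have hθ1 : ∀ x, 0 ≤ x → x ≤ L → θ x = 1 := fun x hx hx' ↦ θ.one_of_mem_closedBall (by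
    rw [Metric.mem_closedBall, Real.dist_eq, abs_le]
    change -(L / 2) ≤ _ ∧ _ ≤ L / 2
    constructor <;> linarith)
  have hθb : ∀ j, ∃ B, ∀ x, |iteratedDeriv j θ x| ≤ B := fun j ↦ by
    obtain ⟨B, hB⟩ := (θ.hasCompactSupport.iteratedFDeriv (𝕜 := ℝ) j).exists_bound_of_continuous
      ((θ.contDiff (n := (⊤ : ℕ∞))).continuous_iteratedFDeriv (by exact_mod_cast le_top))
    exact ⟨B, fun x ↦ by
      rw [← Real.norm_eq_abs, ← norm_iteratedFDeriv_eq_norm_iteratedDeriv]; exact hB x⟩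
  choose B hB using hθb
  set T := branchSum ρ (M + 1) fun _ ↦ 1
  set g : ℕ → ℝ → ℝ := fun n ↦ T^[n] (branchSum ρ (M + 1) w θ) with hg
  have hsucc (n : ℕ) : g (n + 1) = T (g n) := by simp only [hg, Function.iterate_succ_apply']
  have hsmooth (n : ℕ) : ContDiff ℝ (⊤ : ℕ∞) (g n) := by
    induction n with
    | zero => exact contDiff_branchSum θ.contDiff
    | succ n ih => rw [hsucc]; exact contDiff_branchSum ih
  have hsupp (n : ℕ) : ∀ x, R < |x - L / 2| → g n x = 0 := by
    induction n with
    | zero => exact fun x ↦ branchSum_eq_zero h0 h1 hLeq hLR.le hθs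
    | succ n ih => rw [hsucc]; exact fun x ↦ branchSum_eq_zero h0 h1 hLeq hLR.le ih
  refine ⟨g, fun j ↦ W * (ρ⁻¹ ^ j * B j), hsmooth, fun n j ↦ ?_, fun n ↦ ?_⟩
  · induction n with
    | zero =>
      intro x
      simpa [hg] using abs_iteratedDeriv_branchSum_le h0 hR θ.contDiff hθs (hB j) hw x
    | succ n ih =>
      intro x
      rw [hsucc]
      refine (abs_iteratedDeriv_branchSum_le (W := 1) h0 hR
        ((hsmooth n).of_le (by exact_mod_cast le_top)) (hsupp n) ih (by simp) x).trans (le_of_eq ?_)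
      ring
  · induction n with
    | zero =>
      intro D hD
      rw [expansion_eq_mul h0 h1 hD]
      have hu0 := expansion_nonneg (D := fun i ↦ D (i + 1)) h0
      have hu1 := expansion_le (D := fun i ↦ D (i + 1)) h0 h1 (fun i ↦ hD _)
      exact (branchSum_apply h0 hL1 hR hθs (Nat.lt_succ_iff.2 (hD 0)) hu0 hu1).trans (by
        rw [hθ1 _ hu0 hu1, mul_one])
    | succ n ih =>
      intro D hD
      rw [expansion_eq_mul h0 h1 hD, hsucc]
      exact (branchSum_apply h0 hL1 hR (hsupp n) (Nat.lt_succ_iff.2 (hD 0))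
        (expansion_nonneg h0) (expansion_le h0 h1 (fun i ↦ hD _))).trans (by
        rw [ih _ fun i ↦ hD _, one_mul])

/-- A `C^k` function that maps base `ρ⁻¹` expansions with digits `D` to base `μ⁻¹` expansions with
digits `D mod s`. -/
lemma exists_contDiff_expansion_mod {ρ μ : ℝ} {M s k : ℕ} (h0 : 0 < ρ) (hM : 0 < M)
    (hρM : ρ * (M + 1) < 1) (hμ0 : 0 < μ) (hs : 0 < s) (hμ : μ < ρ ^ k) :
    ∃ f : ℝ → ℝ, ContDiff ℝ k f ∧ ∀ D : ℕ → ℕ, (∀ i, D i ≤ M) →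
      f (expansion ρ D) = expansion μ fun i ↦ D i % s := by
  obtain ⟨g, C, hg, hC, hgD⟩ := exists_smooth_digit_functions (w := fun d ↦ ((d % s : ℕ) : ℝ))
    (W := s) h0 hM hρM fun d ↦ by
      rw [Nat.abs_cast]; exact_mod_cast (Nat.mod_lt d hs).le
  have hM' : (1 : ℝ) ≤ M := by exact_mod_cast hM
  have h1 : ρ < 1 := by nlinarith
  refine ⟨fun x ↦ ∑' n, μ ^ (n + 1) * g n x, ?_, fun D hD ↦ ?_⟩
  · refine contDiff_tsum (N := (k : ℕ∞)) (v := fun j n ↦ μ ^ (n + 1) * (C j * (ρ⁻¹ ^ j) ^ n))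
      (fun n ↦ contDiff_const.mul ((hg n).of_le (by exact_mod_cast le_top))) ?_ ?_
    · intro j hj
      have hjk : j ≤ k := by exact_mod_cast hj
      have hlt : μ * ρ⁻¹ ^ j < 1 := by
        rw [inv_pow, ← div_eq_mul_inv, div_lt_one (by positivity)]
        exact hμ.trans_le (pow_le_pow_of_le_one h0.le h1.le hjk)
      refine ((summable_geometric_of_lt_one (by positivity) hlt).mul_left (μ * C j)).congr ?_
      intro n
      rw [mul_pow]
      ring
    · intro j n x _
      rw [norm_iteratedFDeriv_eq_norm_iteratedDeriv, iteratedDeriv_const_mul_field, norm_mul,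
        Real.norm_eq_abs, Real.norm_eq_abs, abs_of_pos (by positivity)]
      exact mul_le_mul_of_nonneg_left (hC n j x) (by positivity)
  · simp only [hgD _ D hD]
    exact tsum_congr fun n ↦ mul_comm _ _

/-- **The construction.** For `k ≥ 1`, naturals `r, s ≥ 2` and `0 < ε < 1/(rs - 1)`,
there is a `C^k` function `f` on `E = (-2, 2)` such that, with
`α₀ = log_s r / (1 + log_s (r/(1-ε)))`, the set of `y` whose level set has Hausdorff
dimension at least `α₀` itself has Hausdorff dimension at least
`1 / ((k + ε) * (1 + log_s (r/(1-ε))))`. -/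
theorem exists_contDiffOn_dimH_level_sets_ge (k : ℕ) (hk : 1 ≤ k) (r s : ℕ)
    (hr : 2 ≤ r) (hs : 2 ≤ s) (ε : ℝ) (hε0 : 0 < ε)
    (hε1 : ε < 1 / ((r : ℝ) * s - 1)) :
    ∃ f : ℝ → ℝ, ContDiffOn ℝ k f (Set.Ioo (-2 : ℝ) 2) ∧
      ENNReal.ofReal
          (1 / ((k + ε) * (1 + Real.log ((r : ℝ) / (1 - ε)) / Real.log s))) ≤
        dimH {y : ℝ |
          ENNReal.ofReal
              ((Real.log r / Real.log s) /
                (1 + Real.log ((r : ℝ) / (1 - ε)) / Real.log s)) ≤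
            dimH (Set.Ioo (-2 : ℝ) 2 ∩ f ⁻¹' {y})} := by
  have hr' : (2 : ℝ) ≤ r := by exact_mod_cast hr
  have hs' : (2 : ℝ) ≤ s := by exact_mod_cast hs
  have hε : ε < 1 := hε1.trans_le (by rw [div_le_one] <;> nlinarith)
  obtain ⟨M, hM⟩ : ∃ M, r * s = M + 1 := ⟨r * s - 1, by have := Nat.mul_le_mul hr hs; omega⟩
  have hM' : (r : ℝ) * s = M + 1 := by exact_mod_cast hM
  have hMpos : 0 < M := by have := Nat.mul_le_mul hr hs; omega
  set ρ : ℝ := (1 - ε) / (r * s) with hρ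
  have h0 : 0 < ρ := div_pos (by linarith) (by positivity)
  have hρM : ρ * (M + 1) < 1 := by
    rw [← hM', hρ, div_mul_cancel₀ _ (by positivity)]; linarith
  have h1 : ρ < 1 := by nlinarith [(Nat.one_le_cast (α := ℝ)).2 hMpos]
  have hlogs : 0 < Real.log s := Real.log_pos (by linarith)
  have hlogρ : 0 < Real.log ρ⁻¹ := Real.log_pos ((one_lt_inv₀ h0).2 h1)
  have hdim : 1 + Real.log ((r : ℝ) / (1 - ε)) / Real.log s = Real.log ρ⁻¹ / Real.log s := by
    have : ρ⁻¹ = s * (r / (1 - ε)) := by rw [hρ, inv_div]; ring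
    rw [this, Real.log_mul (by positivity) (div_pos (by positivity) (by linarith)).ne', add_div,
      div_self hlogs.ne']
  set μ : ℝ := ρ ^ ((k : ℝ) + ε) with hμ
  have hμ0 : 0 < μ := by positivity
  have hμk : μ < ρ ^ k := by
    rw [hμ, ← Real.rpow_natCast]
    exact Real.rpow_lt_rpow_of_exponent_gt h0 h1 (by linarith)
  have hμρ : μ < ρ := hμk.trans_le (by simpa using pow_le_pow_of_le_one h0.le h1.le hk)
  have hlogμ : Real.log μ⁻¹ = (k + ε) * Real.log ρ⁻¹ := by
    rw [Real.log_inv, hμ, Real.log_rpow h0, Real.log_inv]; ring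
  have hgap {σ : ℝ} {m : ℕ} (hσ0 : 0 < σ) (hσ1 : σ < 1) (hσ : σ * (m + 1) < 1) :
      0 < σ * (1 - σ * m / (1 - σ)) := by
    refine mul_pos hσ0 (sub_pos.2 ?_)
    rw [div_lt_one (by linarith)]
    linarith
  obtain ⟨f, hf, hfD⟩ := exists_contDiff_expansion_mod (s := s) h0 hMpos hρM hμ0 (by omega) hμk
  refine ⟨f, hf.contDiffOn, ?_⟩
  rw [hdim, div_div_div_cancel_right₀ hlogs.ne', mul_div_assoc', one_div_div, ← hlogμ]
  have hrange : ENNReal.ofReal (Real.log s / Real.log μ⁻¹) ≤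
      dimH (range fun b : ℕ → Fin s ↦ expansion μ fun i ↦ b i) := by
    have hsub : ((s - 1 : ℕ) : ℝ) + 1 = s := by exact_mod_cast Nat.sub_add_cancel (by omega : 1 ≤ s)
    refine le_dimH_range_of_separated (by omega) hμ0 (hμρ.trans h1)
      (hgap (m := s - 1) hμ0 (hμρ.trans h1) ?_) _ fun a b n hlt hn ↦ ?_
    · rw [hsub]
      rw [← hM'] at hρM
      have : (s : ℝ) ≤ r * s := by nlinarith
      nlinarith
    · exact le_abs_expansion_sub hμ0 (hμρ.trans h1) (fun i ↦ by omega) (fun i ↦ by omega)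
        (fun i hi ↦ by rw [hlt i hi]) (by simpa [Fin.ext_iff] using hn)
  refine hrange.trans (dimH_mono ?_)
  rintro _ ⟨b, rfl⟩
  have hdigit (a : ℕ → Fin r) (i : ℕ) : (a i : ℕ) * s + b i ≤ M := by
    have : (a i + 1 : ℕ) * s ≤ r * s := Nat.mul_le_mul_right _ (a i).2
    have := (b i).2
    rw [add_mul] at *
    omega
  have hlevel : ENNReal.ofReal (Real.log r / Real.log ρ⁻¹) ≤
      dimH (range fun a : ℕ → Fin r ↦ expansion ρ fun i ↦ (a i : ℕ) * s + b i) := by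
    refine le_dimH_range_of_separated (by omega) h0 h1 (hgap h0 h1 hρM) _ fun a a' n hlt hn ↦ ?_
    refine le_abs_expansion_sub h0 h1 (hdigit a) (hdigit a') (fun i hi ↦ by rw [hlt i hi]) ?_
    simpa [Fin.ext_iff, show s ≠ 0 by omega] using hn
  refine hlevel.trans (dimH_mono ?_)
  rintro _ ⟨a, rfl⟩
  have hx0 := expansion_nonneg (D := fun i ↦ (a i : ℕ) * s + b i) h0
  have hx1 := expansion_le h0 h1 (hdigit a)
  have hL : ρ * M / (1 - ρ) < 1 := by rw [div_lt_one (by linarith)]; linarith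
  refine ⟨⟨by linarith, by linarith⟩, ?_⟩
  rw [mem_preimage, hfD _ (hdigit a), mem_singleton_iff]
  congr 1
  ext i
  rw [Nat.mul_add_mod_self_right, Nat.mod_eq_of_lt (b i).2]
end

section
/- Let k ≥ 1 be a natural number, let r ≥ 2 and s ≥ 2 be natural numbers, and let 0 < ε < 1/(rs−1). Set α₀ := (log_s r)/(1 + log_s(r/(1−ε))) and β₀ := 1/((k+ε)·(1 + log_s(r/(1−ε)))). Then there exist a function f ∈ C^k((-2,2),ℝ) and a compact set D ⊆ [0,1] such that dim_H D = β₀ and for every y ∈ D the level set f⁻¹(y) has Hausdorff dimension exactly α₀. -/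
open MeasureTheory Set

/-- The number `∑ qⁿ zₙ` with generalized base-`q⁻¹` digits `zₙ`. -/
noncomputable def geomCode (q : ℝ) (z : ℕ → ℝ) : ℝ := ∑' n, q ^ n * z n

section GeomCode

variable {q δ : ℝ} {z w : ℕ → ℝ}

lemma summable_geomCode (hq0 : 0 ≤ q) (hq1 : q < 1) (hz : ∀ n, z n ∈ Icc 0 (1 - q)) :
    Summable fun n => q ^ n * z n :=
  Summable.of_nonneg_of_le (fun n => mul_nonneg (pow_nonneg hq0 n) (hz n).1)
    (fun n => mul_le_mul_of_nonneg_left (hz n).2 (pow_nonneg hq0 n))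
    ((summable_geometric_of_lt_one hq0 hq1).mul_right _)

lemma geomCode_mem_Icc (hq0 : 0 ≤ q) (hq1 : q < 1) (hz : ∀ n, z n ∈ Icc 0 (1 - q)) :
    geomCode q z ∈ Icc 0 1 := by
  refine ⟨tsum_nonneg fun n => mul_nonneg (pow_nonneg hq0 n) (hz n).1, ?_⟩
  calc geomCode q z ≤ ∑' n, q ^ n * (1 - q) :=
        (summable_geomCode hq0 hq1 hz).tsum_le_tsum
          (fun n => mul_le_mul_of_nonneg_left (hz n).2 (pow_nonneg hq0 n))
          ((summable_geometric_of_lt_one hq0 hq1).mul_right _)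
    _ = 1 := by
        rw [tsum_mul_right, tsum_geometric_of_lt_one hq0 hq1]
        exact inv_mul_cancel₀ (by linarith)

lemma geomCode_eq_sum_add (hq0 : 0 ≤ q) (hq1 : q < 1) (hz : ∀ n, z n ∈ Icc 0 (1 - q)) (n : ℕ) :
    geomCode q z =
      ∑ i ∈ Finset.range n, q ^ i * z i + q ^ n * geomCode q fun i => z (i + n) := by
  rw [geomCode, ← (summable_geomCode hq0 hq1 hz).sum_add_tsum_nat_add n, geomCode, ← tsum_mul_left]
  congr 2
  ext i
  ring

lemma geomCode_eq_add (hq0 : 0 ≤ q) (hq1 : q < 1) (hz : ∀ n, z n ∈ Icc 0 (1 - q)) :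
    geomCode q z = z 0 + q * geomCode q fun i => z (i + 1) := by
  simpa using geomCode_eq_sum_add hq0 hq1 hz 1

lemma abs_geomCode_sub_le (hq0 : 0 ≤ q) (hq1 : q < 1) (hz : ∀ n, z n ∈ Icc 0 (1 - q))
    (hw : ∀ n, w n ∈ Icc 0 (1 - q)) {n : ℕ} (h : ∀ i < n, z i = w i) :
    |geomCode q z - geomCode q w| ≤ q ^ n := by
  rw [geomCode_eq_sum_add hq0 hq1 hz n, geomCode_eq_sum_add hq0 hq1 hw n,
    Finset.sum_congr rfl fun i hi => by rw [h i (Finset.mem_range.mp hi)],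
    add_sub_add_left_eq_sub, ← mul_sub, abs_mul, abs_of_nonneg (pow_nonneg hq0 n)]
  have h1 := geomCode_mem_Icc hq0 hq1 fun i => hz (i + n)
  have h2 := geomCode_mem_Icc hq0 hq1 fun i => hw (i + n)
  refine mul_le_of_le_one_right (pow_nonneg hq0 n) (abs_le.2 ⟨?_, ?_⟩) <;>
    linarith [h1.1, h1.2, h2.1, h2.2]

lemma le_abs_geomCode_sub (hq0 : 0 ≤ q) (hq1 : q < 1) (hz : ∀ n, z n ∈ Icc 0 (1 - q))
    (hw : ∀ n, w n ∈ Icc 0 (1 - q)) {n : ℕ} (h : ∀ i < n, z i = w i)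
    (hn : q + δ ≤ |z n - w n|) :
    δ * q ^ n ≤ |geomCode q z - geomCode q w| := by
  have h1 := geomCode_mem_Icc hq0 hq1 fun i => hz (i + 1 + n)
  have h2 := geomCode_mem_Icc hq0 hq1 fun i => hw (i + 1 + n)
  rw [geomCode_eq_sum_add hq0 hq1 hz n, geomCode_eq_sum_add hq0 hq1 hw n,
    Finset.sum_congr rfl fun i hi => by rw [h i (Finset.mem_range.mp hi)],
    add_sub_add_left_eq_sub, ← mul_sub, abs_mul, abs_of_nonneg (pow_nonneg hq0 n), mul_comm δ]
  refine mul_le_mul_of_nonneg_left ?_ (pow_nonneg hq0 n)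
  rw [geomCode_eq_add hq0 hq1 fun i => hz (i + n), geomCode_eq_add hq0 hq1 fun i => hw (i + n)]
  simp only [zero_add]
  set a := geomCode q fun i => z (i + 1 + n)
  set b := geomCode q fun i => w (i + 1 + n)
  have h3 : |q * b - q * a| ≤ q := by
    rw [← mul_sub, abs_mul, abs_of_nonneg hq0]
    refine mul_le_of_le_one_right hq0 (abs_le.2 ⟨?_, ?_⟩) <;> linarith [h1.1, h1.2, h2.1, h2.2]
  have h4 := abs_sub_abs_le_abs_sub (z n - w n) (q * b - q * a)
  rw [show z n - w n - (q * b - q * a) = z n + q * a - (w n + q * b) by ring] at h4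
  linarith

end GeomCode

section CantorSet

variable {r : ℕ} {q δ : ℝ} {A : ℕ → Fin r → ℝ}

lemma rpow_log_div_log_inv {x : ℝ} (hq0 : 0 < q) (hq1 : q < 1) (hx : 0 < x) :
    q ^ (Real.log x / Real.log q⁻¹) = x⁻¹ := by
  have hq : Real.log q ≠ 0 := (Real.log_neg hq0 hq1).ne
  rw [Real.rpow_def_of_pos hq0, Real.log_inv,
    show Real.log q * (Real.log x / -Real.log q) = -Real.log x by field_simp,
    Real.exp_neg, Real.exp_log hx]

lemma dimH_range_geomCode_le (hr : 2 ≤ r) (hq0 : 0 < q) (hq1 : q < 1)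
    (hA : ∀ n i, A n i ∈ Icc 0 (1 - q)) :
    dimH (range fun u : ℕ → Fin r => geomCode q fun n => A n (u n)) ≤
      ENNReal.ofReal (Real.log r / Real.log q⁻¹) := by
  have hlogr : 0 < Real.log r := Real.log_pos (by exact_mod_cast hr)
  have hlogq : 0 < Real.log q⁻¹ := Real.log_pos ((one_lt_inv₀ hq0).2 hq1)
  set α := Real.log r / Real.log q⁻¹ with hα
  have hα0 : 0 < α := div_pos hlogr hlogq
  have hqα : q ^ α = (r : ℝ)⁻¹ := rpow_log_div_log_inv hq0 hq1 (by positivity)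
  have hfin : μH[α] (range fun u : ℕ → Fin r => geomCode q fun n => A n (u n)) ≤ 1 := by
    have hdiam : ∀ (n : ℕ) (w : Fin n → Fin r),
        Metric.ediam ((fun u : ℕ → Fin r => geomCode q fun n => A n (u n)) ''
          {u | ∀ i : Fin n, u i = w i}) ≤ ENNReal.ofReal (q ^ n) := by
      intro n w
      refine Metric.ediam_le ?_
      rintro _ ⟨u, hu, rfl⟩ _ ⟨v, hv, rfl⟩
      rw [edist_dist, Real.dist_eq]
      refine ENNReal.ofReal_le_ofReal (abs_geomCode_sub_le hq0.le hq1 (fun n => hA n _)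
        (fun n => hA n _) fun i hi => ?_)
      rw [hu ⟨i, hi⟩, hv ⟨i, hi⟩]
    refine (Measure.hausdorffMeasure_le_liminf_sum (l := Filter.atTop) α _
      (fun n : ℕ => ENNReal.ofReal (q ^ n)) ?_
      (fun n (w : Fin n → Fin r) => (fun u : ℕ → Fin r => geomCode q fun n => A n (u n)) ''
          {u | ∀ i : Fin n, u i = w i}) (.of_forall hdiam) (.of_forall fun n => ?_)).trans ?_
    · simpa using ENNReal.tendsto_ofReal (tendsto_pow_atTop_nhds_zero_of_lt_one hq0.le hq1)
    · rintro _ ⟨u, rfl⟩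
      exact mem_iUnion.2 ⟨fun i => u i, u, fun i => rfl, rfl⟩
    · refine Filter.liminf_le_of_le (by isBoundedDefault) fun b hb => ?_
      obtain ⟨n, hn⟩ := hb.exists
      refine hn.trans ((Finset.sum_le_sum fun w _ =>
        ENNReal.rpow_le_rpow (hdiam n w) hα0.le).trans ?_)
      rw [Finset.sum_const, Finset.card_univ, Fintype.card_fun, Fintype.card_fin, Fintype.card_fin,
        nsmul_eq_mul, ENNReal.ofReal_rpow_of_nonneg (by positivity) hα0.le, ← Real.rpow_natCast,
        ← Real.rpow_mul hq0.le, mul_comm (n : ℝ), Real.rpow_mul hq0.le, hqα, Real.rpow_natCast,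
        ← ENNReal.ofReal_natCast, ← ENNReal.ofReal_mul (by positivity), Nat.cast_pow, ← mul_pow,
        mul_inv_cancel₀ (by positivity), one_pow, ENNReal.ofReal_one]
  have := dimH_le_of_hausdorffMeasure_ne_top (d := α.toNNReal)
    (s := range fun u : ℕ → Fin r => geomCode q fun n => A n (u n))
    (by rw [Real.coe_toNNReal _ hα0.le]; exact ne_top_of_le_ne_top ENNReal.one_ne_top hfin)
  exact this

lemma le_dimH_range_geomCode (hr : 2 ≤ r) (hq0 : 0 < q) (hq1 : q < 1) (hδ : 0 < δ)
    (hA : ∀ n i, A n i ∈ Icc 0 (1 - q))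
    (hsep : ∀ n i j, i ≠ j → q + δ ≤ |A n i - A n j|) :
    ENNReal.ofReal (Real.log r / Real.log q⁻¹) ≤
      dimH (range fun u : ℕ → Fin r => geomCode q fun n => A n (u n)) := by
  have hlogr : 0 < Real.log r := Real.log_pos (by exact_mod_cast hr)
  have hlogq : 0 < Real.log q⁻¹ := Real.log_pos ((one_lt_inv₀ hq0).2 hq1)
  set α := Real.log r / Real.log q⁻¹ with hα
  have hα0 : 0 < α := div_pos hlogr hlogq
  have hqα : q ^ α = (r : ℝ)⁻¹ := rpow_log_div_log_inv hq0 hq1 (by positivity)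
  set X := fun u : ℕ → Fin r => geomCode q fun n => A n (u n) with hX
  have key : ∀ u v : ℕ → Fin r, |Real.ofDigits u - Real.ofDigits v| ≤ (δ⁻¹ * |X u - X v|) ^ α := by
    intro u v
    by_cases huv : u = v
    · simp [huv, Real.zero_rpow hα0.ne']
    · have hex : ∃ n, u n ≠ v n := Function.ne_iff.1 huv
      classical
      have hlt : ∀ i < Nat.find hex, u i = v i := fun i hi => not_not.1 (Nat.find_min hex hi)
      have h1 := le_abs_geomCode_sub hq0.le hq1 (fun n => hA n (u n)) (fun n => hA n (v n))
        (n := Nat.find hex) (fun i hi => by rw [hlt i hi])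
        (hsep _ _ _ (Nat.find_spec hex))
      refine (Real.abs_ofDigits_sub_ofDigits_le hlt).trans ?_
      calc ((r : ℝ) ^ Nat.find hex)⁻¹ = (q ^ Nat.find hex) ^ α := by
            rw [← inv_pow, ← hqα, ← Real.rpow_natCast, ← Real.rpow_natCast, ← Real.rpow_mul hq0.le,
              ← Real.rpow_mul hq0.le, mul_comm]
        _ ≤ _ := by
            refine Real.rpow_le_rpow (by positivity) ?_ hα0.le
            rw [inv_mul_eq_div, le_div_iff₀ hδ, mul_comm]
            exact h1
  have : Nonempty (ℕ → Fin r) := ⟨fun _ => ⟨0, by omega⟩⟩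
  set h : ℝ → ℝ := fun x => Real.ofDigits (Function.invFun X x) with hh
  have hhol : HolderOnWith (Real.toNNReal (δ⁻¹ ^ α)) α.toNNReal h (range X) := by
    rintro x hx y hy
    have h1 := key (Function.invFun X x) (Function.invFun X y)
    rw [Function.invFun_eq hx, Function.invFun_eq hy] at h1
    rw [edist_dist, edist_dist, Real.dist_eq, Real.dist_eq, Real.coe_toNNReal _ hα0.le,
      ENNReal.ofReal_rpow_of_nonneg (abs_nonneg _) hα0.le]
    change _ ≤ ENNReal.ofReal _ * _
    rw [← ENNReal.ofReal_mul (by positivity), ← Real.mul_rpow (by positivity) (abs_nonneg _)]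
    exact ENNReal.ofReal_le_ofReal h1
  have himg : Icc (0 : ℝ) 1 ⊆ h '' range X := by
    intro y hy
    obtain ⟨u, -, rfl⟩ := Real.ofDigits_SurjOn (b := r) (by omega) hy
    refine ⟨X u, ⟨u, rfl⟩, ?_⟩
    have h1 := key (Function.invFun X (X u)) u
    rw [Function.invFun_eq (f := X) ⟨u, rfl⟩, sub_self, abs_zero, mul_zero,
      Real.zero_rpow hα0.ne'] at h1
    exact sub_eq_zero.1 (abs_nonpos_iff.1 h1)
  have h1 : (1 : ENNReal) ≤ dimH (range X) / α.toNNReal := by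
    calc (1 : ENNReal) = dimH (Icc (0 : ℝ) 1) := by
          rw [Real.dimH_of_nonempty_interior (by simp)]; simp
      _ ≤ dimH (h '' range X) := dimH_mono himg
      _ ≤ _ := hhol.dimH_image_le (Real.toNNReal_pos.2 hα0)
  have h2 := ENNReal.mul_le_of_le_div h1
  rwa [one_mul] at h2

/-- A Cantor set with `r` separated branches of ratio `q` at every stage has Hausdorff dimension
`log r / log q⁻¹`. -/
theorem dimH_range_geomCode (hr : 2 ≤ r) (hq0 : 0 < q) (hq1 : q < 1) (hδ : 0 < δ)
    (hA : ∀ n i, A n i ∈ Icc 0 (1 - q))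
    (hsep : ∀ n i j, i ≠ j → q + δ ≤ |A n i - A n j|) :
    dimH (range fun u : ℕ → Fin r => geomCode q fun n => A n (u n)) =
      ENNReal.ofReal (Real.log r / Real.log q⁻¹) :=
  (dimH_range_geomCode_le hr hq0 hq1 hA).antisymm (le_dimH_range_geomCode hr hq0 hq1 hδ hA hsep)

lemma isCompact_range_geomCode (hq0 : 0 ≤ q) (hq1 : q < 1)
    (hA : ∀ n i, A n i ∈ Icc 0 (1 - q)) :
    IsCompact (range fun u : ℕ → Fin r => geomCode q fun n => A n (u n)) := by
  refine isCompact_range (continuous_tsum (u := fun n => q ^ n * (1 - q)) (fun n => ?_)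
    ((summable_geometric_of_lt_one hq0 hq1).mul_right _) fun n u => ?_)
  · exact continuous_const.mul ((continuous_of_discreteTopology (f := A n)).comp
      (continuous_apply n))
  · rw [Real.norm_of_nonneg (mul_nonneg (pow_nonneg hq0 n) (hA n _).1)]
    exact mul_le_mul_of_nonneg_left (hA n _).2 (pow_nonneg hq0 n)

/-- If every point of `P n` lies in a countable set or in a branch `A n i + q • P (n + 1)`, then,
up to a countable set, `P 0` is contained in the Cantor set coded by `A`. -/
lemma exists_countable_subset_union_range_geomCode {P S : ℕ → Set ℝ} (hq0 : 0 ≤ q) (hq1 : q < 1)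
    (hA : ∀ n i, A n i ∈ Icc 0 (1 - q)) (hP : ∀ n, P n ⊆ Icc 0 1) (hS : ∀ n, (S n).Countable)
    (hPS : ∀ n, ∀ x ∈ P n, x ∈ S n ∨ ∃ i, ∃ y ∈ P (n + 1), x = A n i + q * y) :
    ∃ C : Set ℝ, C.Countable ∧
      P 0 ⊆ C ∪ range fun u : ℕ → Fin r => geomCode q fun n => A n (u n) := by
  let E : ℕ → ℕ → Set ℝ := fun k => Nat.rec S
    (fun _ F n => ⋃ i, (fun y => A n i + q * y) '' F (n + 1)) k
  have hE : ∀ k n, (E k n).Countable := by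
    intro k
    induction k with
    | zero => exact hS
    | succ k ih => exact fun n => countable_iUnion fun i => (ih (n + 1)).image _
  have hstep : ∀ n x, (x ∈ P n ∧ ∀ k, x ∉ E k n) →
      ∃ i y, (y ∈ P (n + 1) ∧ ∀ k, y ∉ E k (n + 1)) ∧ x = A n i + q * y := by
    rintro n x ⟨hx, hxE⟩
    obtain h | ⟨i, y, hy, rfl⟩ := hPS n x hx
    · exact absurd h (hxE 0)
    · exact ⟨i, y, ⟨hy, fun k hk => hxE (k + 1) (mem_iUnion.2 ⟨i, y, hk, rfl⟩)⟩, rfl⟩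
  refine ⟨⋃ k, E k 0, countable_iUnion fun k => hE k 0, fun x hx => ?_⟩
  by_cases hxC : x ∈ ⋃ k, E k 0
  · exact Or.inl hxC
  · right
    have hx0 : x ∈ P 0 ∧ ∀ k, x ∉ E k 0 := ⟨hx, by simpa using hxC⟩
    have : Nonempty (Fin r) := ⟨(hstep 0 x hx0).choose⟩
    choose! i t ht hit using hstep
    let o : ℕ → ℝ := fun n => Nat.rec x (fun n y => t n y) n
    have ho : ∀ n, o n ∈ P n ∧ ∀ k, o n ∉ E k n := by
      intro n
      induction n with
      | zero => exact hx0
      | succ n ih => exact ht n _ ih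
    have hsum : ∀ n, x = ∑ m ∈ Finset.range n, q ^ m * A m (i m (o m)) + q ^ n * o n := by
      intro n
      induction n with
      | zero => simp [o]
      | succ n ih =>
        rw [Finset.sum_range_succ, pow_succ]
        have : o n = A n (i n (o n)) + q * o (n + 1) := hit n _ (ho n)
        linear_combination ih + q ^ n * this
    refine ⟨fun n => i n (o n), ?_⟩
    have hle : ∀ n : ℕ, |geomCode q (fun n => A n (i n (o n))) - x| ≤ q ^ n := by
      intro n
      have h1 := geomCode_mem_Icc hq0 hq1 fun m => hA (m + n) (i (m + n) (o (m + n)))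
      have h2 := hP n (ho n).1
      have h3 := hsum n
      rw [geomCode_eq_sum_add hq0 hq1 (fun n => hA n _) n]
      set T := ∑ m ∈ Finset.range n, q ^ m * A m (i m (o m))
      rw [h3, add_sub_add_left_eq_sub, ← mul_sub, abs_mul, abs_of_nonneg (pow_nonneg hq0 n)]
      refine mul_le_of_le_one_right (pow_nonneg hq0 n) (abs_le.2 ⟨?_, ?_⟩) <;>
        linarith [h1.1, h1.2, h2.1, h2.2]
    have := ge_of_tendsto' (tendsto_pow_atTop_nhds_zero_of_lt_one hq0 hq1) hle
    exact sub_eq_zero.1 (abs_nonpos_iff.1 this)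

end CantorSet

section SelfSimilar

variable {ι : Type*} {a : ι → ℝ} {q p : ℝ} {h g : ℝ → ℝ} {x : ℝ}

lemma notMem_Icc_of_separated (hq : 0 < q) (hsep : ∀ i j, i ≠ j → q < |a i - a j|) {i j : ι}
    (hij : j ≠ i) (hi : (x - a i) / q ∈ Icc (0 : ℝ) 1) : (x - a j) / q ∉ Icc (0 : ℝ) 1 := by
  intro hj
  rw [mem_Icc, le_div_iff₀ hq, div_le_iff₀ hq] at hi hj
  have := hsep i j hij.symm
  rw [lt_abs] at this
  rcases this with h | h <;> linarith [hi.1, hi.2, hj.1, hj.2]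

lemma notMem_Icc_of_notMem (hq : 0 < q) (ha : ∀ i, a i ∈ Icc 0 (1 - q)) (hx : x ∉ Icc (0 : ℝ) 1)
    (i : ι) : (x - a i) / q ∉ Icc (0 : ℝ) 1 := by
  intro hi
  rw [mem_Icc, le_div_iff₀ hq, div_le_iff₀ hq] at hi
  exact hx ⟨by linarith [hi.1, (ha i).1], by linarith [hi.2, (ha i).2]⟩

variable [Fintype ι]

/-- The sum of the copies of `h` carried from `[0, 1]` to the intervals `[a i, a i + q]`. -/
noncomputable def sumOfCopies (a : ι → ℝ) (q : ℝ) (h : ℝ → ℝ) (x : ℝ) : ℝ :=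
  ∑ i, h ((x - a i) / q)

/-- The solution `f` of the self-similarity equation `f = g + p • sumOfCopies a q f`. -/
noncomputable def selfSimilarSum (a : ι → ℝ) (q p : ℝ) (g : ℝ → ℝ) (x : ℝ) : ℝ :=
  ∑' n : ℕ, p ^ n * (sumOfCopies a q)^[n] g x

lemma sumOfCopies_eq_of_mem {i : ι} (hi : ∀ j ≠ i, (x - a j) / q ∉ Icc (0 : ℝ) 1)
    (hh : ∀ y ∉ Icc (0 : ℝ) 1, h y = 0) : sumOfCopies a q h x = h ((x - a i) / q) :=
  Fintype.sum_eq_single i fun j hj => hh _ (hi j hj)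

lemma sumOfCopies_eq_zero (hi : ∀ j, (x - a j) / q ∉ Icc (0 : ℝ) 1)
    (hh : ∀ y ∉ Icc (0 : ℝ) 1, h y = 0) : sumOfCopies a q h x = 0 :=
  Finset.sum_eq_zero fun j _ => hh _ (hi j)

lemma iterate_sumOfCopies_eq_zero (hq : 0 < q) (ha : ∀ i, a i ∈ Icc 0 (1 - q))
    (hg : ∀ y ∉ Icc (0 : ℝ) 1, g y = 0) (n : ℕ) :
    ∀ y ∉ Icc (0 : ℝ) 1, (sumOfCopies a q)^[n] g y = 0 := by
  induction n with
  | zero => exact hg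
  | succ n ih =>
    intro y hy
    rw [Function.iterate_succ_apply']
    exact sumOfCopies_eq_zero (notMem_Icc_of_notMem hq ha hy) ih

lemma contDiff_sumOfCopies {n : WithTop ℕ∞} (hh : ContDiff ℝ n h) :
    ContDiff ℝ n (sumOfCopies a q h) :=
  ContDiff.sum fun _ _ => hh.comp ((contDiff_id.sub contDiff_const).div_const q)

lemma contDiff_iterate_sumOfCopies {k : WithTop ℕ∞} (hg : ContDiff ℝ k g) (n : ℕ) :
    ContDiff ℝ k ((sumOfCopies a q)^[n] g) := by
  induction n with
  | zero => exact hg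
  | succ n ih =>
    rw [Function.iterate_succ_apply']
    exact contDiff_sumOfCopies ih

lemma iteratedDeriv_eq_zero_of_notMem_Icc (hh : ∀ y ∉ Icc (0 : ℝ) 1, h y = 0) (m : ℕ) :
    ∀ y ∉ Icc (0 : ℝ) 1, iteratedDeriv m h y = 0 := by
  intro y hy
  have : h =ᶠ[nhds y] fun _ => 0 := by
    filter_upwards [isClosed_Icc.isOpen_compl.mem_nhds hy] with z hz using hh z hz
  rw [this.iteratedDeriv_eq]
  simp

lemma iteratedDeriv_sumOfCopies {m : ℕ} (hh : ContDiff ℝ m h) (x : ℝ) :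
    iteratedDeriv m (sumOfCopies a q h) x =
      (q⁻¹) ^ m * sumOfCopies a q (iteratedDeriv m h) x := by
  have h1 : ∀ i, iteratedDeriv m (fun x => h ((x - a i) / q)) x =
      (q⁻¹) ^ m * iteratedDeriv m h ((x - a i) / q) := by
    intro i
    have h2 := congrFun (iteratedDeriv_comp_sub_const m (fun y => h (q⁻¹ * y)) (a i)) x
    simp only [div_eq_inv_mul]
    rw [h2, congrFun (iteratedDeriv_comp_const_mul hh q⁻¹) (x - a i)]
  have h2 : ∀ i, ContDiff ℝ m fun x => h ((x - a i) / q) := fun i =>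
    hh.comp ((contDiff_id.sub contDiff_const).div_const q)
  unfold sumOfCopies
  rw [iteratedDeriv_fun_sum fun i _ => (h2 i).contDiffAt, Finset.mul_sum]
  exact Finset.sum_congr rfl fun i _ => h1 i

lemma abs_sumOfCopies_le (hq : 0 < q) (hsep : ∀ i j, i ≠ j → q < |a i - a j|)
    (hh : ∀ y ∉ Icc (0 : ℝ) 1, h y = 0) {C : ℝ} (hC : ∀ y, |h y| ≤ C) (x : ℝ) :
    |sumOfCopies a q h x| ≤ C := by
  by_cases hx : ∃ i, (x - a i) / q ∈ Icc (0 : ℝ) 1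
  · obtain ⟨i, hi⟩ := hx
    rw [sumOfCopies_eq_of_mem (fun j hj => notMem_Icc_of_separated hq hsep hj hi) hh]
    exact hC _
  · rw [sumOfCopies_eq_zero (not_exists.1 hx) hh, abs_zero]
    exact (abs_nonneg _).trans (hC 0)

lemma abs_iteratedDeriv_iterate_sumOfCopies_le (hq : 0 < q) (ha : ∀ i, a i ∈ Icc 0 (1 - q))
    (hsep : ∀ i j, i ≠ j → q < |a i - a j|) (hg : ∀ y ∉ Icc (0 : ℝ) 1, g y = 0) {m : ℕ}
    (hgm : ContDiff ℝ m g) {C : ℝ} (hC : ∀ y, |iteratedDeriv m g y| ≤ C) (n : ℕ) (x : ℝ) :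
    |iteratedDeriv m ((sumOfCopies a q)^[n] g) x| ≤ C * ((q⁻¹) ^ m) ^ n := by
  induction n generalizing x with
  | zero => simpa using hC x
  | succ n ih =>
    rw [Function.iterate_succ_apply', iteratedDeriv_sumOfCopies (contDiff_iterate_sumOfCopies hgm n),
      abs_mul, abs_of_nonneg (by positivity), pow_succ, ← mul_assoc, mul_comm]
    exact mul_le_mul_of_nonneg_right (abs_sumOfCopies_le hq hsep
      (iteratedDeriv_eq_zero_of_notMem_Icc (iterate_sumOfCopies_eq_zero hq ha hg n) m) ih x)
      (by positivity)

lemma contDiff_selfSimilarSum (hq0 : 0 < q) (hq1 : q < 1) (hp : 0 ≤ p)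
    (ha : ∀ i, a i ∈ Icc 0 (1 - q)) (hsep : ∀ i j, i ≠ j → q < |a i - a j|)
    (hg : ∀ y ∉ Icc (0 : ℝ) 1, g y = 0) {k : ℕ} (hgk : ContDiff ℝ k g) (hpq : p < q ^ k) :
    ContDiff ℝ k (selfSimilarSum a q p g) := by
  have hbound : ∀ m : ℕ, m ≤ k → ∃ C, ∀ y, |iteratedDeriv m g y| ≤ C := by
    intro m hm
    obtain ⟨C, hC⟩ := isCompact_Icc.exists_bound_of_continuousOn (s := Icc (0 : ℝ) 1)
      (hgk.continuous_iteratedDeriv m (by exact_mod_cast hm)).continuousOn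
    refine ⟨max C 0, fun y => ?_⟩
    by_cases hy : y ∈ Icc (0 : ℝ) 1
    · exact (hC y hy).trans (le_max_left _ _)
    · rw [iteratedDeriv_eq_zero_of_notMem_Icc hg m y hy, abs_zero]
      exact le_max_right _ _
  choose! C hC using hbound
  refine contDiff_tsum (N := (k : ℕ∞)) (v := fun m n => C m * (p * (q⁻¹) ^ m) ^ n)
    (fun n => contDiff_const.mul (contDiff_iterate_sumOfCopies hgk n)) (fun m hm => ?_)
    fun m n x hm => ?_
  · have hm' : m ≤ k := by exact_mod_cast hm
    refine (summable_geometric_of_lt_one (by positivity) ?_).mul_left _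
    rw [inv_pow, ← div_eq_mul_inv, div_lt_one (by positivity)]
    exact hpq.trans_le (pow_le_pow_of_le_one hq0.le hq1.le hm')
  · have hm' : m ≤ k := by exact_mod_cast hm
    have hgm : ContDiff ℝ m g := hgk.of_le (by exact_mod_cast hm')
    rw [norm_iteratedFDeriv_eq_norm_iteratedDeriv, iteratedDeriv_const_mul _
      (contDiff_iterate_sumOfCopies hgm n).contDiffAt, norm_mul, Real.norm_of_nonneg (by positivity),
      mul_pow, mul_left_comm]
    exact mul_le_mul_of_nonneg_left
      (abs_iteratedDeriv_iterate_sumOfCopies_le hq0 ha hsep hg hgm (hC m hm') n x) (by positivity)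

lemma iterate_sumOfCopies_mem_Icc (hq : 0 < q) (ha : ∀ i, a i ∈ Icc 0 (1 - q))
    (hsep : ∀ i j, i ≠ j → q < |a i - a j|) (hg : ∀ y ∉ Icc (0 : ℝ) 1, g y = 0) {M : ℝ}
    (hgM : ∀ y, g y ∈ Icc 0 M) (n : ℕ) (x : ℝ) : (sumOfCopies a q)^[n] g x ∈ Icc 0 M := by
  induction n generalizing x with
  | zero => exact hgM x
  | succ n ih =>
    rw [Function.iterate_succ_apply']
    exact ⟨Finset.sum_nonneg fun i _ => (ih _).1, (le_abs_self _).trans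
      (abs_sumOfCopies_le hq hsep (iterate_sumOfCopies_eq_zero hq ha hg n)
        (fun y => (abs_of_nonneg (ih y).1).trans_le (ih y).2) x)⟩

lemma selfSimilarSum_eq_geomCode (x : ℝ) :
    selfSimilarSum a q p g x = geomCode p fun n => (sumOfCopies a q)^[n] g x := rfl

lemma selfSimilarSum_mem_Icc (hq : 0 < q) (hp0 : 0 ≤ p) (hp1 : p < 1)
    (ha : ∀ i, a i ∈ Icc 0 (1 - q)) (hsep : ∀ i j, i ≠ j → q < |a i - a j|)
    (hg : ∀ y ∉ Icc (0 : ℝ) 1, g y = 0) (hgp : ∀ y, g y ∈ Icc 0 (1 - p)) (x : ℝ) :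
    selfSimilarSum a q p g x ∈ Icc 0 1 :=
  geomCode_mem_Icc hp0 hp1 fun n => iterate_sumOfCopies_mem_Icc hq ha hsep hg hgp n x

lemma selfSimilarSum_eq_zero (hq : 0 < q) (ha : ∀ i, a i ∈ Icc 0 (1 - q))
    (hg : ∀ y ∉ Icc (0 : ℝ) 1, g y = 0) : ∀ y ∉ Icc (0 : ℝ) 1, selfSimilarSum a q p g y = 0 := by
  intro y hy
  simp [selfSimilarSum, iterate_sumOfCopies_eq_zero hq ha hg _ y hy]

lemma selfSimilarSum_eq_add (hq : 0 < q) (hp0 : 0 ≤ p) (hp1 : p < 1)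
    (ha : ∀ i, a i ∈ Icc 0 (1 - q)) (hsep : ∀ i j, i ≠ j → q < |a i - a j|)
    (hg : ∀ y ∉ Icc (0 : ℝ) 1, g y = 0) (hgp : ∀ y, g y ∈ Icc 0 (1 - p)) (x : ℝ) :
    selfSimilarSum a q p g x = g x + p * sumOfCopies a q (selfSimilarSum a q p g) x := by
  have hmem := iterate_sumOfCopies_mem_Icc hq ha hsep hg hgp
  rw [selfSimilarSum_eq_geomCode, geomCode_eq_add hp0 hp1 fun n => hmem n x]
  simp only [Function.iterate_zero, id]
  congr 2
  simp only [Function.iterate_succ_apply', geomCode]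
  unfold sumOfCopies selfSimilarSum
  rw [← Summable.tsum_finsetSum fun i _ => summable_geomCode hp0 hp1 fun n => hmem n _]
  simp_rw [Finset.mul_sum]
  rfl

end SelfSimilar

section Terrace

/-- A smooth function vanishing off `(0, 1)`, equal to `1` on `[ε/2, 1 - ε/2]` and strictly monotone
in between. -/
noncomputable def plateau (ε u : ℝ) : ℝ :=
  Real.smoothTransition (2 * u / ε) * Real.smoothTransition (2 * (1 - u) / ε)

lemma expNegInvGlue_strictMonoOn : StrictMonoOn expNegInvGlue (Ici 0) := by
  intro x hx y hy hxy
  have hy0 : 0 < y := lt_of_le_of_lt hx hxy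
  rcases (show 0 ≤ x from hx).eq_or_lt with rfl | hx0
  · rw [expNegInvGlue.zero]
    exact expNegInvGlue.pos_of_pos hy0
  · simp only [expNegInvGlue, not_le.2 hx0, not_le.2 hy0, if_false]
    exact Real.exp_lt_exp.2 (neg_lt_neg ((inv_lt_inv₀ hy0 hx0).2 hxy))

lemma Real.smoothTransition_strictMonoOn : StrictMonoOn Real.smoothTransition (Icc 0 1) := by
  intro x hx y hy hxy
  have h1 := expNegInvGlue_strictMonoOn hx.1 hy.1 hxy
  have h2 : expNegInvGlue (1 - y) ≤ expNegInvGlue (1 - x) := expNegInvGlue.monotone (by linarith)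
  have h3 := expNegInvGlue.nonneg x
  have h4 := expNegInvGlue.nonneg (1 - y)
  have h5 := Real.smoothTransition.pos_denom x
  rw [Real.smoothTransition, Real.smoothTransition,
    div_lt_div_iff₀ h5 (Real.smoothTransition.pos_denom y)]
  have h6 : expNegInvGlue x * expNegInvGlue (1 - y) ≤ expNegInvGlue x * expNegInvGlue (1 - x) :=
    mul_le_mul_of_nonneg_left h2 h3
  have h7 : 0 < expNegInvGlue (1 - x) := expNegInvGlue.pos_of_pos (by linarith [hy.2])
  nlinarith [mul_lt_mul_of_pos_right h1 h7]

variable {ε u : ℝ}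

lemma contDiff_plateau {n : ℕ∞} : ContDiff ℝ n (plateau ε) :=
  (Real.smoothTransition.contDiff.comp ((contDiff_const.mul contDiff_id).div_const ε)).mul
    (Real.smoothTransition.contDiff.comp
      ((contDiff_const.mul (contDiff_const.sub contDiff_id)).div_const ε))

lemma plateau_mem_Icc : plateau ε u ∈ Icc (0 : ℝ) 1 :=
  ⟨mul_nonneg (Real.smoothTransition.nonneg _) (Real.smoothTransition.nonneg _),
    mul_le_one₀ (Real.smoothTransition.le_one _) (Real.smoothTransition.nonneg _)
      (Real.smoothTransition.le_one _)⟩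

lemma plateau_eq_zero (hε : 0 < ε) (hu : u ∉ Ioo (0 : ℝ) 1) : plateau ε u = 0 := by
  rw [mem_Ioo, not_and_or, not_lt, not_lt] at hu
  rcases hu with hu | hu
  · rw [plateau, Real.smoothTransition.zero_of_nonpos
      (div_nonpos_of_nonpos_of_nonneg (by linarith) hε.le), zero_mul]
  · rw [plateau, Real.smoothTransition.zero_of_nonpos (x := 2 * (1 - u) / ε)
      (div_nonpos_of_nonpos_of_nonneg (by linarith) hε.le), mul_zero]

lemma plateau_eq_left (hε : 0 < ε) (hu : u ≤ 1 - ε / 2) :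
    plateau ε u = Real.smoothTransition (2 * u / ε) := by
  rw [plateau, Real.smoothTransition.one_of_one_le (x := 2 * (1 - u) / ε)
    ((one_le_div hε).2 (by linarith)), mul_one]

lemma plateau_eq_right (hε : 0 < ε) (hu : ε / 2 ≤ u) :
    plateau ε u = Real.smoothTransition (2 * (1 - u) / ε) := by
  rw [plateau, Real.smoothTransition.one_of_one_le (x := 2 * u / ε)
    ((one_le_div hε).2 (by linarith)), one_mul]

lemma plateau_eq_one (hε : 0 < ε) (hu : u ∈ Icc (ε / 2) (1 - ε / 2)) : plateau ε u = 1 := by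
  rw [plateau_eq_left hε hu.2,
    Real.smoothTransition.one_of_one_le ((one_le_div hε).2 (by linarith [hu.1]))]

lemma plateau_injOn_left (hε : 0 < ε) (hε1 : ε < 1) : InjOn (plateau ε) (Icc 0 (ε / 2)) := by
  intro u hu v hv huv
  have h01 : ∀ w ∈ Icc 0 (ε / 2), 2 * w / ε ∈ Icc (0 : ℝ) 1 := fun w hw =>
    ⟨div_nonneg (by linarith [hw.1]) hε.le, (div_le_one hε).2 (by linarith [hw.2])⟩
  rw [plateau_eq_left hε (by linarith [hu.2]), plateau_eq_left hε (by linarith [hv.2])] at huv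
  have := Real.smoothTransition_strictMonoOn.injOn (h01 u hu) (h01 v hv) huv
  field_simp at this
  linarith

lemma plateau_injOn_right (hε : 0 < ε) (hε1 : ε < 1) : InjOn (plateau ε) (Icc (1 - ε / 2) 1) := by
  intro u hu v hv huv
  have h01 : ∀ w ∈ Icc (1 - ε / 2) 1, 2 * (1 - w) / ε ∈ Icc (0 : ℝ) 1 := fun w hw =>
    ⟨div_nonneg (by linarith [hw.2]) hε.le, (div_le_one hε).2 (by linarith [hw.1])⟩
  rw [plateau_eq_right hε (by linarith [hu.1]), plateau_eq_right hε (by linarith [hv.1])] at huv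
  have := Real.smoothTransition_strictMonoOn.injOn (h01 u hu) (h01 v hv) huv
  field_simp at this
  linarith

variable {ι : Type*} [Fintype ι]

/-- The smooth function with a plateau of height `d i` on the middle part of the cell
`[c i / N, (c i + 1) / N]`. -/
noncomputable def terrace (c : ι → ℕ) (N : ℕ) (ε : ℝ) (d : ι → ℝ) (x : ℝ) : ℝ :=
  ∑ i, d i * plateau ε (N * x - c i)

variable {c : ι → ℕ} {N : ℕ} {d : ι → ℝ} {x : ℝ}

lemma contDiff_terrace {n : ℕ∞} : ContDiff ℝ n (terrace c N ε d) :=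
  ContDiff.sum fun _ _ => contDiff_const.mul
    (contDiff_plateau.comp ((contDiff_const.mul contDiff_id).sub contDiff_const))

lemma terrace_eq (hε : 0 < ε) (hc : Function.Injective c) {i : ι}
    (hi : N * x - c i ∈ Ioo (0 : ℝ) 1) :
    terrace c N ε d x = d i * plateau ε (N * x - c i) := by
  refine Fintype.sum_eq_single i fun j hj => ?_
  rw [plateau_eq_zero hε, mul_zero]
  intro hj'
  have h1 : (c i : ℝ) < c j + 1 := by linarith [hi.1, hj'.2]
  have h2 : (c j : ℝ) < c i + 1 := by linarith [hi.2, hj'.1]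
  norm_cast at h1 h2
  exact hj (hc (by omega))

lemma terrace_eq_zero (hε : 0 < ε) (h : ∀ i, N * x - c i ∉ Ioo (0 : ℝ) 1) :
    terrace c N ε d x = 0 :=
  Finset.sum_eq_zero fun i _ => by rw [plateau_eq_zero hε (h i), mul_zero]

lemma terrace_mem_Icc (hε : 0 < ε) (hc : Function.Injective c) {M : ℝ} (hM : 0 ≤ M)
    (hd : ∀ i, d i ∈ Icc 0 M) (x : ℝ) : terrace c N ε d x ∈ Icc 0 M := by
  by_cases h : ∃ i, N * x - c i ∈ Ioo (0 : ℝ) 1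
  · obtain ⟨i, hi⟩ := h
    rw [terrace_eq hε hc hi]
    exact ⟨mul_nonneg (hd i).1 plateau_mem_Icc.1,
      (mul_le_of_le_one_right (hd i).1 plateau_mem_Icc.2).trans (hd i).2⟩
  · rw [terrace_eq_zero hε (not_exists.1 h)]
    exact ⟨le_rfl, hM⟩

lemma terrace_eq_zero_of_notMem_Icc (hε : 0 < ε) (hcN : ∀ i, c i < N) (hx : x ∉ Icc (0 : ℝ) 1) :
    terrace c N ε d x = 0 := by
  refine terrace_eq_zero hε fun i hi => hx ?_
  have h1 : (c i : ℝ) + 1 ≤ N := by exact_mod_cast hcN i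
  have h2 : (0 : ℝ) ≤ c i := by positivity
  have h3 : (0 : ℝ) < N := by linarith
  refine ⟨?_, ?_⟩
  · by_contra! h
    nlinarith [hi.1]
  · by_contra! h
    nlinarith [hi.2]

lemma countable_terrace_eq (hε : 0 < ε) (hε1 : ε < 1) (hc : Function.Injective c) (hN : 0 < N)
    (hd : ∀ i, d i ≠ 0) {y : ℝ} (hy : y ≠ 0) :
    {x | terrace c N ε d x = y ∧ ∀ i, N * x - c i ∉ Icc (ε / 2) (1 - ε / 2)}.Countable := by
  have hsub : ∀ (i : ι) (I : Set ℝ), InjOn (plateau ε) I →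
      {x : ℝ | N * x - c i ∈ I ∧ d i * plateau ε (N * x - c i) = y}.Subsingleton := by
    rintro i I hI x ⟨hx, hxy⟩ x' ⟨hx', hxy'⟩
    have h1 := hI hx hx' (mul_left_cancel₀ (hd i) (hxy.trans hxy'.symm))
    exact mul_left_cancel₀ (by positivity : (N : ℝ) ≠ 0) (sub_left_injective h1)
  refine Countable.mono ?_ (countable_iUnion fun i =>
    ((hsub i _ (plateau_injOn_left hε hε1)).countable.union
      (hsub i _ (plateau_injOn_right hε hε1)).countable))
  rintro x ⟨hxy, hx⟩
  by_cases h : ∃ i, N * x - c i ∈ Ioo (0 : ℝ) 1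
  · obtain ⟨i, hi⟩ := h
    rw [terrace_eq hε hc hi] at hxy
    refine mem_iUnion.2 ⟨i, ?_⟩
    rcases le_total (N * x - c i) (ε / 2) with h1 | h1
    · exact Or.inl ⟨⟨hi.1.le, h1⟩, hxy⟩
    · exact Or.inr ⟨⟨by by_contra! h2; exact hx i ⟨h1, h2.le⟩, hi.2.le⟩, hxy⟩
  · rw [terrace_eq_zero hε (not_exists.1 h)] at hxy
    exact absurd hxy.symm hy

end Terrace

/-- **The construction, precise form.** For `k ≥ 1`, naturals `r, s ≥ 2` and
`0 < ε < 1/(rs - 1)`, with `α₀ = log_s r / (1 + log_s (r/(1-ε)))` and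
`β₀ = 1 / ((k + ε) * (1 + log_s (r/(1-ε))))`, there exist a `C^k` function `f`
on `(-2, 2)` and a compact set `D ⊆ [0,1]` with `dim_H D = β₀` such that every
level set `f⁻¹(y)`, `y ∈ D`, has Hausdorff dimension exactly `α₀`. -/
theorem exists_contDiffOn_compact_dimH_level_sets_eq (k : ℕ) (hk : 1 ≤ k)
    (r s : ℕ) (hr : 2 ≤ r) (hs : 2 ≤ s) (ε : ℝ) (hε0 : 0 < ε)
    (hε1 : ε < 1 / ((r : ℝ) * s - 1)) :
    ∃ (f : ℝ → ℝ) (D : Set ℝ), ContDiffOn ℝ k f (Set.Ioo (-2 : ℝ) 2) ∧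
      IsCompact D ∧ D ⊆ Set.Icc (0 : ℝ) 1 ∧
      dimH D =
        ENNReal.ofReal
          (1 / ((k + ε) * (1 + Real.log ((r : ℝ) / (1 - ε)) / Real.log s))) ∧
      ∀ y ∈ D,
        dimH (Set.Ioo (-2 : ℝ) 2 ∩ f ⁻¹' {y}) =
          ENNReal.ofReal
            ((Real.log r / Real.log s) /
              (1 + Real.log ((r : ℝ) / (1 - ε)) / Real.log s)) := by
  have hrR : (2 : ℝ) ≤ r := by exact_mod_cast hr
  have hsR : (2 : ℝ) ≤ s := by exact_mod_cast hs
  have hkR : (1 : ℝ) ≤ k := by exact_mod_cast hk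
  have hε1' : ε < 1 := hε1.trans_le ((div_le_one (by nlinarith)).2 (by nlinarith))
  have hN0 : 0 < r * s := by positivity
  have hNR : (0 : ℝ) < (r * s : ℕ) := by exact_mod_cast hN0
  set q : ℝ := (1 - ε) / (r * s : ℕ) with hq
  have hqN : q * (r * s : ℕ) = 1 - ε := div_mul_cancel₀ _ hNR.ne'
  have hq0 : 0 < q := div_pos (by linarith) hNR
  have hqs : q * (s + 1) < 1 := by
    push_cast at hqN
    nlinarith [mul_pos hq0 (show (0 : ℝ) < s by linarith)]
  have hq1 : q < 1 := by nlinarith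
  set p : ℝ := q ^ ((k : ℝ) + ε) with hp
  have hp0 : 0 < p := Real.rpow_pos_of_pos hq0 _
  have hpk : p < q ^ k := by
    rw [hp, ← Real.rpow_natCast]
    exact Real.rpow_lt_rpow_of_exponent_gt hq0 hq1 (by linarith)
  have hpq : p ≤ q := hpk.le.trans (pow_le_of_le_one hq0.le hq1.le (by omega))
  have hp1 : p < 1 := hpq.trans_lt hq1
  have hps : p * (s + 1) < 1 := by nlinarith
  -- the digits of the values
  set d : Fin s → ℝ := fun j => (1 - p) / s * ((j : ℕ) + 1) with hd
  have hd0 : ∀ j, 0 < d j := fun j =>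
    mul_pos (div_pos (by linarith) (by linarith)) (by positivity)
  have hdp : ∀ j, d j ∈ Icc 0 (1 - p) := fun j => by
    refine ⟨(hd0 j).le, ?_⟩
    have : ((j : ℕ) : ℝ) + 1 ≤ s := by exact_mod_cast j.2
    calc (1 - p) / s * ((j : ℕ) + 1) ≤ (1 - p) / s * s :=
          mul_le_mul_of_nonneg_left this (div_nonneg (by linarith) (by linarith))
      _ = 1 - p := div_mul_cancel₀ _ (by positivity)
  obtain ⟨δ, hδ0, hδ⟩ : ∃ δ > 0, p + δ = (1 - p) / s := by
    refine ⟨(1 - p) / s - p, ?_, by ring⟩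
    rw [gt_iff_lt, sub_pos, lt_div_iff₀ (by linarith)]
    linarith
  have hdsep : ∀ i j, i ≠ j → p + δ ≤ |d i - d j| := by
    intro i j hij
    have h1 : (1 : ℝ) ≤ |((i : ℕ) : ℝ) - (j : ℕ)| := by
      have : (1 : ℤ) ≤ |((i : ℕ) : ℤ) - (j : ℕ)| :=
        Int.one_le_abs (sub_ne_zero.2 (by exact_mod_cast fun h => hij (Fin.ext h)))
      exact_mod_cast this
    rw [hd, ← mul_sub, add_sub_add_right_eq_sub, abs_mul, abs_of_pos (by rw [← hδ]; linarith), hδ]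
    exact le_mul_of_one_le_right (by rw [← hδ]; linarith) h1
  -- the digits of the arguments
  set c : Fin r × Fin s → ℕ := fun i => finProdFinEquiv i with hc
  have hcinj : Function.Injective c := Fin.val_injective.comp finProdFinEquiv.injective
  have hcN : ∀ i, c i < r * s := fun i => (finProdFinEquiv i).2
  set a : Fin r × Fin s → ℝ := fun i => (c i + ε / 2) / (r * s : ℕ) with ha
  have haq : ∀ i, a i ∈ Icc 0 (1 - q) := by
    intro i
    have h1 : (c i : ℝ) + 1 ≤ (r * s : ℕ) := by exact_mod_cast hcN i
    refine ⟨by positivity, ?_⟩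
    rw [ha, div_le_iff₀ hNR, sub_mul, hqN]
    linarith
  have hasep' : ∀ i j, i ≠ j → q + ε / (r * s : ℕ) ≤ |a i - a j| := by
    intro i j hij
    have h1 : (1 : ℝ) ≤ |(c i : ℝ) - c j| := by
      have : (1 : ℤ) ≤ |(c i : ℤ) - c j| :=
        Int.one_le_abs (sub_ne_zero.2 (by exact_mod_cast fun h => hij (hcinj h)))
      exact_mod_cast this
    rw [ha, ← sub_div, add_sub_add_right_eq_sub, abs_div, abs_of_pos hNR, hq, ← add_div]
    gcongr
    linarith
  have hεN : 0 < ε / (r * s : ℕ) := div_pos hε0 hNR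
  have hasep : ∀ i j, i ≠ j → q < |a i - a j| := fun i j hij => by linarith [hasep' i j hij]
  have hmem : ∀ x i, (x - a i) / q ∈ Icc (0 : ℝ) 1 ↔
      (r * s : ℕ) * x - c i ∈ Icc (ε / 2) (1 - ε / 2) := by
    intro x i
    have h1 : (r * s : ℕ) * a i = c i + ε / 2 := mul_div_cancel₀ _ hNR.ne'
    rw [mem_Icc, mem_Icc, le_div_iff₀ hq0, div_le_iff₀ hq0, ← mul_le_mul_iff_right₀ hNR,
      ← mul_le_mul_iff_right₀ (b := x - a i) hNR]
    constructor <;> rintro ⟨h2, h3⟩ <;> constructor <;> linarith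
  -- the function
  set g : ℝ → ℝ := terrace c (r * s) ε fun i => d i.2 with hg
  have hg0 : ∀ y ∉ Icc (0 : ℝ) 1, g y = 0 := fun y => terrace_eq_zero_of_notMem_Icc hε0 hcN
  have hgp : ∀ y, g y ∈ Icc 0 (1 - p) :=
    terrace_mem_Icc hε0 hcinj (by linarith) fun i => hdp i.2
  set f : ℝ → ℝ := selfSimilarSum a q p g with hf
  have hf01 : ∀ x, f x ∈ Icc 0 1 := selfSimilarSum_mem_Icc hq0 hp0.le hp1 haq hasep hg0 hgp
  have hf0 : ∀ y ∉ Icc (0 : ℝ) 1, f y = 0 := selfSimilarSum_eq_zero hq0 haq hg0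
  have hfeq := selfSimilarSum_eq_add hq0 hp0.le hp1 haq hasep hg0 hgp
  have hfstep : ∀ x i, (x - a i) / q ∈ Icc (0 : ℝ) 1 → f x = d i.2 + p * f ((x - a i) / q) := by
    intro x i hi
    have h1 := (hmem x i).1 hi
    rw [hf, hfeq, sumOfCopies_eq_of_mem (fun j hj => notMem_Icc_of_separated hq0 hasep hj hi) hf0,
      hg, terrace_eq hε0 hcinj ⟨by linarith [h1.1], by linarith [h1.2]⟩, plateau_eq_one hε0 h1,
      mul_one]
  have hfgap : ∀ x, (∀ i, (x - a i) / q ∉ Icc (0 : ℝ) 1) → f x = g x := fun x hx => by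
    rw [hf, hfeq, sumOfCopies_eq_zero hx hf0, mul_zero, add_zero]
  have hlogs : 0 < Real.log s := Real.log_pos (by linarith)
  have hlogq : Real.log q⁻¹ = Real.log s + Real.log (r / (1 - ε)) := by
    rw [← Real.log_mul (by positivity) (div_pos (by linarith) (by linarith)).ne', hq, inv_div]
    congr 1
    push_cast
    ring
  have hlogq0 : 0 < Real.log q⁻¹ := Real.log_pos ((one_lt_inv₀ hq0).2 hq1)
  have hlogp : Real.log p⁻¹ = (k + ε) * Real.log q⁻¹ := by
    rw [Real.log_inv, Real.log_inv, hp, Real.log_rpow hq0]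
    ring
  have hden : 1 + Real.log ((r : ℝ) / (1 - ε)) / Real.log s = Real.log q⁻¹ / Real.log s := by
    rw [hlogq]
    field_simp
  refine ⟨f, range fun v : ℕ → Fin s => geomCode p fun n => d (v n),
    (contDiff_selfSimilarSum hq0 hq1 hp0.le haq hasep hg0 contDiff_terrace hpk).contDiffOn,
    isCompact_range_geomCode hp0.le hp1 fun _ => hdp, ?_, ?_, ?_⟩
  · rintro _ ⟨v, rfl⟩
    exact geomCode_mem_Icc hp0.le hp1 fun n => hdp (v n)
  · rw [dimH_range_geomCode hs hp0 hp1 hδ0 (fun _ => hdp) fun _ => hdsep, hlogp, hden]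
    congr 1
    field_simp
  rintro _ ⟨v, rfl⟩
  have hdim : dimH (range fun u : ℕ → Fin r => geomCode q fun n => a (u n, v n)) =
      ENNReal.ofReal ((Real.log r / Real.log s) /
        (1 + Real.log ((r : ℝ) / (1 - ε)) / Real.log s)) := by
    rw [dimH_range_geomCode (A := fun n i => a (i, v n)) hr hq0 hq1 hεN (fun n i => haq _)
      (fun n i j hij => hasep' _ _ fun h => hij (Prod.ext_iff.1 h).1), hden]
    congr 1
    field_simp
  have hy : ∀ n, geomCode p (fun m => d (v (m + n))) =
      d (v n) + p * geomCode p fun m => d (v (m + (n + 1))) := by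
    intro n
    rw [geomCode_eq_add hp0.le hp1 fun m => hdp (v (m + n))]
    simp only [zero_add, add_assoc, add_comm 1]
  have hy01 : ∀ n, geomCode p (fun m => d (v (m + n))) ∈ Icc 0 1 :=
    fun n => geomCode_mem_Icc hp0.le hp1 fun m => hdp _
  have hypos : ∀ n, 0 < geomCode p (fun m => d (v (m + n))) := fun n => by
    rw [hy]
    exact add_pos_of_pos_of_nonneg (hd0 _) (mul_nonneg hp0.le (hy01 _).1)
  refine le_antisymm ?_ ?_
  · obtain ⟨C, hC, hsub⟩ := exists_countable_subset_union_range_geomCode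
      (P := fun n => {x | f x = geomCode p fun m => d (v (m + n))})
      (S := fun n => {x | g x = geomCode p (fun m => d (v (m + n))) ∧
        ∀ i, (r * s : ℕ) * x - c i ∉ Icc (ε / 2) (1 - ε / 2)})
      (A := fun n i => a (i, v n)) hq0.le hq1 (fun n i => haq _)
      (fun n x hx => by
        by_contra hx'
        exact (hypos n).ne ((hf0 x hx').symm.trans hx))
      (fun n => countable_terrace_eq hε0 hε1' hcinj hN0 (fun i => (hd0 i.2).ne') (hypos n).ne')
      (fun n x hx => by
        by_cases h : ∃ i, (x - a i) / q ∈ Icc (0 : ℝ) 1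
        · right
          obtain ⟨⟨i, j⟩, hi⟩ := h
          have h1 := hfstep x _ hi
          have h2 : f x = _ := hx
          rw [h1, hy n] at h2
          have h3 := hf01 ((x - a (i, j)) / q)
          have h4 := hy01 (n + 1)
          have hj : j = v n := by
            by_contra hj
            have h5 := hdsep _ _ hj
            rw [show d j - d (v n) = p * (geomCode p (fun m => d (v (m + (n + 1)))) -
              f ((x - a (i, j)) / q)) by linarith, abs_mul, abs_of_pos hp0] at h5
            have h6 : |geomCode p (fun m => d (v (m + (n + 1)))) - f ((x - a (i, j)) / q)| ≤ 1 :=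
              abs_le.2 ⟨by linarith [h3.2, h4.1], by linarith [h3.1, h4.2]⟩
            nlinarith
          subst hj
          refine ⟨i, _, mul_left_cancel₀ hp0.ne' (add_left_cancel h2), ?_⟩
          field_simp
          ring
        · left
          rw [not_exists] at h
          exact ⟨(hfgap x h).symm.trans hx, fun i hi => h i ((hmem x i).2 hi)⟩)
    calc dimH (Ioo (-2 : ℝ) 2 ∩ f ⁻¹' {geomCode p fun n => d (v n)})
        ≤ dimH (C ∪ range fun u : ℕ → Fin r => geomCode q fun n => a (u n, v n)) :=
          dimH_mono (inter_subset_right.trans hsub)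
      _ = _ := by rw [dimH_union, dimH_countable hC, hdim, max_eq_right zero_le]
  · rw [← hdim]
    refine dimH_mono ?_
    rintro _ ⟨u, rfl⟩
    have hx01 : ∀ n, geomCode q (fun m => a (u (m + n), v (m + n))) ∈ Icc 0 1 :=
      fun n => geomCode_mem_Icc hq0.le hq1 fun m => haq _
    have hfx : ∀ n, f (geomCode q fun m => a (u (m + n), v (m + n))) =
        d (v n) + p * f (geomCode q fun m => a (u (m + (n + 1)), v (m + (n + 1)))) := by
      intro n
      have h1 : (geomCode q (fun m => a (u (m + n), v (m + n))) - a (u n, v n)) / q =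
          geomCode q fun m => a (u (m + (n + 1)), v (m + (n + 1))) := by
        rw [geomCode_eq_add hq0.le hq1 fun m => haq _]
        simp only [zero_add, add_assoc, add_comm 1]
        field_simp
        ring
      have h2 := hfstep (geomCode q fun m => a (u (m + n), v (m + n))) (u n, v n)
      rw [h1] at h2
      exact h2 (hx01 (n + 1))
    have hle : ∀ n l, |f (geomCode q fun m => a (u (m + l), v (m + l))) -
        geomCode p fun m => d (v (m + l))| ≤ p ^ n := by
      intro n
      induction n with
      | zero =>
        intro l
        have h3 := hf01 (geomCode q fun m => a (u (m + l), v (m + l)))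
        have h4 := hy01 l
        rw [pow_zero]
        exact abs_le.2 ⟨by linarith [h3.1, h4.2], by linarith [h3.2, h4.1]⟩
      | succ n ih =>
        intro l
        rw [hfx, hy, add_sub_add_left_eq_sub, ← mul_sub, abs_mul, abs_of_pos hp0, pow_succ']
        exact mul_le_mul_of_nonneg_left (ih (l + 1)) hp0.le
    have hlim := ge_of_tendsto' (tendsto_pow_atTop_nhds_zero_of_lt_one hp0.le hp1) fun n => hle n 0
    refine ⟨⟨?_, ?_⟩, sub_eq_zero.1 (abs_nonpos_iff.1 hlim)⟩
    · exact lt_of_lt_of_le (by norm_num) (hx01 0).1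
    · exact lt_of_le_of_lt (hx01 0).2 (by norm_num)
end

section
/- The set of all real numbers of the form (log_s r)/(1 + log_s r) = (log r)/(log r + log s), where r and s range over the natural numbers with r ≥ 2 and s ≥ 2, is dense in the open interval (0,1). -/
open Set

/-- Every rational number in `(0, 1)` is of the form `log r / (log r + log s)`, with `r` and `s`
powers of two. -/
lemma exists_log_ratio_eq_ratCast {q : ℚ} (h0 : 0 < q) (h1 : q < 1) :
    ∃ r s : ℕ, 2 ≤ r ∧ 2 ≤ s ∧ (q : ℝ) = Real.log r / (Real.log r + Real.log s) := by
  obtain ⟨a, ha⟩ := Int.eq_ofNat_of_zero_le (Rat.num_pos.2 h0).le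
  have ha0 : 0 < a := by have := Rat.num_pos.2 h0; omega
  have hlt : a < q.den := by have := Rat.num_lt_denom_iff.2 h1; omega
  obtain ⟨b, hb⟩ := Nat.exists_eq_add_of_lt hlt
  refine ⟨2 ^ a, 2 ^ (b + 1), Nat.le_self_pow ha0.ne' 2, Nat.le_self_pow b.succ_ne_zero 2, ?_⟩
  have hlog : Real.log 2 ≠ 0 := (Real.log_pos one_lt_two).ne'
  rw [Rat.cast_def, ha, hb]
  push_cast
  rw [Real.log_pow, Real.log_pow, ← add_mul, mul_div_mul_right _ _ hlog]
  push_cast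
  rw [add_assoc]

/-- The set of numbers `log_s r / (1 + log_s r) = log r / (log r + log s)`,
for naturals `r, s ≥ 2`, is dense in the open interval `(0, 1)`. -/
theorem dense_log_ratio_in_Ioo :
    Set.Ioo (0 : ℝ) 1 ⊆
      closure {x : ℝ | ∃ r s : ℕ, 2 ≤ r ∧ 2 ≤ s ∧
        x = Real.log r / (Real.log r + Real.log s)} := by
  rintro x ⟨hx0, hx1⟩
  refine Metric.mem_closure_iff.2 fun ε hε ↦ ?_
  obtain ⟨q, hq, hqx⟩ := exists_rat_btwn (max_lt (sub_lt_self x hε) hx0)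
  obtain ⟨hqε, hq0⟩ := max_lt_iff.1 hq
  refine ⟨q, exists_log_ratio_eq_ratCast (by exact_mod_cast hq0)
    (by exact_mod_cast hqx.trans hx1), ?_⟩
  rw [Real.dist_eq, abs_of_pos (sub_pos.2 hqx)]
  linarith
end

section
/- Let s ≥ 1 and C ≥ 0 be real numbers, let A ⊆ ℝ, and let f : ℝ → ℝ satisfy |f(x₁) − f(x₂)| ≤ C·|x₁ − x₂|^s for all x₁, x₂ ∈ A. Let κ ≥ 0 and m ≥ 0 be real numbers and let Y ⊆ ℝ be a set with H^m(Y) > 0 such that H^κ(A ∩ f⁻¹(y)) > 0 for every y ∈ Y. Then H^{κ + s·m}(A) > 0. -/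
open MeasureTheory Set

open scoped ENNReal

/-- Index the dyadic interval `{y | ⌊2 ^ k * y⌋ = z}` by `(k, z)`. Given weights on these intervals,
this is the sum of the weights of all dyadic intervals of levels `0, …, k - 1` that contain it. -/
def ancestorWeight (w : ℕ → ℤ → ℝ≥0∞) : ℕ → ℤ → ℝ≥0∞
  | 0, _ => 0
  | k + 1, z => ancestorWeight w k (z / 2) + w k (z / 2)

lemma floor_two_pow_succ_div_two (k : ℕ) (y : ℝ) :
    ⌊(2 : ℝ) ^ (k + 1) * y⌋ / 2 = ⌊(2 : ℝ) ^ k * y⌋ := by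
  have h := Int.floor_div_natCast ((2 : ℝ) ^ (k + 1) * y) 2
  rw [show (2 : ℝ) ^ (k + 1) * y / (2 : ℕ) = 2 ^ k * y by push_cast; ring] at h
  exact_mod_cast h.symm

lemma ancestorWeight_floor (w : ℕ → ℤ → ℝ≥0∞) (y : ℝ) (n : ℕ) :
    ancestorWeight w n ⌊(2 : ℝ) ^ n * y⌋ = ∑ k ∈ Finset.range n, w k ⌊(2 : ℝ) ^ k * y⌋ := by
  induction n with
  | zero => simp [ancestorWeight]
  | succ n ih => rw [ancestorWeight, floor_two_pow_succ_div_two, ih, Finset.sum_range_succ]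

lemma volume_setOf_le_ofReal_lt_add_le (a b : ℝ≥0∞) :
    volume {t : ℝ | 0 ≤ t ∧ a ≤ ENNReal.ofReal t ∧ ENNReal.ofReal t < a + b} ≤ b := by
  rcases eq_or_ne b ∞ with rfl | hb
  · exact le_top
  rcases eq_or_ne a ∞ with rfl | ha
  · simp
  lift a to NNReal using ha
  lift b to NNReal using hb
  calc volume {t : ℝ | 0 ≤ t ∧ (a : ℝ≥0∞) ≤ ENNReal.ofReal t ∧ ENNReal.ofReal t < a + b}
      ≤ volume (Ico (a : ℝ) (a + b)) := by
        refine measure_mono ?_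
        rintro t ⟨h0, h1, h2⟩
        lift t to NNReal using h0
        rw [ENNReal.ofReal_coe_nnreal] at h1 h2
        exact ⟨by exact_mod_cast h1, by exact_mod_cast h2⟩
    _ = b := by simp [Real.volume_Ico]

/-- If the weights of the dyadic intervals containing any given point of `Y` add up to at least `1`,
then `Y` is covered by a family of dyadic intervals whose total cost does not exceed the weighted
cost: average over `t ∈ [0, 1)` the intervals at which the cumulative weight first exceeds `t`. -/
lemma exists_dyadic_cover (w : ℕ → ℤ → ℝ≥0∞) (c : ℕ → ℝ≥0∞) (Y : Set ℝ)
    (hY : ∀ y ∈ Y, 1 ≤ ∑' k, w k ⌊(2 : ℝ) ^ k * y⌋) :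
    ∃ B : Set (ℕ × ℤ), (∀ y ∈ Y, ∃ k, (k, ⌊(2 : ℝ) ^ k * y⌋) ∈ B) ∧
      ∑' q, B.indicator (fun q => c q.1) q ≤ ∑' q : ℕ × ℤ, c q.1 * w q.1 q.2 := by
  set T : ℕ × ℤ → Set ℝ := fun q => {t : ℝ | 0 ≤ t ∧ ancestorWeight w q.1 q.2 ≤ ENNReal.ofReal t ∧
    ENNReal.ofReal t < ancestorWeight w q.1 q.2 + w q.1 q.2} with hT
  have hTm : ∀ q, MeasurableSet (T q) := fun q =>
    measurableSet_Ici.inter ((measurableSet_le measurable_const ENNReal.measurable_ofReal).inter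
      (measurableSet_lt ENNReal.measurable_ofReal measurable_const))
  set μ : Measure ℝ := volume.restrict (Ico 0 1) with hμ
  have : IsProbabilityMeasure μ := ⟨by simp [hμ]⟩
  have hint : ∫⁻ t, ∑' q, (T q).indicator (fun _ => c q.1) t ∂μ ≤
      ∑' q : ℕ × ℤ, c q.1 * w q.1 q.2 := by
    rw [lintegral_tsum fun q => (measurable_const.indicator (hTm q)).aemeasurable]
    refine ENNReal.tsum_le_tsum fun q => ?_
    rw [lintegral_indicator_const (hTm q)]
    gcongr
    exact (Measure.restrict_apply_le _ _).trans (volume_setOf_le_ofReal_lt_add_le _ _)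
  obtain ⟨t, ht, hle⟩ := exists_notMem_null_le_lintegral (μ := μ) (N := (Ico 0 1)ᶜ)
    (f := fun t => ∑' q, (T q).indicator (fun _ => c q.1) t)
    (Measurable.tsum fun q => measurable_const.indicator (hTm q)).aemeasurable
    (by simp [hμ])
  rw [notMem_compl_iff] at ht
  refine ⟨{q | t ∈ T q}, fun y hy => ?_, ?_⟩
  · have hlt : ENNReal.ofReal t < ∑' k, w k ⌊(2 : ℝ) ^ k * y⌋ :=
      (ENNReal.ofReal_lt_one.2 ht.2).trans_le (hY y hy)
    rw [ENNReal.tsum_eq_iSup_nat, lt_iSup_iff] at hlt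
    simp_rw [← ancestorWeight_floor] at hlt
    classical
    obtain ⟨n, hn, hmin⟩ : ∃ n, ENNReal.ofReal t < ancestorWeight w n ⌊(2 : ℝ) ^ n * y⌋ ∧
        ∀ k < n, ¬ ENNReal.ofReal t < ancestorWeight w k ⌊(2 : ℝ) ^ k * y⌋ :=
      ⟨Nat.find hlt, Nat.find_spec hlt, fun k hk => Nat.find_min hlt hk⟩
    cases n with
    | zero => simp [ancestorWeight] at hn
    | succ k =>
      rw [ancestorWeight, floor_two_pow_succ_div_two] at hn
      exact ⟨k, ht.1, not_lt.1 (hmin k k.lt_succ_self), hn⟩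
  · exact hle.trans hint

/-- A null set for `μH[p]`, `p > 0`, has covers with small positive radii and small cost. -/
lemma exists_cover_of_hausdorffMeasure_eq_zero {X : Type*} [EMetricSpace X] [MeasurableSpace X]
    [BorelSpace X] {p : ℝ} (hp : 0 < p) {A : Set X} (hA : μH[p] A = 0) {δ : ℝ} (hδ : 0 < δ)
    {ε : ℝ≥0∞} (hε : ε ≠ 0) :
    ∃ (E : ℕ → Set X) (r : ℕ → ℝ), A ⊆ ⋃ i, E i ∧ (∀ i, 0 < r i) ∧ (∀ i, r i ≤ δ) ∧
      (∀ i, Metric.ediam (E i) ≤ ENNReal.ofReal (r i)) ∧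
      ∑' i, ENNReal.ofReal (r i) ^ p ≤ ε := by
  have hε2 : ε / 2 ≠ 0 := (ENNReal.half_pos hε).ne'
  have hδ2 : 0 < ENNReal.ofReal (δ / 2) := ENNReal.ofReal_pos.2 (half_pos hδ)
  rw [Measure.hausdorffMeasure_apply] at hA
  have h1 := (le_iSup₂ (f := fun (r : ℝ≥0∞) (_ : 0 < r) => ⨅ (t : ℕ → Set X) (_ : A ⊆ ⋃ n, t n)
    (_ : ∀ n, Metric.ediam (t n) ≤ r), ∑' n, ⨆ _ : (t n).Nonempty, Metric.ediam (t n) ^ p)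
    _ hδ2).trans hA.le
  have h2 := h1.trans_lt (pos_iff_ne_zero.2 hε2)
  simp only [iInf_lt_iff] at h2
  obtain ⟨E, hAE, hE, hsum⟩ := h2
  obtain ⟨e, he, hesum⟩ := ENNReal.exists_pos_sum_of_countable hε2 ℕ
  have key : ∀ i, ∃ r : ℝ, 0 < r ∧ r ≤ δ ∧ Metric.ediam (E i) ≤ ENNReal.ofReal r ∧
      ENNReal.ofReal r ^ p ≤ (⨆ _ : (E i).Nonempty, Metric.ediam (E i) ^ p) + e i := by
    intro i
    set d := Metric.ediam (E i) with hd
    have hdp : d ^ p ≤ ⨆ _ : (E i).Nonempty, d ^ p := by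
      rcases (E i).eq_empty_or_nonempty with h | h
      · simp [hd, h, hp]
      · simp [h]
    have hdδ : d < ENNReal.ofReal δ := (hE i).trans_lt
      ((ENNReal.ofReal_lt_ofReal_iff hδ).2 (half_lt_self hδ))
    have hdt : d ≠ ∞ := hdδ.ne_top
    have hlt : d ^ p < d ^ p + e i :=
      ENNReal.lt_add_right (ENNReal.rpow_ne_top_of_nonneg hp.le hdt) (by simpa using (he i).ne')
    have hev : ∀ᶠ x in nhdsWithin d (Ioi d), x ^ p < d ^ p + e i :=
      ((ENNReal.continuous_rpow_const (y := p)).tendsto d).eventually_lt_const hlt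
        |>.filter_mono nhdsWithin_le_nhds
    have : (nhdsWithin d (Ioi d)).NeBot := nhdsGT_neBot_of_exists_gt ⟨_, hdδ⟩
    obtain ⟨x, hx, hdx, hxδ⟩ := (hev.and (Ioo_mem_nhdsGT hdδ)).exists
    have hxt : x ≠ ∞ := hxδ.ne_top
    refine ⟨x.toReal, ENNReal.toReal_pos (pos_of_gt hdx).ne' hxt, ?_, ?_, ?_⟩
    · exact ENNReal.toReal_le_of_le_ofReal hδ.le hxδ.le
    · rw [ENNReal.ofReal_toReal hxt]; exact hdx.le
    · rw [ENNReal.ofReal_toReal hxt]; exact hx.le.trans (by gcongr)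
  choose r hr0 hrδ hrd hrp using key
  refine ⟨E, r, hAE, hr0, hrδ, hrd, ?_⟩
  calc ∑' i, ENNReal.ofReal (r i) ^ p
      ≤ ∑' i, ((⨆ _ : (E i).Nonempty, Metric.ediam (E i) ^ p) + e i) :=
        ENNReal.tsum_le_tsum hrp
    _ = (∑' i, ⨆ _ : (E i).Nonempty, Metric.ediam (E i) ^ p) + ∑' i, (e i : ℝ≥0∞) :=
        ENNReal.tsum_add
    _ ≤ ε / 2 + ε / 2 := add_le_add hsum.le hesum.le
    _ = ε := ENNReal.add_halves ε

lemma hausdorffMeasure_eq_zero_of_forall_exists_cover {X ι : Type*} [EMetricSpace X]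
    [MeasurableSpace X] [BorelSpace X] [Countable ι] {m : ℝ} (hm : 0 < m) {Y : Set X}
    (h : ∀ η : ℝ≥0∞, η ≠ 0 → ∃ t : ι → Set X, Y ⊆ ⋃ i, t i ∧ ∑' i, Metric.ediam (t i) ^ m ≤ η) :
    μH[m] Y = 0 := by
  have h' : ∀ n : ℕ, ∃ t : ι → Set X, Y ⊆ ⋃ i, t i ∧
      ∑' i, Metric.ediam (t i) ^ m ≤ ((n : ℝ≥0∞))⁻¹ := fun n => h _ (by simp)
  choose t ht hsum using h'
  have hlim := ENNReal.tendsto_inv_nat_nhds_zero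
  have hr : Filter.Tendsto (fun n : ℕ => ((n : ℝ≥0∞)⁻¹) ^ (m⁻¹)) Filter.atTop (nhds 0) := by
    have := ((ENNReal.continuous_rpow_const (y := m⁻¹)).tendsto 0).comp hlim
    rwa [ENNReal.zero_rpow_of_pos (inv_pos.2 hm)] at this
  have := Measure.hausdorffMeasure_le_liminf_tsum m Y (fun n : ℕ => ((n : ℝ≥0∞)⁻¹) ^ (m⁻¹)) hr t
    (Filter.Eventually.of_forall fun n i => ?_) (Filter.Eventually.of_forall ht)
  · refine le_antisymm (this.trans ?_) zero_le
    calc _ ≤ Filter.liminf (fun n : ℕ => ((n : ℝ≥0∞)⁻¹)) Filter.atTop :=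
          Filter.liminf_le_liminf (Filter.Eventually.of_forall hsum)
      _ = 0 := hlim.liminf_eq
  · rw [← ENNReal.rpow_le_rpow_iff hm, ENNReal.rpow_inv_rpow hm.ne']
    exact (ENNReal.le_tsum i).trans (hsum n)

lemma ediam_setOf_floor_eq_le (k : ℕ) (z : ℤ) :
    Metric.ediam {y : ℝ | ⌊(2 : ℝ) ^ k * y⌋ = z} ≤ ENNReal.ofReal ((1 / 2) ^ k) := by
  refine Metric.ediam_le fun x hx y hy => ?_
  rw [edist_dist, Real.dist_eq]
  refine ENNReal.ofReal_le_ofReal ?_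
  have h := Int.abs_sub_lt_one_of_floor_eq_floor (hx.trans hy.symm)
  rw [← mul_sub, abs_mul, abs_of_pos (by positivity : (0 : ℝ) < 2 ^ k)] at h
  rw [one_div, inv_pow, ← one_div, le_div_iff₀' (by positivity)]
  exact h.le

lemma floor_two_pow_mem_Icc {k : ℕ} {x y L : ℝ} (hL : L ≤ (1 / 2) ^ k) (h : |y - x| ≤ L) :
    ⌊(2 : ℝ) ^ k * y⌋ ∈ Finset.Icc (⌊(2 : ℝ) ^ k * x⌋ - 1) (⌊(2 : ℝ) ^ k * x⌋ + 1) := by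
  have h1 := h.trans hL
  rw [one_div, inv_pow, ← one_div, le_div_iff₀' (by positivity),
    ← abs_of_pos (by positivity : (0 : ℝ) < 2 ^ k), ← abs_mul, mul_sub,
    abs_le] at h1
  rw [Finset.mem_Icc, ← Int.floor_sub_one, ← Int.floor_add_one]
  exact ⟨Int.floor_le_floor (by linarith), Int.floor_le_floor (by linarith)⟩

open Classical in
/-- Sets with weighted covers by balls of arbitrarily small `m`-dimensional cost are `μH[m]`-null. -/
lemma hausdorffMeasure_eq_zero_of_weighted_cover {m : ℝ} (hm : 0 < m) {Y : Set ℝ}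
    (h : ∀ η : ℝ≥0∞, η ≠ 0 → ∃ (x L : ℕ → ℝ) (v : ℕ → ℝ≥0∞), (∀ i, 0 < L i) ∧ (∀ i, L i ≤ 1) ∧
      (∀ y ∈ Y, 1 ≤ ∑' i, if |y - x i| ≤ L i then v i else 0) ∧
      ∑' i, v i * ENNReal.ofReal (L i) ^ m ≤ η) :
    μH[m] Y = 0 := by
  refine hausdorffMeasure_eq_zero_of_forall_exists_cover (ι := ℕ × ℤ) hm fun η hη => ?_
  have hK0 : (3 * 2 ^ m : ℝ≥0∞) ≠ 0 := by simp
  have hKt : (3 * 2 ^ m : ℝ≥0∞) ≠ ∞ :=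
    ENNReal.mul_ne_top (by simp) (ENNReal.rpow_ne_top_of_nonneg hm.le (by simp))
  obtain ⟨x, L, v, hL0, hL1, hcov, hsum⟩ := h (η / (3 * 2 ^ m)) (ENNReal.div_ne_zero.2 ⟨hη, hKt⟩)
  have hk : ∀ i, ∃ k : ℕ, L i ≤ (1 / 2) ^ k ∧ (1 / 2) ^ k ≤ 2 * L i := by
    intro i
    obtain ⟨k, h1, h2⟩ := exists_nat_pow_near_of_lt_one (hL0 i) (hL1 i)
      (by norm_num : (0 : ℝ) < 1 / 2) (by norm_num)
    exact ⟨k, h2, by rw [pow_succ] at h1; linarith⟩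
  choose k hkL hkU using hk
  set S : ℕ → Finset (ℕ × ℤ) := fun i =>
    {k i} ×ˢ Finset.Icc (⌊(2 : ℝ) ^ k i * x i⌋ - 1) (⌊(2 : ℝ) ^ k i * x i⌋ + 1) with hS
  set c : ℕ → ℝ≥0∞ := fun j => ENNReal.ofReal ((1 / 2) ^ j) ^ m with hc
  obtain ⟨B, hBY, hB⟩ := exists_dyadic_cover (fun j z => ∑' i, if (j, z) ∈ S i then v i else 0) c Y
    (fun y hy => (hcov y hy).trans (by
      rw [ENNReal.tsum_comm]
      refine ENNReal.tsum_le_tsum fun i => ?_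
      split_ifs with hi
      · refine le_trans ?_ (ENNReal.le_tsum (k i))
        rw [if_pos]
        simpa [hS] using floor_two_pow_mem_Icc (hkL i) hi
      · exact zero_le))
  refine ⟨fun q => if q ∈ B then {y : ℝ | ⌊(2 : ℝ) ^ q.1 * y⌋ = q.2} else ∅, fun y hy => ?_, ?_⟩
  · obtain ⟨j, hj⟩ := hBY y hy
    exact mem_iUnion.2 ⟨_, by rw [if_pos hj]; rfl⟩
  calc _ ≤ ∑' q, B.indicator (fun q => c q.1) q := by
        refine ENNReal.tsum_le_tsum fun q => ?_
        by_cases hq : q ∈ B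
        · simp only [if_pos hq, indicator_of_mem hq]
          exact ENNReal.rpow_le_rpow (ediam_setOf_floor_eq_le _ _) hm.le
        · simp [hq, hm]
    _ ≤ _ := hB
    _ = ∑' (i : ℕ) (q : ℕ × ℤ), if q ∈ S i then c q.1 * v i else 0 := by
        rw [ENNReal.tsum_comm]
        simp_rw [← ENNReal.tsum_mul_left, mul_ite, mul_zero]
    _ ≤ ∑' i, 3 * 2 ^ m * (v i * ENNReal.ofReal (L i) ^ m) := by
        refine ENNReal.tsum_le_tsum fun i => ?_
        rw [tsum_eq_sum (s := S i) fun q hq => if_neg hq, Finset.sum_congr rfl fun q hq => if_pos hq]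
        have hck : c (k i) ≤ 2 ^ m * ENNReal.ofReal (L i) ^ m := by
          rw [← ENNReal.mul_rpow_of_nonneg _ _ hm.le]
          refine ENNReal.rpow_le_rpow ?_ hm.le
          have := ENNReal.ofReal_le_ofReal (hkU i)
          rwa [ENNReal.ofReal_mul zero_le_two, ENNReal.ofReal_ofNat] at this
        calc ∑ q ∈ S i, c q.1 * v i = 3 * (c (k i) * v i) := by
              rw [hS, Finset.sum_product, Finset.sum_singleton]
              dsimp only
              rw [Finset.sum_const, nsmul_eq_mul, Int.card_Icc,
                show ∀ a : ℤ, (a + 1 + 1 - (a - 1)).toNat = 3 from fun a => by omega]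
              rfl
          _ ≤ 3 * (2 ^ m * ENNReal.ofReal (L i) ^ m * v i) := by gcongr
          _ = _ := by ring
    _ ≤ 3 * 2 ^ m * (η / (3 * 2 ^ m)) := by
        rw [ENNReal.tsum_mul_left]
        gcongr
    _ = η := ENNReal.mul_div_cancel hK0 hKt

/-- **Hölder coarea positivity.** If `f` satisfies a Hölder condition of exponent
`s ≥ 1` with constant `C` on `A ⊆ ℝ`, and `Y ⊆ ℝ` has positive `m`-dimensional
Hausdorff measure while `A ∩ f⁻¹(y)` has positive `κ`-dimensional Hausdorff measure
for every `y ∈ Y`, then `A` has positive `(κ + s·m)`-dimensional Hausdorff measure. -/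
theorem hausdorffMeasure_pos_of_holder_level_sets (s C : ℝ) (hs : 1 ≤ s)
    (hC : 0 ≤ C) (A : Set ℝ) (f : ℝ → ℝ)
    (hf : ∀ x₁ ∈ A, ∀ x₂ ∈ A, |f x₁ - f x₂| ≤ C * |x₁ - x₂| ^ s)
    (κ m : ℝ) (hκ : 0 ≤ κ) (hm : 0 ≤ m) (Y : Set ℝ) (hY : 0 < μH[m] Y)
    (hlevel : ∀ y ∈ Y, 0 < μH[κ] (A ∩ f ⁻¹' {y})) :
    0 < μH[κ + s * m] A := by
  rcases hm.eq_or_lt with rfl | hm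
  · obtain ⟨y, hy⟩ : Y.Nonempty := nonempty_of_measure_ne_zero hY.ne'
    simpa using (hlevel y hy).trans_le (measure_mono inter_subset_left)
  have hs0 : 0 < s := one_pos.trans_le hs
  rw [pos_iff_ne_zero]
  intro hA
  refine hY.ne' ?_
  set Z : ℕ → Set ℝ := fun n => {y | ∀ t : ℕ → Set ℝ, A ∩ f ⁻¹' {y} ⊆ ⋃ i, t i →
    (∀ i, Metric.ediam (t i) ≤ ENNReal.ofReal (1 / (n + 1))) →
    ENNReal.ofReal (1 / (n + 1)) ≤ ∑' i, ⨆ _ : (t i).Nonempty, Metric.ediam (t i) ^ κ} with hZ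
  have hYZ : Y ⊆ ⋃ n, Z n := by
    intro y hy
    have h := hlevel y hy
    rw [Measure.hausdorffMeasure_apply] at h
    simp only [lt_iSup_iff] at h
    obtain ⟨r, hr, h⟩ := h
    have hlim : Filter.Tendsto (fun n : ℕ => ENNReal.ofReal (1 / ((n : ℝ) + 1))) Filter.atTop
        (nhds 0) := by
      simpa using ENNReal.tendsto_ofReal (tendsto_one_div_add_atTop_nhds_zero_nat (𝕜 := ℝ))
    obtain ⟨n, hn1, hn2⟩ := ((hlim.eventually_lt_const hr).and (hlim.eventually_lt_const h)).exists
    refine mem_iUnion.2 ⟨n, fun t ht htd => hn2.le.trans ?_⟩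
    exact (iInf_le_of_le t <| iInf_le_of_le ht <|
      iInf_le_of_le (fun i => (htd i).trans hn1.le) le_rfl)
  refine measure_mono_null hYZ (measure_iUnion_null fun n => ?_)
  refine hausdorffMeasure_eq_zero_of_weighted_cover hm fun η hη => ?_
  set K : ℝ := max C 1 with hK
  have hK1 : 1 ≤ K := le_max_right _ _
  have hK0 : 0 < K := one_pos.trans_le hK1
  set δ : ℝ := min (1 / (n + 1)) (1 / K) with hδ
  have hδ0 : 0 < δ := lt_min (by positivity) (by positivity)
  set M : ℝ≥0∞ := ENNReal.ofReal (n + 1) * ENNReal.ofReal K ^ m with hM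
  have hMt : M ≠ ∞ := ENNReal.mul_ne_top (by simp) (ENNReal.rpow_ne_top_of_nonneg hm.le (by simp))
  have hM0 : M ≠ 0 := by
    refine mul_ne_zero (ENNReal.ofReal_pos.2 (by positivity)).ne' ?_
    exact (ENNReal.rpow_pos (ENNReal.ofReal_pos.2 hK0) (by simp)).ne'
  obtain ⟨E, r, hAE, hr0, hrδ, hrd, hsum⟩ := exists_cover_of_hausdorffMeasure_eq_zero
    (by positivity : 0 < κ + s * m) hA hδ0 (ENNReal.div_ne_zero.2 ⟨hη, hMt⟩ : η / M ≠ 0)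
  have ha : ∀ i, ∃ a, (E i ∩ A).Nonempty → a ∈ E i ∩ A := fun i => by
    rcases (E i ∩ A).eq_empty_or_nonempty with h | ⟨a, ha⟩
    · exact ⟨0, fun h' => absurd h h'.ne_empty⟩
    · exact ⟨a, fun _ => ha⟩
  choose a ha using ha
  refine ⟨fun i => f (a i), fun i => K * r i ^ s,
    fun i => ENNReal.ofReal (n + 1) * ENNReal.ofReal (r i) ^ κ, fun i => ?_, fun i => ?_,
    fun y hy => ?_, ?_⟩
  · have := hr0 i
    positivity
  · have h1 : r i ≤ 1 / K := (hrδ i).trans (min_le_right _ _)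
    have h2 : r i ^ s ≤ r i := by
      refine Real.rpow_le_self_of_le_one (hr0 i).le (h1.trans ?_) hs
      exact (div_le_one hK0).2 hK1
    calc K * r i ^ s ≤ K * (1 / K) := by gcongr; exact h2.trans h1
      _ = 1 := mul_one_div_cancel hK0.ne'
  · have hy' := hy (fun i => E i ∩ (A ∩ f ⁻¹' {y}))
      (by rw [← iUnion_inter]; exact subset_inter (inter_subset_left.trans hAE) le_rfl)
      (fun i => (Metric.ediam_mono inter_subset_left).trans ((hrd i).trans
        (ENNReal.ofReal_le_ofReal ((hrδ i).trans (min_le_left _ _)))))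
    calc (1 : ℝ≥0∞) = ENNReal.ofReal (n + 1) * ENNReal.ofReal (1 / (n + 1)) := by
          rw [← ENNReal.ofReal_mul (by positivity), mul_one_div_cancel (by positivity),
            ENNReal.ofReal_one]
      _ ≤ ENNReal.ofReal (n + 1) * _ := mul_le_mul_right hy' _
      _ ≤ _ := by
          rw [← ENNReal.tsum_mul_left]
          refine ENNReal.tsum_le_tsum fun i => ?_
          rcases (E i ∩ (A ∩ f ⁻¹' {y})).eq_empty_or_nonempty with h | ⟨b, hbE, hbA, hby⟩
          · simp [h]
          have hai := ha i ⟨b, hbE, hbA⟩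
          rw [if_pos]
          · refine mul_le_mul_right (iSup_le fun _ => ?_) _
            exact ENNReal.rpow_le_rpow ((Metric.ediam_mono inter_subset_left).trans (hrd i)) hκ
          · have hd : |b - a i| ≤ r i := by
              have := (Metric.edist_le_ediam_of_mem hbE hai.1).trans (hrd i)
              rwa [edist_dist, ENNReal.ofReal_le_ofReal_iff (hr0 i).le, Real.dist_eq] at this
            rw [← mem_singleton_iff.1 hby]
            calc |f b - f (a i)| ≤ C * |b - a i| ^ s := hf _ hbA _ hai.2
              _ ≤ K * r i ^ s := by gcongr; exact le_max_left _ _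
  · calc _ = ∑' i, M * ENNReal.ofReal (r i) ^ (κ + s * m) := by
          refine tsum_congr fun i => ?_
          have hri : ENNReal.ofReal (r i) ≠ 0 := (ENNReal.ofReal_pos.2 (hr0 i)).ne'
          rw [ENNReal.ofReal_mul hK0.le, ← ENNReal.ofReal_rpow_of_pos (hr0 i),
            ENNReal.mul_rpow_of_nonneg _ _ hm.le, ← ENNReal.rpow_mul,
            ENNReal.rpow_add _ _ hri ENNReal.ofReal_ne_top, hM]
          ring
      _ ≤ M * (η / M) := by
          rw [ENNReal.tsum_mul_left]
          gcongr
      _ = η := ENNReal.mul_div_cancel hM0 hMt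
end
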